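/- Fix an integer ℓ ≥ 2 and a vector 𝐦 = (𝐦_S) of nonnegative integers indexed by unordered pairs of distinct elements of [ℓ], not all zero, and set σ = Σ_S 𝐦_S. There exist a constant C > 0 and an integer N such that for every n ≥ N and every extremal 𝐦-overlapping tuple 𝓕_1,…,𝓕_ℓ of families of subsets of [n] the following holds: there exist an oriented graph T on vertex set [ℓ] whose underlying undirected edges are exactly the pairs {k1,k2} with 𝐦_{k1,k2} > 0 (each such pair carrying exactly one of the two orientations, and no other arcs), and pairwise disjoint sets A_e ⊆ [n] indexed by the arcs e of T whose union is [n], such that: (i) for every arc e over the pair S, | |A_e| − 𝐦_S·n/σ | ≤ C; and (ii) for every k ∈ [ℓ], every set of the form B ∪ T' — where B ⊆ ⋃_{k' : (k',k) is an arc of T} A_{(k',k)} and T' ⊆ ⋃_{k' : (k,k') is an arc of T} A_{(k,k')} with |T' ∩ A_{(k,k')}| ≤ 𝐦_{k,k'} for each such k' — belongs to 𝓕_k. -/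

import Mathlib

open scoped Classical

noncomputable section

/-- The `𝐦`-overlapping property. -/
def Overlap {n ℓ : ℕ} (m : Fin ℓ → Fin ℓ → ℕ) (F : Fin ℓ → Finset (Finset (Fin n))) : Prop :=
  ∀ k1 k2 : Fin ℓ, k1 ≠ k2 → ∀ A ∈ F k1, ∀ B ∈ F k2, (A ∩ B).card ≤ m k1 k2

/-- An `𝐦`-overlapping tuple maximizing the product of cardinalities. -/
def Extremal {n ℓ : ℕ} (m : Fin ℓ → Fin ℓ → ℕ) (F : Fin ℓ → Finset (Finset (Fin n))) : Prop :=
  Overlap m F ∧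
    ∀ G : Fin ℓ → Finset (Finset (Fin n)), Overlap m G →
      ∏ k, (G k).card ≤ ∏ k, (F k).card

/-- The set of (representatives of) unordered pairs of distinct elements of `[ℓ]`. -/
def pairs (ℓ : ℕ) : Finset (Fin ℓ × Fin ℓ) :=
  (Finset.univ : Finset (Fin ℓ × Fin ℓ)).filter (fun p => p.1 < p.2)

section

open Finset
open Filter (atTop Tendsto)
open scoped FinsetFamily

lemma card_small_subsets {α : Type*} (S : Finset α) (b : ℕ) :
    (S.powerset.filter (fun A => A.card ≤ b)).card ≤ (S.card + 1) ^ b := by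
  induction b with
  | zero =>
    have : S.powerset.filter (fun A => A.card ≤ 0) ⊆ {∅} := by
      intro A hA
      simp only [nonpos_iff_eq_zero, card_eq_zero, mem_filter] at hA
      simp [hA.2]
    simpa using card_le_card this
  | succ b ih =>
    have h1 : S.powerset.filter (fun A => A.card ≤ b + 1)
        ⊆ S.powerset.filter (fun A => A.card ≤ b) ∪ S.powersetCard (b + 1) := by
      intro A hA
      simp only [mem_filter, mem_powerset, mem_union, mem_powersetCard] at hA ⊢
      rcases Nat.lt_or_ge b A.card with h | h
      · exact Or.inr ⟨hA.1, by omega⟩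
      · exact Or.inl ⟨hA.1, h⟩
    have h2 := (card_le_card h1).trans (card_union_le _ _)
    rw [card_powersetCard] at h2
    have h3 : S.card.choose (b + 1) ≤ S.card ^ (b + 1) := Nat.choose_le_pow _ _
    have h4 : S.card ^ (b + 1) ≤ S.card * (S.card + 1) ^ b := by
      rw [pow_succ, mul_comm]
      exact Nat.mul_le_mul_left _ (Nat.pow_le_pow_left (by omega) b)
    calc _ ≤ _ := h2
      _ ≤ (S.card + 1) ^ b + S.card * (S.card + 1) ^ b := by omega
      _ = (S.card + 1) ^ (b + 1) := by ring

lemma card_filter_card_le {n : ℕ} (H : Finset (Finset (Fin n))) (b : ℕ)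
    (h : ∀ A ∈ H, A.card ≤ b) : H.card ≤ (n + 1) ^ b := by
  have := card_small_subsets (univ : Finset (Fin n)) b
  rw [card_univ, Fintype.card_fin] at this
  refine (card_le_card ?_).trans this
  intro A hA
  simp [h A hA]

section basics
variable {n ℓ : ℕ} {m : Fin ℓ → Fin ℓ → ℕ} {F : Fin ℓ → Finset (Finset (Fin n))}

lemma Extremal.card_pos (hF : Extremal m F) (k : Fin ℓ) : 0 < (F k).card := by
  have h := hF.2 (fun _ => {∅}) (by
    intro k1 k2 _ A hA B hB
    simp only [mem_singleton] at hA
    simp [hA])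
  simp only [card_singleton, prod_const_one] at h
  have : ∏ k, (F k).card ≠ 0 := by omega
  rw [prod_ne_zero_iff] at this
  exact Nat.pos_of_ne_zero (this k (mem_univ k))

lemma prod_update_insert_le (hF : Extremal m F) (k : Fin ℓ) (A : Finset (Fin n))
    (hsym : ∀ k1 k2, m k1 k2 = m k2 k1)
    (hA : ∀ j, j ≠ k → ∀ B ∈ F j, (A ∩ B).card ≤ m k j) : A ∈ F k := by
  by_contra hn
  have hO : Overlap m (Function.update F k (insert A (F k))) := by
    intro k1 k2 hne X hX Y hY
    by_cases h1 : k1 = k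
    · subst h1
      rw [Function.update_self] at hX
      rw [Function.update_of_ne hne.symm] at hY
      rcases mem_insert.1 hX with rfl | hX
      · exact hA k2 hne.symm Y hY
      · exact hF.1 k1 k2 hne X hX Y hY
    · rw [Function.update_of_ne h1] at hX
      by_cases h2 : k2 = k
      · subst h2
        rw [Function.update_self] at hY
        rcases mem_insert.1 hY with rfl | hY
        · rw [inter_comm, hsym]
          exact hA k1 h1 X hX
        · exact hF.1 k1 k2 hne X hX Y hY
      · rw [Function.update_of_ne h2] at hY
        exact hF.1 k1 k2 hne X hX Y hY
  have h := hF.2 _ hO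
  rw [← mul_prod_erase univ _ (mem_univ k), ← mul_prod_erase univ (fun k => (F k).card) (mem_univ k)] at h
  have e : ∏ x ∈ univ.erase k, (Function.update F k (insert A (F k)) x).card
      = ∏ x ∈ univ.erase k, (F x).card := by
    refine prod_congr rfl fun x hx => ?_
    rw [Function.update_of_ne (ne_of_mem_erase hx)]
  rw [e, Function.update_self, card_insert_of_notMem hn] at h
  have hp : 0 < ∏ x ∈ univ.erase k, (F x).card := prod_pos fun x _ => hF.card_pos x
  have := Nat.le_of_mul_le_mul_right h hp
  omega

lemma Extremal.down (hF : Extremal m F) (hsym : ∀ k1 k2, m k1 k2 = m k2 k1) {k : Fin ℓ}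
    {A B : Finset (Fin n)} (hA : A ∈ F k) (hB : B ⊆ A) : B ∈ F k := by
  refine prod_update_insert_le hF k B hsym fun j hj X hX => ?_
  exact (card_le_card (inter_subset_inter hB le_rfl)).trans (hF.1 k j hj.symm A hA X hX)

/-- Upper bound for a product of cardinalities of an overlapping tuple, over a set of indices. -/
lemma prod_card_le_aux (hF : Overlap m F) (hsym : ∀ k1 k2, m k1 k2 = m k2 k1) (s : Finset (Fin ℓ)) :
    ∏ k ∈ s, (F k).card ≤
      ((univ : Finset (Finset (Fin n))).filter
        (fun A => ∃ f : Fin ℓ → Finset (Fin n), (∀ k ∈ s, f k ∈ F k) ∧ A = s.biUnion f)).card *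
      (n + 1) ^ (∑ j ∈ s, ∑ k ∈ s.filter (· < j), m k j) := by
  induction s using Finset.induction_on_max with
  | empty => simpa using ⟨∅, by simp⟩
  | insert a s ha ih =>
    have hna : a ∉ s := fun h => lt_irrefl _ (ha a h)
    have hne : ∀ k ∈ s, k ≠ a := fun k hk => (ha k hk).ne
    rw [prod_insert hna]
    set H := (univ : Finset (Finset (Fin n))).filter
        (fun A => ∃ f : Fin ℓ → Finset (Fin n), (∀ k ∈ s, f k ∈ F k) ∧ A = s.biUnion f) with hH
    set H' := (univ : Finset (Finset (Fin n))).filter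
        (fun A => ∃ f : Fin ℓ → Finset (Fin n), (∀ k ∈ insert a s, f k ∈ F k) ∧
          A = (insert a s).biUnion f) with hH'
    have hexp : (∑ j ∈ insert a s, ∑ k ∈ (insert a s).filter (· < j), m k j)
        = ∑ k ∈ s, m k a + ∑ j ∈ s, ∑ k ∈ s.filter (· < j), m k j := by
      rw [sum_insert hna]
      congr 1
      · refine sum_congr ?_ fun _ _ => rfl
        ext x
        simp only [mem_filter, mem_insert]
        constructor
        · rintro ⟨rfl | h, h2⟩
          · exact absurd h2 (lt_irrefl _)
          · exact h
        · exact fun h => ⟨Or.inr h, ha x h⟩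
      · refine sum_congr rfl fun j hj => sum_congr ?_ fun _ _ => rfl
        ext x
        simp only [mem_filter, mem_insert]
        constructor
        · rintro ⟨rfl | h, h2⟩
          · exact absurd (h2.trans (ha j hj)) (lt_irrefl _)
          · exact ⟨h, h2⟩
        · exact fun h => ⟨Or.inr h.1, h.2⟩
    have hsup : (F a ⊻ H).card ≤ H'.card := by
      refine card_le_card fun X hX => ?_
      obtain ⟨A, hA, B, hB, rfl⟩ := mem_sups.1 hX
      obtain ⟨f, hf, rfl⟩ := (mem_filter.1 hB).2
      refine mem_filter.2 ⟨mem_univ _, Function.update f a A, ?_, ?_⟩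
      · intro k hk
        rcases mem_insert.1 hk with rfl | hk
        · simpa using hA
        · rw [Function.update_of_ne (hne k hk)]
          exact hf k hk
      · rw [biUnion_insert, Function.update_self]
        congr 1
        refine biUnion_congr rfl fun k hk => ?_
        rw [Function.update_of_ne (hne k hk)]
    have hinf : (F a ⊼ H).card ≤ (n + 1) ^ (∑ k ∈ s, m k a) := by
      refine card_filter_card_le _ _ fun X hX => ?_
      obtain ⟨A, hA, B, hB, rfl⟩ := mem_infs.1 hX
      obtain ⟨f, hf, rfl⟩ := (mem_filter.1 hB).2
      change (A ∩ s.biUnion f).card ≤ _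
      rw [inter_biUnion]
      refine card_biUnion_le.trans (sum_le_sum fun k hk => ?_)
      rw [hsym]
      exact hF a k (hne k hk).symm A hA _ (hf k hk)
    calc (F a).card * ∏ k ∈ s, (F k).card
        ≤ (F a).card * (H.card * (n + 1) ^ (∑ j ∈ s, ∑ k ∈ s.filter (· < j), m k j)) :=
          Nat.mul_le_mul_left _ ih
      _ = ((F a).card * H.card) * (n + 1) ^ (∑ j ∈ s, ∑ k ∈ s.filter (· < j), m k j) := by ring
      _ ≤ ((F a ⊼ H).card * (F a ⊻ H).card) *
            (n + 1) ^ (∑ j ∈ s, ∑ k ∈ s.filter (· < j), m k j) :=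
          Nat.mul_le_mul_right _ (le_card_infs_mul_card_sups _ _)
      _ ≤ ((n + 1) ^ (∑ k ∈ s, m k a) * H'.card) *
            (n + 1) ^ (∑ j ∈ s, ∑ k ∈ s.filter (· < j), m k j) := by gcongr
      _ = _ := by rw [hexp, pow_add]; ring

lemma sum_pairs (f : Fin ℓ → Fin ℓ → ℕ) :
    ∑ q ∈ pairs ℓ, f q.1 q.2 = ∑ j, ∑ k ∈ univ.filter (· < j), f k j := by
  unfold pairs
  rw [sum_filter, ← univ_product_univ, sum_product_right]
  refine sum_congr rfl fun j _ => ?_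
  rw [sum_filter]

lemma prod_card_le (hF : Overlap m F) (hsym : ∀ k1 k2, m k1 k2 = m k2 k1) :
    ∏ k, (F k).card ≤ 2 ^ n * (n + 1) ^ (∑ q ∈ pairs ℓ, m q.1 q.2) := by
  rw [sum_pairs]
  refine (prod_card_le_aux hF hsym univ).trans (Nat.mul_le_mul_right _ ?_)
  refine (card_filter_le _ _).trans ?_
  simp

/-- Upper bound for links. -/
lemma prod_link_le (hF : Overlap m F) (hsym : ∀ k1 k2, m k1 k2 = m k2 k1)
    (D : Fin ℓ → Finset (Fin n)) :
    (∏ k, ((F k).filter (D k ⊆ ·)).card) * (n + 1) ^ (∑ q ∈ pairs ℓ, (D q.1 ∩ D q.2).card) ≤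
      2 ^ n * (n + 1) ^ (∑ q ∈ pairs ℓ, m q.1 q.2) := by
  by_cases hz : ∃ k, ((F k).filter (D k ⊆ ·)).card = 0
  · obtain ⟨k, hk⟩ := hz
    rw [prod_eq_zero (mem_univ k) hk]
    simp
  · push Not at hz
    have hD : ∀ k j, k ≠ j → (D k ∩ D j).card ≤ m k j := by
      intro k j hkj
      obtain ⟨A, hA⟩ := card_ne_zero.1 (hz k)
      obtain ⟨B, hB⟩ := card_ne_zero.1 (hz j)
      rw [mem_filter] at hA hB
      exact (card_le_card (inter_subset_inter hA.2 hB.2)).trans (hF k j hkj A hA.1 B hB.1)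
    have hO : Overlap (fun k j => m k j - (D k ∩ D j).card)
        (fun k => ((F k).filter (D k ⊆ ·)).image (· \ D k)) := by
      intro k j hkj X hX Y hY
      obtain ⟨A, hA, rfl⟩ := mem_image.1 hX
      obtain ⟨B, hB, rfl⟩ := mem_image.1 hY
      rw [mem_filter] at hA hB
      have h1 := hF k j hkj A hA.1 B hB.1
      have h2 : ((A \ D k) ∩ (B \ D j)).card + (D k ∩ D j).card ≤ (A ∩ B).card := by
        rw [← card_union_of_disjoint]
        · refine card_le_card (union_subset ?_ (inter_subset_inter hA.2 hB.2))
          exact inter_subset_inter sdiff_subset sdiff_subset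
        · rw [disjoint_left]
          intro x hx hx'
          simp only [mem_inter, mem_sdiff] at hx hx'
          exact hx.1.2 hx'.1
      change _ ≤ m k j - (D k ∩ D j).card
      omega
    have h := prod_card_le hO (fun k1 k2 => by rw [hsym, inter_comm])
    have hc : ∀ k, (((F k).filter (D k ⊆ ·)).image (· \ D k)).card
        = ((F k).filter (D k ⊆ ·)).card := by
      intro k
      refine card_image_of_injOn fun A hA B hB hAB => ?_
      have hA' := (mem_filter.1 hA).2
      have hB' := (mem_filter.1 hB).2
      rw [← sdiff_union_of_subset hA', ← sdiff_union_of_subset hB']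
      rw [show A \ D k = B \ D k from hAB]
    simp only [hc] at h
    calc _ ≤ (2 ^ n * (n + 1) ^ (∑ q ∈ pairs ℓ, (m q.1 q.2 - (D q.1 ∩ D q.2).card))) *
          (n + 1) ^ (∑ q ∈ pairs ℓ, (D q.1 ∩ D q.2).card) := Nat.mul_le_mul_right _ h
      _ = _ := by
        rw [mul_assoc, ← pow_add, ← sum_add_distrib]
        congr 2
        refine sum_congr rfl fun q hq => ?_
        have hq' : q.1 < q.2 := (mem_filter.1 hq).2
        have := hD q.1 q.2 hq'.ne
        omega

end basics

/-- Proportion of the members of `F` satisfying `P`. -/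
def pr {α : Type*} (F : Finset α) (P : α → Prop) : ℝ := ((F.filter P).card : ℝ) / F.card

section pr
variable {α : Type*} {F : Finset α} {P Q : α → Prop}

lemma pr_nonneg : 0 ≤ pr F P := by unfold pr; positivity

lemma pr_eq [DecidablePred P] : pr F P = ((F.filter P).card : ℝ) / F.card := by
  unfold pr
  congr!

lemma pr_mul_card [DecidablePred P] : pr F P * F.card = (F.filter P).card := by
  rw [pr_eq]
  rcases F.eq_empty_or_nonempty with rfl | h
  · simp
  · have : (F.card : ℝ) ≠ 0 := by exact_mod_cast h.card_pos.ne'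
    field_simp

lemma pr_le_of_card_le [DecidablePred P] {c : ℝ} (hF : 0 < F.card) (h : ((F.filter P).card : ℝ) ≤ c * F.card) :
    pr F P ≤ c := by
  have : (0 : ℝ) < F.card := by exact_mod_cast hF
  rw [pr_eq]
  rwa [div_le_iff₀ this]

lemma pr_mono (h : ∀ A ∈ F, P A → Q A) : pr F P ≤ pr F Q := by
  unfold pr
  gcongr 2
  refine Nat.cast_le.2 (card_le_card fun A hA => ?_)
  rw [mem_filter] at hA ⊢
  exact ⟨hA.1, h A hA.1 hA.2⟩

lemma pr_le_one : pr F P ≤ 1 := by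
  unfold pr
  refine div_le_one_of_le₀ ?_ (by positivity)
  exact_mod_cast card_filter_le _ _

lemma pr_or_le : pr F (fun A => P A ∨ Q A) ≤ pr F P + pr F Q := by
  rw [pr_eq, pr_eq, pr_eq, ← add_div]
  gcongr
  have : F.filter (fun A => P A ∨ Q A) ⊆ F.filter P ∪ F.filter Q := by
    intro A hA
    simp only [mem_union, mem_filter] at hA ⊢
    tauto
  exact_mod_cast (card_le_card this).trans (card_union_le _ _)

lemma pr_le_add {R : α → Prop} (h : ∀ A ∈ F, P A → Q A ∨ R A) : pr F P ≤ pr F Q + pr F R :=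
  (pr_mono h).trans pr_or_le

lemma pr_exists_le {ι : Type*} (s : Finset ι) (R : ι → α → Prop)
    (h : ∀ A ∈ F, P A → ∃ i ∈ s, R i A) : pr F P ≤ ∑ i ∈ s, pr F (R i) := by
  unfold pr
  rw [← sum_div]
  gcongr
  have : F.filter P ⊆ s.biUnion (fun i => F.filter (R i)) := by
    intro A hA
    rw [mem_filter] at hA
    obtain ⟨i, hi, hR⟩ := h A hA.1 hA.2
    exact mem_biUnion.2 ⟨i, hi, mem_filter.2 ⟨hA.1, hR⟩⟩
  exact_mod_cast (card_le_card this).trans card_biUnion_le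

lemma pr_add_not (hF : 0 < F.card) : pr F P + pr F (fun A => ¬ P A) = 1 := by
  have h1 : (0 : ℝ) < F.card := by exact_mod_cast hF
  rw [pr_eq, pr_eq, ← add_div, div_eq_one_iff_eq h1.ne']
  exact_mod_cast card_filter_add_card_filter_not (s := F) P

lemma exists_of_pr_pos (h : 0 < pr F P) : ∃ A ∈ F, P A := by
  by_contra hn
  push Not at hn
  have : F.filter P = ∅ := filter_eq_empty_iff.2 fun {A} hA => hn A hA
  unfold pr at h
  simp [this] at h

lemma pr_eq_zero (h : ∀ A ∈ F, ¬ P A) : pr F P = 0 := by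
  unfold pr
  rw [filter_eq_empty_iff.2 fun {A} hA => h A hA]
  simp

end pr

section unions
variable {n : ℕ}

lemma card_union_image (𝒜 ℬ : Finset (Finset (Fin n))) (X : Finset (Fin n)) (h𝒜 : ∀ A ∈ 𝒜, A ⊆ X)
    (hℬ : ∀ B ∈ ℬ, Disjoint B X) :
    ((𝒜 ×ˢ ℬ).image (fun p => p.1 ∪ p.2)).card = 𝒜.card * ℬ.card := by
  rw [card_image_of_injOn, card_product]
  rintro ⟨A, B⟩ hAB ⟨A', B'⟩ hAB' h
  simp only [coe_product, Set.mem_prod, mem_coe] at hAB hAB' h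
  have h1 := h𝒜 A hAB.1
  have h2 := h𝒜 A' hAB'.1
  have h3 := disjoint_left.1 (hℬ B hAB.2)
  have h4 := disjoint_left.1 (hℬ B' hAB'.2)
  simp only [Finset.ext_iff, mem_union] at h
  rw [Prod.mk.injEq]
  constructor <;> ext x <;> have := h x <;> have := @h1 x <;> have := @h2 x <;>
    have := @h3 x <;> have := @h4 x <;> tauto

/-- The number of members of a family is bounded through the traces on `X` and its complement. -/
lemma card_le_trace (F 𝒜 ℬ : Finset (Finset (Fin n))) (X : Finset (Fin n))
    (h : ∀ A ∈ F, A ∩ X ∈ 𝒜 ∧ A \ X ∈ ℬ) : F.card ≤ 𝒜.card * ℬ.card := by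
  rw [← card_product]
  refine card_le_card_of_injOn (fun A => (A ∩ X, A \ X)) (fun A hA => ?_) ?_
  · simpa using h A hA
  · intro A _ B _ hAB
    simp only [Prod.mk.injEq] at hAB
    rw [← sdiff_union_inter A X, ← sdiff_union_inter B X, hAB.1, hAB.2]

/-- Subsets of `⋃ W j` with prescribed sizes of the traces on the `W j`. -/
def slices {ℓ : ℕ} (W : Fin ℓ → Finset (Fin n)) (b : Fin ℓ → ℕ) : Finset (Finset (Fin n)) :=
  univ.filter (fun T => T ⊆ univ.biUnion W ∧ ∀ j, (T ∩ W j).card = b j)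

lemma card_slices {ℓ : ℕ} (W : Fin ℓ → Finset (Fin n)) (b : Fin ℓ → ℕ)
    (hW : ∀ i j, i ≠ j → Disjoint (W i) (W j)) :
    (slices W b).card = ∏ j, (W j).card.choose (b j) := by
  have : ∏ j, (W j).card.choose (b j)
      = (Fintype.piFinset fun j => (W j).powersetCard (b j)).card := by
    rw [Fintype.card_piFinset]
    simp
  rw [this]
  have key : ∀ f : Fin ℓ → Finset (Fin n), (∀ j, f j ⊆ W j) →
      ∀ j, univ.biUnion f ∩ W j = f j := by
    intro f hf j
    ext x
    simp only [mem_inter, mem_biUnion, mem_univ, true_and]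
    constructor
    · rintro ⟨⟨i, hi⟩, hx⟩
      by_cases hij : i = j
      · exact hij ▸ hi
      · exact absurd hx (disjoint_left.1 (hW i j hij) (hf i hi))
    · exact fun h => ⟨⟨j, h⟩, hf j h⟩
  refine card_bij' (fun T _ j => T ∩ W j) (fun f _ => univ.biUnion f) ?_ ?_ ?_ ?_
  · intro T hT
    simp only [slices, mem_filter, mem_univ, true_and] at hT
    simp only [Fintype.mem_piFinset, mem_powersetCard]
    exact fun j => ⟨inter_subset_right, hT.2 j⟩
  · intro f hf
    simp only [Fintype.mem_piFinset, mem_powersetCard] at hf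
    simp only [slices, mem_filter, mem_univ, true_and]
    refine ⟨biUnion_mono fun j _ => (hf j).1, fun j => ?_⟩
    rw [key f (fun j => (hf j).1) j, (hf j).2]
  · intro T hT
    simp only [slices, mem_filter, mem_univ, true_and] at hT
    rw [← inter_biUnion, inter_eq_left.2 hT.1]
  · intro f hf
    simp only [Fintype.mem_piFinset, mem_powersetCard] at hf
    funext j
    exact key f (fun j => (hf j).1) j

end unions

section struct
variable {n ℓ : ℕ}

/-- Points whose head is `k`. -/
def inn (h : Fin n → Fin ℓ) (k : Fin ℓ) : Finset (Fin n) := univ.filter (h · = k)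

/-- Points lying over the arc `(k, j)`. -/
def cell (h t : Fin n → Fin ℓ) (k j : Fin ℓ) : Finset (Fin n) :=
  univ.filter (fun y => t y = k ∧ h y = j)

/-- The families of the extremal structure. -/
def St (h t : Fin n → Fin ℓ) (a : Fin ℓ → Fin ℓ → ℕ) (k : Fin ℓ) : Finset (Finset (Fin n)) :=
  univ.filter (fun C => (∀ y ∈ C, h y = k ∨ t y = k) ∧ ∀ j, (C ∩ cell h t k j).card ≤ a k j)

variable {h t : Fin n → Fin ℓ} {a : Fin ℓ → Fin ℓ → ℕ}

@[simp] lemma mem_inn {k : Fin ℓ} {y : Fin n} : y ∈ inn h k ↔ h y = k := by simp [inn]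

@[simp] lemma mem_cell {k j : Fin ℓ} {y : Fin n} : y ∈ cell h t k j ↔ t y = k ∧ h y = j := by
  simp [cell]

lemma mem_St {k : Fin ℓ} {C : Finset (Fin n)} : C ∈ St h t a k ↔
    (∀ y ∈ C, h y = k ∨ t y = k) ∧ ∀ j, (C ∩ cell h t k j).card ≤ a k j := by
  simp [St]

lemma mem_slices {W : Fin ℓ → Finset (Fin n)} {b : Fin ℓ → ℕ} {T : Finset (Fin n)} :
    T ∈ slices W b ↔ T ⊆ univ.biUnion W ∧ ∀ j, (T ∩ W j).card = b j := by
  simp [slices]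

lemma disjoint_cell (k : Fin ℓ) (i j : Fin ℓ) (hij : i ≠ j) :
    Disjoint (cell h t k i) (cell h t k j) := by
  rw [disjoint_left]
  intro x hx hx'
  rw [mem_cell] at hx hx'
  exact hij (hx.2.symm.trans hx'.2)

lemma St_overlap {m : Fin ℓ → Fin ℓ → ℕ}
    (ha : ∀ k j, k ≠ j → a k j + a j k ≤ m k j) : Overlap m (St h t a) := by
  intro k j hkj A hA B hB
  rw [mem_St] at hA hB
  have : A ∩ B ⊆ (A ∩ cell h t k j) ∪ (B ∩ cell h t j k) := by
    intro x hx
    rw [mem_inter] at hx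
    simp only [mem_union, mem_inter, mem_cell]
    have h1 := hA.1 x hx.1
    have h2 := hB.1 x hx.2
    rcases h1 with h1 | h1 <;> rcases h2 with h2 | h2
    · exact absurd (h1.symm.trans h2) hkj
    · exact Or.inr ⟨hx.2, h2, h1⟩
    · exact Or.inl ⟨hx.1, h1, h2⟩
    · exact absurd (h1.symm.trans h2) hkj
  refine (card_le_card this).trans ((card_union_le _ _).trans ?_)
  exact (add_le_add (hA.2 j) (hB.2 k)).trans (ha k j hkj)

lemma slices_disjoint_inn (hht : ∀ y, h y ≠ t y) {k : Fin ℓ} {b : Fin ℓ → ℕ} {T : Finset (Fin n)}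
    (hT : T ∈ slices (cell h t k) b) : Disjoint T (inn h k) := by
  rw [disjoint_left]
  intro x hx hx'
  obtain ⟨j, _, hj⟩ := mem_biUnion.1 ((mem_slices.1 hT).1 hx)
  rw [mem_cell] at hj
  rw [mem_inn] at hx'
  exact hht x (hx'.trans hj.1.symm)

lemma union_mem_St (hht : ∀ y, h y ≠ t y) {k : Fin ℓ} {E T : Finset (Fin n)} (hE : E ⊆ inn h k)
    (hT : T ∈ slices (cell h t k) (a k)) : E ∪ T ∈ St h t a k := by
  rw [mem_St]
  rw [mem_slices] at hT
  refine ⟨fun y hy => ?_, fun j => ?_⟩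
  · rcases mem_union.1 hy with hy | hy
    · exact Or.inl (mem_inn.1 (hE hy))
    · obtain ⟨j, _, hj⟩ := mem_biUnion.1 (hT.1 hy)
      exact Or.inr (mem_cell.1 hj).1
  · rw [← hT.2 j]
    refine card_le_card fun x hx => ?_
    rw [mem_inter, mem_union] at hx
    refine mem_inter.2 ⟨hx.1.resolve_left fun hxE => ?_, hx.2⟩
    have h1 := mem_inn.1 (hE hxE)
    exact hht x (h1.trans (mem_cell.1 hx.2).1.symm)

lemma card_St_ge (hht : ∀ y, h y ≠ t y) (k : Fin ℓ) :
    2 ^ (inn h k).card * ∏ j, (cell h t k j).card.choose (a k j) ≤ (St h t a k).card := by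
  rw [← card_slices _ _ (disjoint_cell k), ← card_powerset,
    ← card_union_image _ _ (inn h k) (fun A hA => mem_powerset.1 hA)
      (fun B hB => slices_disjoint_inn hht hB)]
  refine card_le_card fun X hX => ?_
  obtain ⟨⟨E, T⟩, hp, rfl⟩ := mem_image.1 hX
  rw [mem_product] at hp
  exact union_mem_St hht (mem_powerset.1 hp.1) hp.2

lemma prod_two_pow_inn (h : Fin n → Fin ℓ) : ∏ k, 2 ^ (inn h k).card = 2 ^ n := by
  rw [prod_pow_eq_pow_sum]
  congr 1
  have := card_eq_sum_card_fiberwise (f := h) (s := univ) (t := univ) (fun _ _ => mem_univ _)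
  rw [card_univ, Fintype.card_fin] at this
  exact this.symm

lemma Extremal.ge_struct {m : Fin ℓ → Fin ℓ → ℕ} {F : Fin ℓ → Finset (Finset (Fin n))}
    (hF : Extremal m F) (hht : ∀ y, h y ≠ t y)
    (ha : ∀ k j, k ≠ j → a k j + a j k ≤ m k j) :
    2 ^ n * ∏ k, ∏ j, (cell h t k j).card.choose (a k j) ≤ ∏ k, (F k).card := by
  refine le_trans ?_ (hF.2 _ (St_overlap (h := h) (t := t) ha))
  rw [← prod_two_pow_inn h, ← prod_mul_distrib]
  exact prod_le_prod' fun k _ => card_St_ge hht k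

end struct

section insertion
variable {n ℓ : ℕ} {m : Fin ℓ → Fin ℓ → ℕ} {F : Fin ℓ → Finset (Finset (Fin n))}

lemma Extremal.insertion_card (hF : Extremal m F) (hsym : ∀ k1 k2, m k1 k2 = m k2 k1) (y : Fin n)
    {k j : Fin ℓ} (hkj : k ≠ j) {𝒞 ℬ : Finset (Finset (Fin n))}
    (h𝒞 : ∀ C ∈ 𝒞, C ∈ F k ∧ y ∉ C) (hℬ : ∀ B ∈ ℬ, B ∈ F j ∧ y ∉ B)
    (h : ∀ C ∈ 𝒞, ∀ B ∈ ℬ, (C ∩ B).card + 1 ≤ m k j) :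
    ∏ i, (((F i).filter (y ∉ ·)).card + (if i = k then 𝒞.card else if i = j then ℬ.card else 0)) ≤
      ∏ i, (F i).card := by
  set X : Fin ℓ → Finset (Finset (Fin n)) :=
    fun i => (if i = k then 𝒞 else if i = j then ℬ else ∅) with hX
  have hXm : ∀ i, ∀ A ∈ X i, A ∈ F i ∧ y ∉ A := by
    intro i A hA
    simp only [hX] at hA
    split_ifs at hA with h1 h2
    · exact h1 ▸ h𝒞 A hA
    · exact h2 ▸ hℬ A hA
    · simp at hA
  have hcard : ∀ i, ((F i).filter (y ∉ ·) ∪ (X i).image (insert y)).card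
      = ((F i).filter (y ∉ ·)).card + (if i = k then 𝒞.card else if i = j then ℬ.card else 0) := by
    intro i
    rw [card_union_of_disjoint, card_image_of_injOn]
    · congr 1
      simp only [hX]
      split_ifs <;> simp
    · intro A hA B hB hAB
      rw [← erase_insert (hXm i A hA).2, ← erase_insert (hXm i B hB).2]
      exact congrArg (fun S => S.erase y) hAB
    · rw [disjoint_left]
      intro A hA hA'
      obtain ⟨B, _, rfl⟩ := mem_image.1 hA'
      exact (mem_filter.1 hA).2 (mem_insert_self _ _)
  simp only [← hcard]
  refine hF.2 _ ?_
  have main : ∀ i i', i ≠ i' → ∀ A ∈ X i, ∀ B ∈ X i', (A ∩ B).card + 1 ≤ m i i' := by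
    intro i i' hii A hA B hB
    simp only [hX] at hA hB
    split_ifs at hA with h1 h2
    · subst h1
      split_ifs at hB with h3 h4
      · exact absurd h3.symm hii
      · subst h4; exact h A hA B hB
      · simp at hB
    · subst h2
      split_ifs at hB with h3 h4
      · subst h3; rw [inter_comm, hsym]; exact h B hB A hA
      · exact absurd h4.symm hii
      · simp at hB
    · simp at hA
  intro i i' hii A hA B hB
  rcases mem_union.1 hA with hA | hA <;> rcases mem_union.1 hB with hB | hB
  · exact hF.1 i i' hii A (mem_filter.1 hA).1 B (mem_filter.1 hB).1
  · obtain ⟨B, hB', rfl⟩ := mem_image.1 hB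
    rw [inter_insert_of_notMem (mem_filter.1 hA).2]
    exact hF.1 i i' hii A (mem_filter.1 hA).1 B (hXm _ _ hB').1
  · obtain ⟨A, hA', rfl⟩ := mem_image.1 hA
    rw [insert_inter_of_notMem (mem_filter.1 hB).2]
    exact hF.1 i i' hii A (hXm _ _ hA').1 B (mem_filter.1 hB).1
  · obtain ⟨A, hA', rfl⟩ := mem_image.1 hA
    obtain ⟨B, hB', rfl⟩ := mem_image.1 hB
    rw [← insert_inter_distrib]
    exact (card_insert_le _ _).trans (main i i' hii A hA' B hB')

/-- The proportion of the members of `F` containing `y`. -/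
def pp (F : Finset (Finset (Fin n))) (y : Fin n) : ℝ := pr F (y ∈ ·)

lemma pp_nonneg (G : Finset (Finset (Fin n))) (y : Fin n) : 0 ≤ pp G y := pr_nonneg

lemma card_avoid {G : Finset (Finset (Fin n))} (hG : 0 < G.card) (y : Fin n) :
    ((G.filter (y ∉ ·)).card : ℝ) = (1 - pp G y) * G.card := by
  rw [← pr_mul_card (P := (y ∉ ·))]
  congr 1
  have := pr_add_not (P := (y ∈ ·)) hG
  unfold pp
  linarith

lemma Extremal.insertion (hF : Extremal m F) (hsym : ∀ k1 k2, m k1 k2 = m k2 k1) (y : Fin n)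
    {k j : Fin ℓ} (hkj : k ≠ j) {𝒞 ℬ : Finset (Finset (Fin n))}
    (h𝒞 : ∀ C ∈ 𝒞, C ∈ F k ∧ y ∉ C) (hℬ : ∀ B ∈ ℬ, B ∈ F j ∧ y ∉ B)
    (h : ∀ C ∈ 𝒞, ∀ B ∈ ℬ, (C ∩ B).card + 1 ≤ m k j) {c b : ℝ} (hc0 : 0 ≤ c) (hb0 : 0 ≤ b)
    (hc : c * ((F k).filter (y ∉ ·)).card ≤ 𝒞.card)
    (hb : b * ((F j).filter (y ∉ ·)).card ≤ ℬ.card) :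
    (∏ i, (1 - pp (F i) y)) * ((1 + c) * (1 + b)) ≤ 1 := by
  have h1 := hF.insertion_card hsym y hkj h𝒞 hℬ h
  have h2 : (∏ i, (((F i).filter (y ∉ ·)).card +
      (if i = k then (𝒞.card : ℝ) else if i = j then (ℬ.card : ℝ) else 0))) ≤
      ∏ i, ((F i).card : ℝ) := by
    have := (Nat.cast_le (α := ℝ)).2 h1
    push_cast at this
    exact this
  have h3 : (∏ i, (1 + if i = k then c else if i = j then b else 0)) = (1 + c) * (1 + b) := by
    rw [← mul_prod_erase univ _ (mem_univ k), ← mul_prod_erase (univ.erase k) _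
      (mem_erase.2 ⟨hkj.symm, mem_univ j⟩), prod_eq_one, if_pos rfl, if_neg hkj.symm, if_pos rfl,
      mul_one]
    intro i hi
    simp only [mem_erase] at hi
    rw [if_neg hi.2.1, if_neg hi.1, add_zero]
  have hpos : ∀ i, (0 : ℝ) < (F i).card := fun i => by exact_mod_cast hF.card_pos i
  have h4 : (∏ i, (1 - pp (F i) y)) * ((1 + c) * (1 + b)) * ∏ i, ((F i).card : ℝ)
      ≤ ∏ i, ((F i).card : ℝ) := by
    rw [← h3, ← prod_mul_distrib, ← prod_mul_distrib]
    refine (prod_le_prod (fun i _ => ?_) fun i _ => ?_).trans h2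
    · have : pp (F i) y ≤ 1 := pr_le_one
      have h5 : (0 : ℝ) ≤ if i = k then c else if i = j then b else 0 := by
        split_ifs <;> simp [*]
      have := (hpos i).le
      have : 0 ≤ 1 - pp (F i) y := by linarith
      positivity
    · have e : (1 - pp (F i) y) * (1 + if i = k then c else if i = j then b else 0) * (F i).card
          = ((F i).filter (y ∉ ·)).card +
            (if i = k then c else if i = j then b else 0) * ((F i).filter (y ∉ ·)).card := by
        rw [card_avoid (hF.card_pos i)]; ring
      rw [e]
      gcongr
      split_ifs with h5 h6
      · subst h5; exact hc
      · subst h6; exact hb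
      · simp
  have hP : (0 : ℝ) < ∏ i, ((F i).card : ℝ) := prod_pos fun i _ => hpos i
  exact le_of_mul_le_mul_right (by linarith) hP

lemma Extremal.pp_le_half (hF : Extremal m F) (hsym : ∀ k1 k2, m k1 k2 = m k2 k1) (k : Fin ℓ)
    (y : Fin n) : pp (F k) y ≤ 1 / 2 := by
  have h1 : ((F k).filter (y ∈ ·)).card ≤ ((F k).filter (y ∉ ·)).card := by
    refine card_le_card_of_injOn (fun A => A.erase y) (fun A hA => ?_) ?_
    · rw [mem_coe, mem_filter] at hA ⊢
      exact ⟨hF.down hsym hA.1 (erase_subset _ _), notMem_erase _ _⟩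
    · intro A hA B hB hAB
      rw [← insert_erase (mem_filter.1 hA).2, ← insert_erase (mem_filter.1 hB).2]
      exact congrArg (insert y) hAB
  have h2 : pr (F k) (y ∈ ·) ≤ pr (F k) (y ∉ ·) := by
    rw [pr_eq, pr_eq]
    exact div_le_div_of_nonneg_right (Nat.cast_le.2 h1) (by positivity)
  have := pr_add_not (P := (y ∈ ·)) (hF.card_pos k)
  unfold pp
  linarith

end insertion

/-- The sum of the overlap bounds over unordered pairs. -/
def tot {ℓ : ℕ} (m : Fin ℓ → Fin ℓ → ℕ) : ℕ := ∑ q ∈ pairs ℓ, m q.1 q.2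

lemma ev_le (K : ℝ) : ∀ᶠ n : ℕ in atTop, K ≤ (n : ℝ) + 1 := by
  filter_upwards [Filter.eventually_ge_atTop ⌈K⌉₊] with n hn
  have := Nat.le_ceil K
  have : (⌈K⌉₊ : ℝ) ≤ n := by exact_mod_cast hn
  linarith

lemma choose_ge {s b : ℕ} (h : 2 * b ≤ s) :
    ((s : ℝ) / 2) ^ b / (b.factorial : ℝ) ≤ (s.choose b : ℝ) := by
  refine le_trans ?_ (Nat.pow_le_choose (α := ℝ) b s)
  gcongr
  rw [div_le_iff₀ (by norm_num)]
  have : s ≤ (s + 1 - b) * 2 := by omega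
  exact_mod_cast this

lemma prod_pairs {ℓ : ℕ} {M : Type*} [CommMonoid M] (f : Fin ℓ → Fin ℓ → M) :
    ∏ k, ∏ j, (if k < j then f k j else 1) = ∏ q ∈ pairs ℓ, f q.1 q.2 := by
  unfold pairs
  rw [prod_filter, ← univ_product_univ, prod_product]

lemma pairs_nonempty {ℓ : ℕ} (hℓ : 2 ≤ ℓ) : (pairs ℓ).Nonempty :=
  ⟨(⟨0, by omega⟩, ⟨1, by omega⟩), by simp [pairs]⟩

lemma exists_balanced {ℓ : ℕ} (hℓ : 2 ≤ ℓ) (n : ℕ) : ∃ h t : Fin n → Fin ℓ, (∀ y, h y ≠ t y) ∧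
    ∀ q ∈ pairs ℓ, n / (pairs ℓ).card ≤ (cell h t q.1 q.2).card := by
  set Q := (pairs ℓ).card with hQ
  have hQ0 : 0 < Q := (pairs_nonempty hℓ).card_pos
  let e : Fin Q ≃ pairs ℓ := (pairs ℓ).equivFin.symm
  refine ⟨fun y => (e ⟨y.val % Q, Nat.mod_lt _ hQ0⟩).1.2,
    fun y => (e ⟨y.val % Q, Nat.mod_lt _ hQ0⟩).1.1, fun y => ?_, fun q hq => ?_⟩
  · have := (mem_filter.1 (e ⟨y.val % Q, Nat.mod_lt _ hQ0⟩).2).2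
    exact this.ne'
  · set i := e.symm ⟨q, hq⟩ with hi
    have hb : ∀ r : Fin (n / Q), Q * r.val + i.val < n := by
      intro r
      have h1 : r.val + 1 ≤ n / Q := r.2
      have h2 : Q * (r.val + 1) ≤ n := (Nat.mul_le_mul_left Q h1).trans (Nat.mul_div_le n Q)
      have h3 := i.2
      rw [mul_add] at h2
      omega
    rw [← Fintype.card_fin (n / Q), ← card_univ]
    refine card_le_card_of_injOn (fun r => (⟨Q * r.val + i.val, hb r⟩ : Fin n)) ?_ ?_
    · intro r _
      have h1 : (Q * r.val + i.val) % Q = i.val := by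
        rw [Nat.mul_add_mod, Nat.mod_eq_of_lt i.2]
      simp only [mem_coe, mem_cell, h1]
      simp [hi]
    · intro r _ r' _ h
      simp only [Fin.mk.injEq, add_left_inj] at h
      exact Fin.ext (Nat.eq_of_mul_eq_mul_left hQ0 h)

lemma exists_lower {ℓ : ℕ} (hℓ : 2 ≤ ℓ) (m : Fin ℓ → Fin ℓ → ℕ) (hsym : ∀ k1 k2, m k1 k2 = m k2 k1) :
    ∃ c : ℝ, 0 < c ∧ ∀ᶠ n : ℕ in atTop, ∀ F : Fin ℓ → Finset (Finset (Fin n)), Extremal m F →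
      c * (2 ^ n * ((n : ℝ) + 1) ^ tot m) ≤ ∏ k, ((F k).card : ℝ) := by
  set Q := (pairs ℓ).card with hQ
  have hQ0 : 0 < Q := (pairs_nonempty hℓ).card_pos
  have hQr : (0 : ℝ) < Q := by exact_mod_cast hQ0
  refine ⟨∏ q ∈ pairs ℓ, (1 / (4 * (Q : ℝ))) ^ m q.1 q.2 / ((m q.1 q.2).factorial : ℝ),
    prod_pos fun q _ => by positivity, ?_⟩
  filter_upwards [Filter.eventually_ge_atTop (Q * (2 * tot m + 3))] with n hn F hF
  obtain ⟨h, t, hht, hcell⟩ := exists_balanced hℓ n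
  have h1 := hF.ge_struct (a := fun k j => if k < j then m k j else 0) hht (by
    intro k j hkj
    rcases lt_or_gt_of_ne hkj with h | h
    · simp [h, h.not_gt]
    · simp [h, h.not_gt, hsym k j])
  have h2 : ∏ k, ∏ j, (cell h t k j).card.choose (if k < j then m k j else 0)
      = ∏ q ∈ pairs ℓ, (cell h t q.1 q.2).card.choose (m q.1 q.2) := by
    rw [← prod_pairs (fun k j => (cell h t k j).card.choose (m k j))]
    refine prod_congr rfl fun k _ => prod_congr rfl fun j _ => ?_
    split_ifs <;> simp
  rw [h2] at h1
  have h3 : (2 : ℝ) ^ n * ∏ q ∈ pairs ℓ, ((cell h t q.1 q.2).card.choose (m q.1 q.2) : ℝ)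
      ≤ ∏ k, ((F k).card : ℝ) := by exact_mod_cast h1
  refine le_trans ?_ h3
  rw [mul_left_comm]
  gcongr
  unfold tot
  rw [← prod_pow_eq_pow_sum, ← prod_mul_distrib]
  refine prod_le_prod (fun q _ => by positivity) fun q hq => ?_
  have hm : m q.1 q.2 ≤ tot m := single_le_sum (f := fun q => m q.1 q.2) (by simp) hq
  have h4 : 2 * tot m + 3 ≤ n / Q := by
    rw [Nat.le_div_iff_mul_le hQ0, mul_comm]; exact hn
  have h5 : (n : ℝ) + 1 ≤ 2 * Q * ((n / Q : ℕ) : ℝ) := by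
    have h6 : n < Q * (n / Q + 1) := by
      have := Nat.div_add_mod n Q
      have := Nat.mod_lt n hQ0
      rw [mul_add]; omega
    have h7 : n + 1 ≤ 2 * Q * (n / Q) := by nlinarith
    exact_mod_cast h7
  calc (1 / (4 * (Q : ℝ))) ^ m q.1 q.2 / ((m q.1 q.2).factorial : ℝ) * ((n : ℝ) + 1) ^ m q.1 q.2
      = (((n : ℝ) + 1) / (4 * Q)) ^ m q.1 q.2 / ((m q.1 q.2).factorial : ℝ) := by
        rw [div_pow, div_pow, one_pow]; field_simp
    _ ≤ (((n / Q : ℕ) : ℝ) / 2) ^ m q.1 q.2 / ((m q.1 q.2).factorial : ℝ) := by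
        gcongr ?_ ^ _ / _
        rw [div_le_div_iff₀ (by positivity) (by norm_num)]
        linarith
    _ ≤ ((n / Q).choose (m q.1 q.2) : ℝ) := choose_ge (by omega)
    _ ≤ _ := by exact_mod_cast Nat.choose_le_choose _ (hcell q hq)

lemma choose_two_le_pairs {ℓ : ℕ} (s : Finset (Fin ℓ)) :
    s.card.choose 2 ≤ ((pairs ℓ).filter (fun q => q.1 ∈ s ∧ q.2 ∈ s)).card := by
  induction s using Finset.induction_on_max with
  | empty => simp
  | insert a s ha ih =>
    have hna : a ∉ s := fun h => lt_irrefl _ (ha a h)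
    have h1 : (pairs ℓ).filter (fun q => q.1 ∈ s ∧ q.2 ∈ s) ∪ s.image (fun k => (k, a)) ⊆
        (pairs ℓ).filter (fun q => q.1 ∈ insert a s ∧ q.2 ∈ insert a s) := by
      intro q hq
      simp only [mem_union, mem_filter, mem_image, mem_insert, pairs, mem_univ, true_and] at hq ⊢
      rcases hq with hq | ⟨k, hk, rfl⟩
      · tauto
      · exact ⟨ha k hk, Or.inr hk, Or.inl rfl⟩
    have h2 := card_le_card h1
    rw [card_union_of_disjoint, card_image_of_injective _ (fun x y h => (Prod.mk.inj h).1)] at h2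
    · rw [card_insert_of_notMem hna, Nat.choose_succ_succ' _ 1, Nat.choose_one_right]
      simp only [Nat.reduceAdd] at ih ⊢
      omega
    · rw [disjoint_left]
      intro q hq hq'
      obtain ⟨k, _, rfl⟩ := mem_image.1 hq'
      exact hna (mem_filter.1 hq).2.2

lemma weight_le {n ℓ : ℕ} (D : Fin ℓ → Finset (Fin n)) :
    ∑ y, (univ.filter (fun i => y ∈ D i)).card.choose 2 ≤
      ∑ q ∈ pairs ℓ, (D q.1 ∩ D q.2).card := by
  calc _ ≤ ∑ y, ((pairs ℓ).filter (fun q => y ∈ D q.1 ∧ y ∈ D q.2)).card := by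
        refine sum_le_sum fun y _ => (choose_two_le_pairs _).trans ?_
        simp
    _ = ∑ q ∈ pairs ℓ, (univ.filter (fun y => y ∈ D q.1 ∧ y ∈ D q.2)).card := by
        simp only [card_filter]
        rw [sum_comm]
    _ = _ := by
        refine sum_congr rfl fun q _ => ?_
        congr 1
        ext y
        simp

lemma exists_link {ℓ : ℕ} (hℓ : 2 ≤ ℓ) (m : Fin ℓ → Fin ℓ → ℕ) (hsym : ∀ k1 k2, m k1 k2 = m k2 k1) :
    ∃ K : ℝ, 0 < K ∧ ∀ᶠ n : ℕ in atTop, ∀ F : Fin ℓ → Finset (Finset (Fin n)), Extremal m F →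
      2 ^ n * ((n : ℝ) + 1) ^ tot m ≤ K * ∏ k, ((F k).card : ℝ) ∧
      ∀ D : Fin ℓ → Finset (Fin n), (∏ k, pr (F k) (D k ⊆ ·)) *
        ((n : ℝ) + 1) ^ (∑ y, (univ.filter (fun i => y ∈ D i)).card.choose 2) ≤ K := by
  obtain ⟨c, hc, hev⟩ := exists_lower hℓ m hsym
  refine ⟨1 / c, by positivity, ?_⟩
  filter_upwards [hev] with n hn F hF
  have h1 := hn F hF
  have h0 : 2 ^ n * ((n : ℝ) + 1) ^ tot m ≤ 1 / c * ∏ k, ((F k).card : ℝ) := by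
    rw [div_mul_eq_mul_div, one_mul, le_div_iff₀ hc]; linarith
  refine ⟨h0, fun D => ?_⟩
  have h2 := prod_link_le hF.1 hsym D
  have hP : (0 : ℝ) < ∏ k, ((F k).card : ℝ) :=
    prod_pos fun k _ => by exact_mod_cast hF.card_pos k
  have h3 : (∏ k, (((F k).filter (D k ⊆ ·)).card : ℝ)) *
      ((n : ℝ) + 1) ^ (∑ q ∈ pairs ℓ, (D q.1 ∩ D q.2).card) ≤
      2 ^ n * ((n : ℝ) + 1) ^ tot m := by exact_mod_cast h2
  have h4 : (∏ k, pr (F k) (D k ⊆ ·)) *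
        ((n : ℝ) + 1) ^ (∑ y, (univ.filter (fun i => y ∈ D i)).card.choose 2) *
        ∏ k, ((F k).card : ℝ) ≤ 1 / c * ∏ k, ((F k).card : ℝ) := by
    refine le_trans ?_ h0
    refine le_trans ?_ h3
    rw [mul_right_comm, ← prod_mul_distrib]
    simp only [pr_mul_card]
    gcongr
    · linarith [(Nat.cast_nonneg n : (0 : ℝ) ≤ n)]
    · exact weight_le D
  exact le_of_mul_le_mul_right h4 hP

lemma one_sub_sum_le_prod {ι : Type*} (s : Finset ι) (p : ι → ℝ) (h0 : ∀ i ∈ s, 0 ≤ p i)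
    (h1 : ∀ i ∈ s, p i ≤ 1) : 1 - ∑ i ∈ s, p i ≤ ∏ i ∈ s, (1 - p i) := by
  induction s using Finset.induction_on with
  | empty => simp
  | insert a s ha ih =>
    rw [sum_insert ha, prod_insert ha]
    have h2 := ih (fun i hi => h0 i (mem_insert_of_mem hi)) (fun i hi => h1 i (mem_insert_of_mem hi))
    have h3 := h0 a (mem_insert_self _ _)
    have h4 := h1 a (mem_insert_self _ _)
    have h5 : 0 ≤ ∑ i ∈ s, p i := sum_nonneg fun i hi => h0 i (mem_insert_of_mem hi)
    nlinarith

/-- Heads `h` and tails `t` adapted to an extremal tuple, with error constant `C`. -/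
structure Good {n ℓ : ℕ} (m : Fin ℓ → Fin ℓ → ℕ) (F : Fin ℓ → Finset (Finset (Fin n)))
    (h t : Fin n → Fin ℓ) (C : ℝ) : Prop where
  ext : Extremal m F
  ne : ∀ y, h y ≠ t y
  top : ∀ y, 1 / 2 - C / ((n : ℝ) + 1) ≤ pp (F (h y)) y
  low : ∀ y k, k ≠ h y → pp (F k) y ≤ C / ((n : ℝ) + 1)
  snd : ∀ y k, k ≠ h y → pp (F k) y ≤ pp (F (t y)) y
  lower : 2 ^ n * ((n : ℝ) + 1) ^ tot m ≤ C * ∏ k, ((F k).card : ℝ)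
  link : ∀ D : Fin ℓ → Finset (Fin n), (∏ k, pr (F k) (D k ⊆ ·)) *
        ((n : ℝ) + 1) ^ (∑ y, (univ.filter (fun i => y ∈ D i)).card.choose 2) ≤ C

lemma pr_true {α : Type*} {F : Finset α} (hF : 0 < F.card) {P : α → Prop} (h : ∀ A ∈ F, P A) :
    pr F P = 1 := by
  rw [pr_eq, filter_true_of_mem h]
  exact div_self (by exact_mod_cast hF.ne')

lemma link_points {n ℓ : ℕ} {m : Fin ℓ → Fin ℓ → ℕ} {F : Fin ℓ → Finset (Finset (Fin n))} {C : ℝ}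
    (hF : Extremal m F)
    (link : ∀ D : Fin ℓ → Finset (Fin n), (∏ k, pr (F k) (D k ⊆ ·)) *
        ((n : ℝ) + 1) ^ (∑ y, (univ.filter (fun i => y ∈ D i)).card.choose 2) ≤ C)
    (s : Finset (Fin ℓ)) (y : Fin n) :
    (∏ k ∈ s, pp (F k) y) * ((n : ℝ) + 1) ^ (s.card.choose 2) ≤ C := by
  have h1 := link (fun i => if i ∈ s then {y} else ∅)
  have e1 : (∏ k, pr (F k) ((fun i => if i ∈ s then ({y} : Finset (Fin n)) else ∅) k ⊆ ·))
      = ∏ k ∈ s, pp (F k) y := by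
    rw [← prod_filter_mul_prod_filter_not univ (· ∈ s)]
    rw [filter_mem_eq_inter, univ_inter, prod_eq_one (s := univ.filter (· ∉ s)), mul_one]
    · refine prod_congr rfl fun k hk => ?_
      simp only [hk, if_true, singleton_subset_iff, pp]
    · intro k hk
      simp only [mem_filter, mem_univ, true_and] at hk
      simp only [hk, if_false, empty_subset]
      exact pr_true (hF.card_pos k) fun _ _ => trivial
  have e2 : (∑ x, (univ.filter (fun i => x ∈ (fun i => if i ∈ s then ({y} : Finset (Fin n)) else ∅) i)).card.choose 2)
      = s.card.choose 2 := by
    rw [sum_eq_single y]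
    · congr 2
      ext i
      by_cases hi : i ∈ s <;> simp [hi]
    · intro x _ hx
      rw [filter_eq_empty_iff.2]
      · simp
      · intro i _
        by_cases hi : i ∈ s <;> simp [hi, hx]
    · simp
  rw [e1, e2] at h1
  exact h1

lemma Extremal.prod_le_half {n ℓ : ℕ} {m : Fin ℓ → Fin ℓ → ℕ} {F : Fin ℓ → Finset (Finset (Fin n))}
    (hF : Extremal m F) (hsym : ∀ k1 k2, m k1 k2 = m k2 k1) (y : Fin n) {k j : Fin ℓ}
    (hkj : k ≠ j) : ∏ i, (1 - pp (F i) y) ≤ 1 / 2 := by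
  have := hF.insertion hsym y hkj (𝒞 := ∅) (ℬ := (F j).filter (y ∉ ·)) (by simp)
    (fun B hB => mem_filter.1 hB) (by simp) (c := 0) (b := 1) le_rfl zero_le_one (by simp)
    (by simp)
  linarith

lemma top_of_prod_le {ℓ : ℕ} (p : Fin ℓ → ℝ) (h0 : ∀ i, 0 ≤ p i) (h1 : ∀ i, p i ≤ 1) (i : Fin ℓ)
    {δ q : ℝ} (hδ : 0 ≤ δ) (hlo : ∀ k, k ≠ i → p k ≤ δ) (hQ : ∏ k, (1 - p k) ≤ q) :
    1 - q - ℓ * δ ≤ p i := by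
  rw [← mul_prod_erase univ _ (mem_univ i)] at hQ
  have h2 := one_sub_sum_le_prod (univ.erase i) p (fun i _ => h0 i) (fun i _ => h1 i)
  have h3 : ∑ k ∈ univ.erase i, p k ≤ ℓ * δ := by
    refine (sum_le_sum fun k hk => hlo k (mem_erase.1 hk).1).trans ?_
    rw [sum_const, nsmul_eq_mul]
    refine mul_le_mul_of_nonneg_right (Nat.cast_le.2 ?_) hδ
    exact (card_le_univ _).trans_eq (Fintype.card_fin ℓ)
  have h4 := h1 i
  have h5 := h0 i
  have h6 : 0 ≤ ℓ * δ := by positivity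
  nlinarith

lemma exists_good {ℓ : ℕ} (hℓ : 2 ≤ ℓ) (m : Fin ℓ → Fin ℓ → ℕ) (hsym : ∀ k1 k2, m k1 k2 = m k2 k1) :
    ∃ C : ℝ, 0 < C ∧ ∀ᶠ n : ℕ in atTop, ∀ F : Fin ℓ → Finset (Finset (Fin n)), Extremal m F →
      ∃ h t, Good m F h t C := by
  obtain ⟨K, hK, hev⟩ := exists_link hℓ m hsym
  have hℓr : (2 : ℝ) ≤ ℓ := by exact_mod_cast hℓ
  obtain ⟨K', hK'⟩ : ∃ K' : ℝ, K' = 2 * ℓ * K := ⟨_, rfl⟩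
  have hKK' : K ≤ K' := by nlinarith
  have hK'0 : 0 < K' := hK.trans_le hKK'
  refine ⟨ℓ * K', by positivity, ?_⟩
  have hC1 : K' ≤ ℓ * K' := by nlinarith
  filter_upwards [hev] with n hn F hF
  obtain ⟨hlow, hlink⟩ := hn F hF
  have hN : (0 : ℝ) < (n : ℝ) + 1 := by positivity
  have hne : Nontrivial (Fin ℓ) := Fin.nontrivial_iff_two_le.2 hℓ
  have H : ∀ y : Fin n, ∃ i : Fin ℓ, ∀ k, pp (F k) y ≤ pp (F i) y := by
    intro y
    obtain ⟨i, _, hi⟩ := exists_max_image (univ : Finset (Fin ℓ)) (fun k => pp (F k) y)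
      univ_nonempty
    exact ⟨i, fun k => hi k (mem_univ k)⟩
  choose h hh using H
  have T : ∀ y : Fin n, ∃ i : Fin ℓ, i ≠ h y ∧ ∀ k, k ≠ h y → pp (F k) y ≤ pp (F i) y := by
    intro y
    obtain ⟨j, hj⟩ := exists_ne (h y)
    obtain ⟨i, hi, hi'⟩ := exists_max_image ((univ : Finset (Fin ℓ)).erase (h y))
      (fun k => pp (F k) y) ⟨j, mem_erase.2 ⟨hj, mem_univ j⟩⟩
    exact ⟨i, (mem_erase.1 hi).1, fun k hk => hi' k (mem_erase.2 ⟨hk, mem_univ k⟩)⟩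
  choose t ht using T
  have hQ : ∀ y, ∏ i, (1 - pp (F i) y) ≤ 1 / 2 := fun y => hF.prod_le_half hsym y (ht y).1
  have hmax : ∀ y, 1 / (2 * (ℓ : ℝ)) ≤ pp (F (h y)) y := by
    intro y
    have h1 := one_sub_sum_le_prod univ (fun i => pp (F i) y) (fun i _ => pp_nonneg _ _)
      (fun i _ => pr_le_one)
    have h2 : ∑ i, pp (F i) y ≤ ℓ * pp (F (h y)) y := by
      refine (sum_le_sum fun i _ => hh y i).trans ?_
      simp
    have h3 := hQ y
    rw [div_le_iff₀ (by positivity)]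
    linarith
  have hlo : ∀ y k, k ≠ h y → pp (F k) y ≤ K' / ((n : ℝ) + 1) := by
    intro y k hk
    have h1 := link_points hF hlink {k, h y} y
    rw [prod_pair hk, card_pair hk] at h1
    simp only [Nat.choose_self, pow_one] at h1
    have h2 := hmax y
    rw [div_le_iff₀ (by positivity)] at h2
    rw [le_div_iff₀ hN, hK']
    have h3 : 0 ≤ pp (F k) y * ((n : ℝ) + 1) := mul_nonneg (pp_nonneg _ _) hN.le
    have h4 := mul_le_mul_of_nonneg_left h2 h3
    have h5 := mul_le_mul_of_nonneg_left h1 (by positivity : (0 : ℝ) ≤ 2 * ℓ)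
    linarith
  refine ⟨h, t, hF, fun y => (ht y).1.symm, fun y => ?_, fun y k hk => ?_, fun y => (ht y).2,
    ?_, fun D => ?_⟩
  · have := top_of_prod_le _ (fun i => pp_nonneg (F i) y) (fun i => pr_le_one) (h y)
      (by positivity : 0 ≤ K' / ((n : ℝ) + 1)) (fun k hk => hlo y k hk) (hQ y)
    rw [mul_div_assoc]
    linarith
  · refine (hlo y k hk).trans ?_
    gcongr
  · exact hlow.trans (mul_le_mul_of_nonneg_right (hKK'.trans hC1)
      (prod_nonneg fun _ _ => Nat.cast_nonneg _))
  · exact (hlink D).trans (hKK'.trans hC1)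

section closure
variable {n : ℕ} {F : Finset (Finset (Fin n))}

lemma card_insert_notMem_add (hd : ∀ A ∈ F, ∀ B, B ⊆ A → B ∈ F) (x : Fin n) :
    (F.filter (fun A => insert x A ∉ F)).card + 2 * (F.filter (x ∈ ·)).card ≤ F.card := by
  have h1 : (F.filter (x ∈ ·)).card ≤ (F.filter (fun A => x ∉ A ∧ insert x A ∈ F)).card := by
    refine card_le_card_of_injOn (fun A => A.erase x) (fun A hA => ?_) ?_
    · rw [mem_coe, mem_filter] at hA ⊢
      refine ⟨hd A hA.1 _ (erase_subset _ _), notMem_erase _ _, ?_⟩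
      rw [insert_erase hA.2]
      exact hA.1
    · intro A hA B hB hAB
      rw [← insert_erase (mem_filter.1 hA).2, ← insert_erase (mem_filter.1 hB).2]
      exact congrArg (insert x) hAB
  have h2 : (F.filter (fun A => insert x A ∉ F)).card + (F.filter (x ∈ ·)).card
      + (F.filter (fun A => x ∉ A ∧ insert x A ∈ F)).card ≤ F.card := by
    rw [← card_union_of_disjoint, ← card_union_of_disjoint]
    · refine card_le_card (union_subset (union_subset ?_ ?_) ?_) <;> exact filter_subset _ _
    · rw [disjoint_left]
      intro A hA hA'
      simp only [mem_union, mem_filter] at hA hA'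
      tauto
    · rw [disjoint_left]
      intro A hA hA'
      simp only [mem_filter] at hA hA'
      rw [insert_eq_of_mem hA'.2] at hA
      exact hA.2 hA.1
  omega

lemma pr_union_notMem_le {β : ℝ} (D : Finset (Fin n)) (hF : 0 < F.card)
    (hβ : ∀ x ∈ D, pr F (fun A => insert x A ∉ F) ≤ β) :
    pr F (fun A => A ∪ D ∉ F) ≤ (2 ^ D.card - 1) * β := by
  induction D using Finset.induction_on with
  | empty => rw [pr_eq_zero (by simp)]; simp
  | insert x D hx ih =>
    have h1 := ih fun y hy => hβ y (mem_insert_of_mem hy)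
    have h2 := hβ x (mem_insert_self _ _)
    have h3 : pr F (fun A => insert x A ∈ F ∧ insert x A ∪ D ∉ F) ≤ 2 * pr F (fun A => A ∪ D ∉ F) := by
      refine pr_le_of_card_le hF ?_
      rw [mul_assoc, pr_mul_card]
      have h4 := card_le_mul_card_image (f := fun A => insert x A)
        (F.filter (fun A => insert x A ∈ F ∧ insert x A ∪ D ∉ F)) 2 (by
          intro B _
          refine (card_le_card (t := {B, B.erase x}) ?_).trans card_le_two
          intro A hA
          obtain ⟨_, rfl⟩ := mem_filter.1 hA
          rw [mem_insert, mem_singleton]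
          by_cases hxA : x ∈ A
          · left; exact (insert_eq_of_mem hxA).symm
          · right; exact (erase_insert hxA).symm)
      have h5 : ((F.filter (fun A => insert x A ∈ F ∧ insert x A ∪ D ∉ F)).image
          (fun A => insert x A)).card ≤ (F.filter (fun A => A ∪ D ∉ F)).card := by
        refine card_le_card fun B hB => ?_
        obtain ⟨A, hA, rfl⟩ := mem_image.1 hB
        rw [mem_filter] at hA ⊢
        exact hA.2
      exact_mod_cast h4.trans (Nat.mul_le_mul_left 2 h5)
    have h4 : pr F (fun A => A ∪ insert x D ∉ F) ≤ pr F (fun A => insert x A ∉ F) +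
        pr F (fun A => insert x A ∈ F ∧ insert x A ∪ D ∉ F) := by
      refine pr_le_add fun A _ hA => ?_
      rw [union_insert, ← insert_union] at hA
      tauto
    rw [card_insert_of_notMem hx, pow_succ]
    linarith

lemma pr_subset_ge (D : Finset (Fin n)) (hF : 0 < F.card) :
    1 - pr F (fun A => A ∪ D ∉ F) ≤ 2 ^ D.card * pr F (D ⊆ ·) := by
  have h1 := pr_add_not (P := fun A => A ∪ D ∉ F) hF
  have h2 : pr F (fun A => ¬ (A ∪ D ∉ F)) ≤ 2 ^ D.card * pr F (D ⊆ ·) := by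
    refine pr_le_of_card_le hF ?_
    rw [mul_assoc, pr_mul_card]
    have h4 := card_le_mul_card_image (f := fun A => A ∪ D)
      (F.filter (fun A => ¬ (A ∪ D ∉ F))) (2 ^ D.card) (by
        intro B _
        rw [← card_powerset]
        refine card_le_card_of_injOn (fun A => A ∩ D) (fun A _ => ?_) ?_
        · simp
        · intro A hA A' hA' h
          have e1 := (mem_filter.1 hA).2
          have e2 := (mem_filter.1 hA').2
          simp only [Finset.ext_iff, mem_inter, mem_union] at h e1 e2 ⊢
          intro x
          have := h x
          have := e1 x
          have := e2 x
          tauto)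
    have h5 : ((F.filter (fun A => ¬ (A ∪ D ∉ F))).image (fun A => A ∪ D)).card ≤
        (F.filter (D ⊆ ·)).card := by
      refine card_le_card fun B hB => ?_
      obtain ⟨A, hA, rfl⟩ := mem_image.1 hB
      rw [mem_filter] at hA ⊢
      exact ⟨not_not.1 hA.2, subset_union_right⟩
    exact_mod_cast h4.trans (Nat.mul_le_mul_left _ h5)
  linarith

end closure

/-- The sum of all overlap bounds. -/
def MM {ℓ : ℕ} (m : Fin ℓ → Fin ℓ → ℕ) : ℕ := ∑ k, ∑ j, m k j

lemma sum_le_MM {ℓ : ℕ} (m : Fin ℓ → Fin ℓ → ℕ) (k : Fin ℓ) : ∑ j, m k j ≤ MM m :=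
  single_le_sum (f := fun k => ∑ j, m k j) (fun _ _ => Nat.zero_le _) (mem_univ k)

lemma le_MM {ℓ : ℕ} (m : Fin ℓ → Fin ℓ → ℕ) (k j : Fin ℓ) : m k j ≤ MM m :=
  (single_le_sum (f := fun j => m k j) (fun _ _ => Nat.zero_le _) (mem_univ j)).trans
    (sum_le_MM m k)

/-- Local closure properties of an extremal tuple. -/
structure Closed {n ℓ : ℕ} (m : Fin ℓ → Fin ℓ → ℕ) (F : Fin ℓ → Finset (Finset (Fin n)))
    (h t : Fin n → Fin ℓ) (C : ℝ) : Prop extends Good m F h t C where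
  bad : ∀ k D, D ⊆ inn h k → D.card ≤ MM m →
    pr (F k) (fun A => A ∪ D ∉ F k) ≤ C / ((n : ℝ) + 1)
  sub : ∀ k D, D ⊆ inn h k → D.card ≤ MM m + 2 → 1 ≤ C * pr (F k) (D ⊆ ·)
  trace : ∀ k j, k ≠ j → ∀ A ∈ F k, (A ∩ inn h j).card ≤ m k j
  inn_mem : ∀ k, inn h k ∈ F k

lemma Good.mono {n ℓ : ℕ} {m : Fin ℓ → Fin ℓ → ℕ} {F : Fin ℓ → Finset (Finset (Fin n))}
    {h t : Fin n → Fin ℓ} {C C' : ℝ} (hg : Good m F h t C) (hC : C ≤ C') : Good m F h t C' := by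
  have h0 : C / ((n : ℝ) + 1) ≤ C' / ((n : ℝ) + 1) := by gcongr
  exact ⟨hg.ext, hg.ne, fun y => by linarith [hg.top y], fun y k hk => (hg.low y k hk).trans h0,
    hg.snd, hg.lower.trans (mul_le_mul_of_nonneg_right hC
      (prod_nonneg fun _ _ => Nat.cast_nonneg _)), fun D => (hg.link D).trans hC⟩

lemma exists_closed {ℓ : ℕ} (m : Fin ℓ → Fin ℓ → ℕ) (hsym : ∀ k1 k2, m k1 k2 = m k2 k1)
    {C₀ : ℝ} (hC₀ : 0 < C₀) :
    ∃ C : ℝ, 0 < C ∧ ∀ᶠ n : ℕ in atTop, ∀ (F : Fin ℓ → Finset (Finset (Fin n))) (h t), Good m F h t C₀ →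
      Closed m F h t C := by
  set d := MM m + 2 with hd
  have hp : (1 : ℝ) ≤ 2 ^ d := one_le_pow₀ (by norm_num)
  obtain ⟨K, hK⟩ : ∃ K : ℝ, K = 2 ^ d * (2 * C₀) := ⟨_, rfl⟩
  have hK0 : 0 < K := by rw [hK]; positivity
  refine ⟨C₀ + K + 2 * 2 ^ d, by positivity, ?_⟩
  filter_upwards [ev_le (2 * K)] with n hn F h t hg
  have hN : (0 : ℝ) < (n : ℝ) + 1 := by positivity
  have hF := hg.ext
  have hKN : K / ((n : ℝ) + 1) ≤ 1 / 2 := by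
    rw [div_le_iff₀ hN]; linarith
  have one : ∀ x, pr (F (h x)) (fun A => insert x A ∉ F (h x)) ≤ 2 * C₀ / ((n : ℝ) + 1) := by
    intro x
    have h1 := card_insert_notMem_add (F := F (h x)) (fun A hA B hB => hF.down hsym hA hB) x
    have h2 := hg.top x
    refine pr_le_of_card_le (hF.card_pos _) ?_
    have h3 : pp (F (h x)) x * (F (h x)).card = ((F (h x)).filter (x ∈ ·)).card := pr_mul_card
    have h4 : (((F (h x)).filter (fun A => insert x A ∉ F (h x))).card : ℝ)
        + 2 * ((F (h x)).filter (x ∈ ·)).card ≤ (F (h x)).card := by exact_mod_cast h1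
    have h5 : (0 : ℝ) ≤ (F (h x)).card := Nat.cast_nonneg _
    have h6 := mul_le_mul_of_nonneg_right h2 h5
    have h7 : 2 * C₀ / ((n : ℝ) + 1) = 2 * (C₀ / ((n : ℝ) + 1)) := by ring
    rw [h7]
    nlinarith
  have bad : ∀ k D, D ⊆ inn h k → D.card ≤ d →
      pr (F k) (fun A => A ∪ D ∉ F k) ≤ K / ((n : ℝ) + 1) := by
    intro k D hD hDc
    have h1 := pr_union_notMem_le D (hF.card_pos k) (β := 2 * C₀ / ((n : ℝ) + 1)) (by
      intro x hx
      have := one x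
      rwa [mem_inn.1 (hD hx)] at this)
    refine h1.trans ?_
    have e : K / ((n : ℝ) + 1) = 2 ^ d * (2 * C₀ / ((n : ℝ) + 1)) := by rw [hK, mul_div_assoc]
    rw [e]
    have h2 : (2 : ℝ) ^ D.card ≤ 2 ^ d := pow_le_pow_right₀ (by norm_num) hDc
    exact mul_le_mul_of_nonneg_right (by linarith) (by positivity)
  have sub : ∀ k D, D ⊆ inn h k → D.card ≤ d → 1 ≤ 2 * 2 ^ d * pr (F k) (D ⊆ ·) := by
    intro k D hD hDc
    have h1 := pr_subset_ge D (hF.card_pos k)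
    have h2 := bad k D hD hDc
    have h3 : (2 : ℝ) ^ D.card ≤ 2 ^ d := pow_le_pow_right₀ (by norm_num) hDc
    have h4 := mul_le_mul_of_nonneg_right h3 (pr_nonneg (F := F k) (P := (D ⊆ ·)))
    linarith
  have trace : ∀ k j, k ≠ j → ∀ A ∈ F k, (A ∩ inn h j).card ≤ m k j := by
    intro k j hkj A hA
    by_contra hcon
    push Not at hcon
    obtain ⟨D, hD, hDc⟩ := exists_subset_card_eq (n := m k j + 1) hcon
    have h1 := sub j D (hD.trans inter_subset_right) (by have := le_MM m k j; omega)
    have h2 : 0 < pr (F j) (D ⊆ ·) := by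
      by_contra h3
      have := mul_nonpos_of_nonneg_of_nonpos (by positivity : (0 : ℝ) ≤ 2 * 2 ^ d) (not_lt.1 h3)
      linarith
    obtain ⟨B, hB, hDB⟩ := exists_of_pr_pos h2
    have h3 := hF.1 k j hkj A hA B hB
    have h4 : D ⊆ A ∩ B := subset_inter (hD.trans inter_subset_left) hDB
    have := card_le_card h4
    omega
  have hCK : (0 : ℝ) ≤ K := hK0.le
  refine ⟨hg.mono (by nlinarith), fun k D hD hDc => ?_, fun k D hD hDc => ?_, trace, fun k => ?_⟩
  · refine (bad k D hD (by omega)).trans ?_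
    gcongr
    nlinarith
  · refine (sub k D hD hDc).trans ?_
    refine mul_le_mul_of_nonneg_right ?_ pr_nonneg
    linarith
  · refine prod_update_insert_le hF k _ hsym fun j hj B hB => ?_
    rw [inter_comm, hsym]
    exact trace j k hj B hB

section chernoff
variable {n ℓ : ℕ} {m : Fin ℓ → Fin ℓ → ℕ} {F : Fin ℓ → Finset (Finset (Fin n))}
  {h t : Fin n → Fin ℓ} {C : ℝ}

lemma Closed.two_pow_le (hc : Closed m F h t C) (hsym : ∀ k1 k2, m k1 k2 = m k2 k1) (k : Fin ℓ) :
    2 ^ (inn h k).card ≤ (F k).card := by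
  rw [← card_powerset]
  refine card_le_card fun A hA => ?_
  exact hc.ext.down hsym (hc.inn_mem k) (mem_powerset.1 hA)

lemma Closed.card_sdiff_le (hc : Closed m F h t C) {k : Fin ℓ} {A : Finset (Fin n)} (hA : A ∈ F k) :
    (A \ inn h k).card ≤ MM m := by
  refine le_trans ?_ (sum_le_MM m k)
  have : A \ inn h k ⊆ (univ.erase k).biUnion (fun j => A ∩ inn h j) := by
    intro x hx
    rw [Finset.mem_sdiff, mem_inn] at hx
    simp only [mem_biUnion, mem_erase, mem_univ, and_true, mem_inter, mem_inn]
    exact ⟨h x, hx.2, hx.1, rfl⟩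
  refine (card_le_card this).trans (card_biUnion_le.trans ?_)
  refine (sum_le_sum fun j hj => hc.trace k j (mem_erase.1 hj).1.symm A hA).trans ?_
  exact sum_le_sum_of_subset (erase_subset _ _)

lemma card_sparse_le (Z : Finset (Fin n)) :
    ((Z.powerset.filter (fun S => 8 * S.card ≤ Z.card)).card : ℝ) ≤ (8 / 5) ^ Z.card := by
  have h1 : ((Z.powerset.filter (fun S => 8 * S.card ≤ Z.card)).card : ℝ) * (9 / 10) ^ Z.card ≤
      (1 + (9 / 10) ^ 8) ^ Z.card := by
    have h2 := Finset.sum_pow_mul_eq_add_pow ((9 / 10 : ℝ) ^ 8) 1 Z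
    rw [add_comm] at h2
    rw [← h2, ← nsmul_eq_mul, ← sum_const]
    refine (sum_le_sum (g := fun S => ((9 / 10 : ℝ) ^ 8) ^ S.card * 1 ^ (Z.card - S.card)) ?_).trans
      (sum_le_sum_of_subset_of_nonneg (filter_subset _ _) fun _ _ _ => by positivity)
    intro S hS
    rw [one_pow, mul_one, ← pow_mul]
    exact pow_le_pow_of_le_one (by norm_num) (by norm_num) (mem_filter.1 hS).2
  have h3 : ((1 : ℝ) + (9 / 10) ^ 8) ^ Z.card ≤ (8 / 5 * (9 / 10)) ^ Z.card := by
    gcongr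
    norm_num
  rw [mul_pow] at h3
  exact le_of_mul_le_mul_right (h1.trans h3) (by positivity)

lemma Closed.chernoff (hc : Closed m F h t C) (hsym : ∀ k1 k2, m k1 k2 = m k2 k1) {k : Fin ℓ}
    {Z : Finset (Fin n)} (hZ : Z ⊆ inn h k) :
    pr (F k) (fun A => 8 * (A ∩ Z).card ≤ Z.card) ≤ ((n : ℝ) + 1) ^ MM m * (4 / 5) ^ Z.card := by
  refine pr_le_of_card_le (hc.ext.card_pos k) ?_
  set 𝒜 := ((Z.powerset.filter (fun S => 8 * S.card ≤ Z.card)) ×ˢ (inn h k \ Z).powerset).image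
    (fun p => p.1 ∪ p.2)
  have h1 := card_le_trace ((F k).filter (fun A => 8 * (A ∩ Z).card ≤ Z.card)) 𝒜
    (univ.filter (fun T => T.card ≤ MM m)) (inn h k) (by
      intro A hA
      rw [mem_filter] at hA
      constructor
      · refine mem_image.2 ⟨(A ∩ Z, A ∩ (inn h k \ Z)), ?_, ?_⟩
        · simp only [mem_product, mem_filter, mem_powerset]
          exact ⟨⟨inter_subset_right, hA.2⟩, inter_subset_right⟩
        · simp only
          rw [← inter_union_distrib_left, union_sdiff_of_subset hZ]
      · simp [hc.card_sdiff_le hA.1])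
  have h2 : 𝒜.card ≤ (Z.powerset.filter (fun S => 8 * S.card ≤ Z.card)).card *
      2 ^ (inn h k \ Z).card := by
    rw [← card_powerset, ← card_product]
    exact card_image_le
  have h3 := card_filter_card_le (univ.filter (fun T : Finset (Fin n) => T.card ≤ MM m)) (MM m)
    (by simp)
  have h4 := h1.trans (Nat.mul_le_mul h2 h3)
  have h5 : (((F k).filter (fun A => 8 * (A ∩ Z).card ≤ Z.card)).card : ℝ) ≤
      ((Z.powerset.filter (fun S => 8 * S.card ≤ Z.card)).card * 2 ^ (inn h k \ Z).card) *
        ((n : ℝ) + 1) ^ MM m := by exact_mod_cast h4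
  refine h5.trans ?_
  have h6 : (2 : ℝ) ^ (inn h k).card ≤ (F k).card := by exact_mod_cast hc.two_pow_le hsym k
  have h7 : (inn h k).card = (inn h k \ Z).card + Z.card := by
    rw [card_sdiff_add_card_eq_card hZ]
  calc _ ≤ ((8 / 5 : ℝ) ^ Z.card * 2 ^ (inn h k \ Z).card) * ((n : ℝ) + 1) ^ MM m := by
        gcongr
        exact card_sparse_le Z
    _ = ((n : ℝ) + 1) ^ MM m * (4 / 5) ^ Z.card * 2 ^ (inn h k).card := by
        rw [h7, pow_add, show (8 / 5 : ℝ) = 4 / 5 * 2 by norm_num, mul_pow]; ring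
    _ ≤ _ := by gcongr

end chernoff

lemma exp_small (K : ℕ) {c ε : ℝ} (hc : 0 < c) (hε : 0 < ε) : ∀ᶠ n : ℕ in atTop, ∀ z : ℕ,
    c * ((n : ℝ) + 1) ≤ z → ((n : ℝ) + 1) ^ K * (4 / 5) ^ z ≤ ε := by
  have h1 : Tendsto (fun z : ℕ => (z : ℝ) ^ K * (4 / 5 : ℝ) ^ z) atTop (nhds 0) :=
    tendsto_pow_const_mul_const_pow_of_abs_lt_one K (by rw [abs_of_pos] <;> norm_num)
  have h2 : ∀ᶠ z : ℕ in atTop, (z : ℝ) ^ K * (4 / 5 : ℝ) ^ z < ε * c ^ K :=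
    h1.eventually (gt_mem_nhds (by positivity))
  obtain ⟨Z, hZ⟩ := Filter.eventually_atTop.1 h2
  filter_upwards [ev_le (Z / c)] with n hn z hz
  have h3 : (Z : ℝ) ≤ z := by
    rw [div_le_iff₀ hc] at hn
    linarith
  have h4 := hZ z (by exact_mod_cast h3)
  have h5 : (c * ((n : ℝ) + 1)) ^ K * (4 / 5 : ℝ) ^ z ≤ (z : ℝ) ^ K * (4 / 5 : ℝ) ^ z := by
    gcongr
  rw [mul_pow] at h5
  have h6 : c ^ K * (((n : ℝ) + 1) ^ K * (4 / 5) ^ z) ≤ c ^ K * ε := by linarith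
  exact le_of_mul_le_mul_left h6 (by positivity)

lemma Closed.mono {n ℓ : ℕ} {m : Fin ℓ → Fin ℓ → ℕ} {F : Fin ℓ → Finset (Finset (Fin n))}
    {h t : Fin n → Fin ℓ} {C C' : ℝ} (hc : Closed m F h t C) (hC : C ≤ C') :
    Closed m F h t C' := by
  have h0 : C / ((n : ℝ) + 1) ≤ C' / ((n : ℝ) + 1) := by gcongr
  exact ⟨hc.toGood.mono hC, fun k D hD hDc => (hc.bad k D hD hDc).trans h0,
    fun k D hD hDc => (hc.sub k D hD hDc).trans (mul_le_mul_of_nonneg_right hC pr_nonneg),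
    hc.trace, hc.inn_mem⟩

/-- Selecting a pair of members that avoids two sparse relations. -/
lemma exists_pair {α β : Type*} {F : Finset α} {G : Finset β} (hF : 0 < F.card) (hG : 0 < G.card)
    {P : α → Prop} {Q : β → Prop} (R R' : α → β → Prop) {ε ε' : ℝ}
    (hR : ∀ b ∈ G, pr F (R · b) ≤ ε) (hR' : ∀ a ∈ F, pr G (R' a ·) ≤ ε')
    (h : ε + ε' < pr F P * pr G Q) : ∃ a ∈ F, ∃ b ∈ G, P a ∧ Q b ∧ ¬ R a b ∧ ¬ R' a b := by
  by_contra hcon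
  push Not at hcon
  have h1 : (F.filter P).card * (G.filter Q).card ≤
      ∑ b ∈ G, (F.filter (R · b)).card + ∑ a ∈ F, (G.filter (R' a ·)).card := by
    have e1 : ∑ b ∈ G, (F.filter (R · b)).card = ((F ×ˢ G).filter (fun p => R p.1 p.2)).card := by
      rw [card_filter, sum_product_right]
      simp only [card_filter]
    have e2 : ∑ a ∈ F, (G.filter (R' a ·)).card = ((F ×ˢ G).filter (fun p => R' p.1 p.2)).card := by
      rw [card_filter, sum_product]
      simp only [card_filter]
    rw [e1, e2, ← card_product]
    refine (card_le_card fun p hp => ?_).trans (card_union_le _ _)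
    rw [mem_product, mem_filter, mem_filter] at hp
    rw [mem_union, mem_filter, mem_filter, mem_product]
    have := hcon p.1 hp.1.1 p.2 hp.2.1 hp.1.2 hp.2.2
    tauto
  have h2 : ∑ b ∈ G, ((F.filter (R · b)).card : ℝ) ≤ ε * (F.card * G.card) := by
    calc _ ≤ ∑ b ∈ G, ε * F.card := sum_le_sum fun b hb => by
          rw [← pr_mul_card]
          exact mul_le_mul_of_nonneg_right (hR b hb) (Nat.cast_nonneg _)
      _ = _ := by rw [sum_const, nsmul_eq_mul]; ring
  have h3 : ∑ a ∈ F, ((G.filter (R' a ·)).card : ℝ) ≤ ε' * (F.card * G.card) := by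
    calc _ ≤ ∑ a ∈ F, ε' * G.card := sum_le_sum fun a ha => by
          rw [← pr_mul_card]
          exact mul_le_mul_of_nonneg_right (hR' a ha) (Nat.cast_nonneg _)
      _ = _ := by rw [sum_const, nsmul_eq_mul]; ring
  have h4 : ((F.filter P).card : ℝ) * (G.filter Q).card ≤ ∑ b ∈ G, ((F.filter (R · b)).card : ℝ) +
      ∑ a ∈ F, ((G.filter (R' a ·)).card : ℝ) := by exact_mod_cast h1
  rw [← pr_mul_card, ← pr_mul_card] at h4
  have h5 : (0 : ℝ) < F.card * G.card := by
    have : (0 : ℝ) < F.card := by exact_mod_cast hF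
    have : (0 : ℝ) < G.card := by exact_mod_cast hG
    positivity
  have h6 := mul_lt_mul_of_pos_right h h5
  linarith

lemma sum_sum_eq_pairs {ℓ : ℕ} (b : Fin ℓ → Fin ℓ → ℕ) (hb : ∀ k, b k k = 0) :
    ∑ k, ∑ j, b k j = ∑ q ∈ pairs ℓ, (b q.1 q.2 + b q.2 q.1) := by
  rw [sum_add_distrib, sum_pairs (fun i j => b i j), sum_pairs (fun i j => b j i)]
  have h1 : ∑ j, ∑ k ∈ univ.filter (· < j), b k j = ∑ k, ∑ j ∈ univ.filter (k < ·), b k j := by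
    refine sum_comm' fun x y => ?_
    simp
  rw [h1, ← sum_add_distrib]
  refine sum_congr rfl fun k _ => ?_
  rw [← sum_union]
  · refine (sum_subset (subset_univ _) fun j _ hj => ?_).symm
    simp only [mem_union, mem_filter, mem_univ, true_and, not_or, not_lt] at hj
    rw [le_antisymm hj.1 hj.2, hb]
  · rw [disjoint_left]
    intro x hx hx'
    simp only [mem_filter, mem_univ, true_and] at hx hx'
    exact lt_asymm hx hx'

lemma prod_two_pow_mul {n ℓ : ℕ} (h : Fin n → Fin ℓ) (s : Fin ℓ → ℕ) (x : ℝ) :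
    ∏ k, (2 ^ (inn h k).card * x ^ s k) = 2 ^ n * x ^ ∑ k, s k := by
  rw [prod_mul_distrib, prod_pow_eq_pow_sum univ s x]
  congr 1
  exact_mod_cast prod_two_pow_inn h

section profile
variable {n ℓ : ℕ} {m : Fin ℓ → Fin ℓ → ℕ} {F : Fin ℓ → Finset (Finset (Fin n))}
  {h t : Fin n → Fin ℓ} {C : ℝ}

lemma Closed.add_le (hc : Closed m F h t C) {k j : Fin ℓ}
    (hkj : k ≠ j) {v w : ℕ} (hvw : 2 * C / ((n : ℝ) + 1) <
      pr (F k) (fun A => v ≤ (A ∩ inn h j).card) * pr (F j) (fun A => w ≤ (A ∩ inn h k).card)) :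
    v + w ≤ m k j := by
  obtain ⟨A, hA, B, hB, hv, hw, h1, h2⟩ := exists_pair (hc.ext.card_pos k) (hc.ext.card_pos j)
    (fun A B => A ∪ (B ∩ inn h k) ∉ F k) (fun A B => B ∪ (A ∩ inn h j) ∉ F j)
    (ε := C / ((n : ℝ) + 1)) (ε' := C / ((n : ℝ) + 1))
    (fun B hB => hc.bad k _ inter_subset_right ((hc.trace j k hkj.symm B hB).trans (le_MM m j k)))
    (fun A hA => hc.bad j _ inter_subset_right ((hc.trace k j hkj A hA).trans (le_MM m k j)))
    (by rw [← add_div, ← two_mul]; exact hvw)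
  rw [not_not] at h1 h2
  have h3 := hc.ext.1 k j hkj _ h1 _ h2
  refine le_trans ?_ h3
  refine (add_le_add hv hw).trans ?_
  rw [← card_union_of_disjoint]
  · refine card_le_card fun x hx => ?_
    simp only [mem_union, mem_inter] at hx ⊢
    tauto
  · rw [disjoint_left]
    intro x hx hx'
    simp only [mem_inter, mem_inn] at hx hx'
    exact hkj (hx'.2.symm.trans hx.2)

lemma card_le_of_sdiff_le (G : Finset (Finset (Fin n))) (I : Finset (Fin n)) (b : ℕ)
    (hb : ∀ A ∈ G, (A \ I).card ≤ b) : (G.card : ℝ) ≤ 2 ^ I.card * ((n : ℝ) + 1) ^ b := by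
  have h1 := card_le_trace G I.powerset (univ.filter (fun T => T.card ≤ b)) I
    (fun A hA => by simp [hb A hA])
  have h2 := card_filter_card_le (univ.filter (fun T : Finset (Fin n) => T.card ≤ b)) b (by simp)
  rw [card_powerset] at h1
  exact_mod_cast h1.trans (Nat.mul_le_mul_left _ h2)

lemma card_sdiff_inn (A : Finset (Fin n)) (k : Fin ℓ) :
    (A \ inn h k).card = ∑ j ∈ univ.erase k, (A ∩ inn h j).card := by
  rw [← card_biUnion]
  · congr 1
    ext x
    simp
    tauto
  · intro i _ j _ hij
    rw [Function.onFun, disjoint_left]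
    intro x hx hx'
    simp only [mem_inter, mem_inn] at hx hx'
    exact hij (hx.2.symm.trans hx'.2)

end profile

/-- The generic sizes `a k j` of the traces of members of `F k` on `inn h j`. -/
structure Profile {n ℓ : ℕ} (m : Fin ℓ → Fin ℓ → ℕ) (F : Fin ℓ → Finset (Finset (Fin n)))
    (h t : Fin n → Fin ℓ) (a : Fin ℓ → Fin ℓ → ℕ) (C : ℝ) : Prop extends Closed m F h t C where
  diag : ∀ k, a k k = 0
  sum : ∀ k j, k ≠ j → a k j + a j k = m k j
  up : ∀ k, ((F k).card : ℝ) ≤ C * (2 ^ (inn h k).card * ((n : ℝ) + 1) ^ (∑ j, a k j))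
  lo : ∀ k, 2 ^ (inn h k).card * ((n : ℝ) + 1) ^ (∑ j, a k j) ≤ C * ((F k).card : ℝ)
  typ : ∀ k, pr (F k) (fun A => ∃ j, j ≠ k ∧ (A ∩ inn h j).card ≠ a k j) ≤ C / ((n : ℝ) + 1)

lemma Profile.mono {n ℓ : ℕ} {m : Fin ℓ → Fin ℓ → ℕ} {F : Fin ℓ → Finset (Finset (Fin n))}
    {h t : Fin n → Fin ℓ} {a : Fin ℓ → Fin ℓ → ℕ} {C C' : ℝ} (hp : Profile m F h t a C)
    (hC : C ≤ C') : Profile m F h t a C' := by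
  have h0 : C / ((n : ℝ) + 1) ≤ C' / ((n : ℝ) + 1) := by gcongr
  exact ⟨hp.toClosed.mono hC, hp.diag, hp.sum,
    fun k => (hp.up k).trans (mul_le_mul_of_nonneg_right hC (by positivity)),
    fun k => (hp.lo k).trans (mul_le_mul_of_nonneg_right hC (Nat.cast_nonneg _)),
    fun k => (hp.typ k).trans h0⟩

section

variable {ℓ : ℕ}

lemma pre_profile (m : Fin ℓ → Fin ℓ → ℕ) (hℓ : 2 ≤ ℓ) (C : ℝ) :
    ∀ᶠ n : ℕ in atTop, ∀ (F : Fin ℓ → Finset (Finset (Fin n))) (h t), Closed m F h t C →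
      ∃ a : Fin ℓ → Fin ℓ → ℕ, (∀ k, a k k = 0) ∧ (∀ k j, k ≠ j → a k j + a j k ≤ m k j) ∧
        (∀ k j, k ≠ j → 1 / (2 * ℓ) ≤ pr (F k) (fun A => a k j ≤ (A ∩ inn h j).card)) ∧
        (∀ k j, k ≠ j → pr (F k) (fun A => a k j < (A ∩ inn h j).card) ≤ 1 / (2 * ℓ)) := by
  have hℓ0 : (0 : ℝ) < ℓ := by exact_mod_cast (by omega : 0 < ℓ)
  obtain ⟨θ, hθ⟩ : ∃ θ : ℝ, θ = 1 / (2 * ℓ) := ⟨_, rfl⟩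
  have hθ0 : 0 < θ := by rw [hθ]; positivity
  have hθ1 : θ ≤ 1 := by
    rw [hθ, div_le_one (by positivity)]
    have : (2 : ℝ) ≤ ℓ := by exact_mod_cast hℓ
    linarith
  rw [← hθ]
  filter_upwards [ev_le (2 * C / θ ^ 2 + 1)] with n hn F h t hc
  have hN : (0 : ℝ) < (n : ℝ) + 1 := by positivity
  have hlt : 2 * C / ((n : ℝ) + 1) < θ * θ := by
    rw [div_lt_iff₀ hN, ← pow_two]
    have h1 : 2 * C / θ ^ 2 < (n : ℝ) + 1 := by linarith
    rw [div_lt_iff₀ (by positivity)] at h1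
    linarith
  refine ⟨fun k j => if k = j then 0 else
    Nat.findGreatest (fun v => θ ≤ pr (F k) (fun A => v ≤ (A ∩ inn h j).card)) (m k j), by simp, ?_⟩
  have key : ∀ k j, k ≠ j → θ ≤ pr (F k) (fun A => Nat.findGreatest
      (fun v => θ ≤ pr (F k) (fun A => v ≤ (A ∩ inn h j).card)) (m k j) ≤ (A ∩ inn h j).card) := by
    intro k j _
    refine Nat.findGreatest_spec (P := fun v => θ ≤ pr (F k) (fun A => v ≤ (A ∩ inn h j).card))
      (Nat.zero_le _) ?_
    rw [pr_true (hc.ext.card_pos k) (by simp)]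
    exact hθ1
  refine ⟨fun k j hkj => ?_, fun k j hkj => ?_, fun k j hkj => ?_⟩
  · simp only [if_neg hkj, if_neg hkj.symm]
    refine hc.add_le hkj (hlt.trans_le ?_)
    exact mul_le_mul (key k j hkj) (key j k hkj.symm) hθ0.le pr_nonneg
  · simp only [if_neg hkj]
    exact key k j hkj
  · simp only [if_neg hkj]
    set v := Nat.findGreatest (fun v => θ ≤ pr (F k) (fun A => v ≤ (A ∩ inn h j).card)) (m k j)
      with hv
    by_cases hvm : v < m k j
    · have := Nat.findGreatest_is_greatest (P := fun v => θ ≤ pr (F k) (fun A => v ≤ (A ∩ inn h j).card))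
        (n := m k j) (k := v + 1) (by omega) hvm
      exact (not_le.1 this).le
    · rw [pr_eq_zero]
      · exact hθ0.le
      · intro A hA
        have := hc.trace k j hkj A hA
        omega

end

section
variable {n ℓ : ℕ} {m : Fin ℓ → Fin ℓ → ℕ} {F : Fin ℓ → Finset (Finset (Fin n))}
  {h t : Fin n → Fin ℓ} {C : ℝ} {a : Fin ℓ → Fin ℓ → ℕ}

lemma Closed.card_le_two_mul (hℓ : 2 ≤ ℓ) (hc : Closed m F h t C) (hd : ∀ k, a k k = 0)
    (hle : ∀ k j, k ≠ j → pr (F k) (fun A => a k j < (A ∩ inn h j).card) ≤ 1 / (2 * ℓ))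
    (k : Fin ℓ) : ((F k).card : ℝ) ≤ 2 * (2 ^ (inn h k).card * ((n : ℝ) + 1) ^ (∑ j, a k j)) := by
  have hℓ0 : (0 : ℝ) < ℓ := by exact_mod_cast (by omega : 0 < ℓ)
  have h1 : pr (F k) (fun A => ∃ j ∈ univ.erase k, a k j < (A ∩ inn h j).card) ≤ 1 / 2 := by
    refine (pr_exists_le (univ.erase k) (fun j A => a k j < (A ∩ inn h j).card)
      fun A _ hA => hA).trans ?_
    refine (sum_le_card_nsmul _ _ (1 / (2 * (ℓ : ℝ))) fun j hj => ?_).trans ?_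
    · exact hle k j (mem_erase.1 hj).1.symm
    · rw [nsmul_eq_mul]
      have : ((univ.erase k : Finset (Fin ℓ)).card : ℝ) ≤ ℓ := by
        have := card_le_card (erase_subset k (univ : Finset (Fin ℓ)))
        rw [card_univ, Fintype.card_fin] at this
        exact_mod_cast this
      calc _ ≤ (ℓ : ℝ) * (1 / (2 * ℓ)) := by gcongr
        _ = 1 / 2 := by field_simp
  have h2 := pr_add_not (P := fun A => ∃ j ∈ univ.erase k, a k j < (A ∩ inn h j).card)
    (hc.ext.card_pos k)
  have h3 := card_le_of_sdiff_le
    ((F k).filter (fun A => ¬ ∃ j ∈ univ.erase k, a k j < (A ∩ inn h j).card)) (inn h k)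
    (∑ j, a k j) (by
      intro A hA
      have hA := (mem_filter.1 hA).2
      push Not at hA
      rw [card_sdiff_inn, ← add_sum_erase univ (fun j => a k j) (mem_univ k), hd, zero_add]
      exact sum_le_sum hA)
  rw [← pr_mul_card (P := fun A => ¬ ∃ j ∈ univ.erase k, a k j < (A ∩ inn h j).card)] at h3
  have h4 : (0 : ℝ) ≤ (F k).card := Nat.cast_nonneg _
  have h5 := mul_le_mul_of_nonneg_right (by linarith : (1 : ℝ) / 2 ≤
    pr (F k) (fun A => ¬ ∃ j ∈ univ.erase k, a k j < (A ∩ inn h j).card)) h4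
  linarith

lemma Closed.lo_of_sum_eq (hc : Closed m F h t C) (hC : 0 < C)
    (hup : ∀ k, ((F k).card : ℝ) ≤ 2 * (2 ^ (inn h k).card * ((n : ℝ) + 1) ^ (∑ j, a k j)))
    (hs : ∑ k, ∑ j, a k j = tot m) (k : Fin ℓ) :
    2 ^ (inn h k).card * ((n : ℝ) + 1) ^ (∑ j, a k j) ≤ C * 2 ^ ℓ * ((F k).card : ℝ) := by
  have h1 := hc.lower
  rw [← mul_prod_erase univ _ (mem_univ k)] at h1
  have h2 : ∏ i ∈ univ.erase k, ((F i).card : ℝ) ≤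
      ∏ i ∈ univ.erase k, (2 * (2 ^ (inn h i).card * ((n : ℝ) + 1) ^ (∑ j, a i j))) :=
    prod_le_prod (fun _ _ => Nat.cast_nonneg _) fun i _ => hup i
  have h3 : (2 : ℝ) ^ n * ((n : ℝ) + 1) ^ tot m =
      ∏ i, (2 ^ (inn h i).card * ((n : ℝ) + 1) ^ (∑ j, a i j)) := by
    rw [prod_two_pow_mul, hs]
  rw [h3, ← mul_prod_erase univ _ (mem_univ k)] at h1
  rw [prod_mul_distrib, prod_const] at h2
  obtain ⟨R, hR⟩ : ∃ R : ℝ, R = ∏ i ∈ univ.erase k, (2 ^ (inn h i).card *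
    ((n : ℝ) + 1) ^ (∑ j, a i j)) := ⟨_, rfl⟩
  have hR0 : 0 < R := by rw [hR]; exact prod_pos fun i _ => by positivity
  rw [← hR] at h1 h2
  have h4 : (2 : ℝ) ^ (univ.erase k : Finset (Fin ℓ)).card ≤ 2 ^ ℓ := by
    refine pow_le_pow_right₀ (by norm_num) ?_
    have := card_le_card (erase_subset k (univ : Finset (Fin ℓ)))
    rwa [card_univ, Fintype.card_fin] at this
  have h5 : ∏ i ∈ univ.erase k, ((F i).card : ℝ) ≤ 2 ^ ℓ * R :=
    h2.trans (mul_le_mul_of_nonneg_right h4 hR0.le)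
  have h6 : (0 : ℝ) ≤ (F k).card := Nat.cast_nonneg _
  have h7 := mul_le_mul_of_nonneg_left h5 (mul_nonneg hC.le h6)
  refine le_of_mul_le_mul_right ?_ hR0
  linarith

lemma sum_eq_tot (hd : ∀ k, a k k = 0) (hle : ∀ k j, k ≠ j → a k j + a j k ≤ m k j)
    (hs : tot m ≤ ∑ k, ∑ j, a k j) (hsym : ∀ k1 k2, m k1 k2 = m k2 k1) :
    ∑ k, ∑ j, a k j = tot m ∧ ∀ k j, k ≠ j → a k j + a j k = m k j := by
  rw [sum_sum_eq_pairs a hd] at hs ⊢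
  have h1 : ∀ q ∈ pairs ℓ, a q.1 q.2 + a q.2 q.1 ≤ m q.1 q.2 := fun q hq =>
    hle _ _ (by simp only [pairs, mem_filter] at hq; exact hq.2.ne)
  have h2 := (sum_le_sum h1).antisymm hs
  refine ⟨h2, fun k j hkj => ?_⟩
  have h3 := (sum_eq_sum_iff_of_le h1).1 h2
  rcases lt_or_gt_of_ne hkj with hlt | hlt
  · exact h3 (k, j) (by simp [pairs, hlt])
  · rw [add_comm, hsym]
    exact h3 (j, k) (by simp [pairs, hlt])

end

lemma exists_profile {ℓ : ℕ} (hℓ : 2 ≤ ℓ) (m : Fin ℓ → Fin ℓ → ℕ)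
    (hsym : ∀ k1 k2, m k1 k2 = m k2 k1) {C₀ : ℝ} (hC₀ : 0 < C₀) :
    ∃ C : ℝ, 0 < C ∧ ∀ᶠ n : ℕ in atTop, ∀ (F : Fin ℓ → Finset (Finset (Fin n))) (h t),
      Closed m F h t C₀ → ∃ a, Profile m F h t a C := by
  have hℓ0 : (0 : ℝ) < ℓ := by exact_mod_cast (by omega : 0 < ℓ)
  obtain ⟨K, hK⟩ : ∃ K : ℝ, K = C₀ * 2 ^ ℓ := ⟨_, rfl⟩
  have hK0 : 0 < K := by rw [hK]; positivity
  refine ⟨C₀ + 2 + K + (ℓ * (2 * C₀ * (2 * ℓ)) + K), by positivity, ?_⟩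
  have hL0 : 0 < ℓ * (2 * C₀ * (2 * ℓ)) := by positivity
  filter_upwards [ev_le (K + 1), pre_profile m hℓ C₀] with n hn hpre F h t hc
  have hN : (0 : ℝ) < (n : ℝ) + 1 := by positivity
  obtain ⟨a, hd, hle, hge, hlt⟩ := hpre F h t hc
  have hup := hc.card_le_two_mul hℓ hd hlt
  have hs : tot m ≤ ∑ k, ∑ j, a k j := by
    by_contra hcon
    push Not at hcon
    have h1 : ∏ k, ((F k).card : ℝ) ≤
        ∏ k, (2 * (2 ^ (inn h k).card * ((n : ℝ) + 1) ^ (∑ j, a k j))) :=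
      prod_le_prod (fun _ _ => Nat.cast_nonneg _) fun i _ => hup i
    rw [prod_mul_distrib, prod_two_pow_mul, prod_const, card_univ, Fintype.card_fin] at h1
    have h4 := hc.lower.trans (mul_le_mul_of_nonneg_left h1 hC₀.le)
    have h5 : ((n : ℝ) + 1) ^ ((∑ k, ∑ j, a k j) + 1) ≤ ((n : ℝ) + 1) ^ tot m :=
      pow_le_pow_right₀ (by have : (0 : ℝ) ≤ n := Nat.cast_nonneg n; linarith) hcon
    have h6 : (0 : ℝ) < 2 ^ n * ((n : ℝ) + 1) ^ (∑ k, ∑ j, a k j) := by positivity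
    have h7 : ((n : ℝ) + 1) * (2 ^ n * ((n : ℝ) + 1) ^ (∑ k, ∑ j, a k j)) ≤
        K * (2 ^ n * ((n : ℝ) + 1) ^ (∑ k, ∑ j, a k j)) := by
      rw [hK]
      refine le_trans ?_ (h4.trans (le_of_eq (by ring)))
      refine le_trans (le_of_eq ?_) (mul_le_mul_of_nonneg_left h5 (by positivity : (0 : ℝ) ≤ 2 ^ n))
      rw [pow_succ]; ring
    have := le_of_mul_le_mul_right h7 h6
    linarith
  obtain ⟨hs', hsum⟩ := sum_eq_tot hd hle hs hsym
  have hlo := hc.lo_of_sum_eq hC₀ hup hs'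
  rw [← hK] at hlo
  refine ⟨a, hc.mono (by linarith), hd, hsum, fun k => (hup k).trans ?_, fun k => (hlo k).trans ?_,
    fun k => ?_⟩
  · exact mul_le_mul_of_nonneg_right (by linarith) (by positivity)
  · exact mul_le_mul_of_nonneg_right (by linarith) (Nat.cast_nonneg _)
  have hgt : ∀ j, j ≠ k → pr (F k) (fun A => a k j < (A ∩ inn h j).card) ≤
      2 * C₀ * (2 * ℓ) / ((n : ℝ) + 1) := by
    intro j hj
    by_contra hcon
    push Not at hcon
    have h1 := hge j k hj
    have h2 := hc.add_le hj.symm (v := a k j + 1) (w := a j k) (by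
      have e : 2 * C₀ / ((n : ℝ) + 1) = 2 * C₀ * (2 * ℓ) / ((n : ℝ) + 1) * (1 / (2 * ℓ)) := by
        field_simp
      rw [e]
      exact mul_lt_mul hcon h1 (by positivity) pr_nonneg)
    have := hsum k j hj.symm
    omega
  have hlow : pr (F k) (fun A => (∀ j ∈ univ.erase k, (A ∩ inn h j).card ≤ a k j) ∧
      ∃ j ∈ univ.erase k, (A ∩ inn h j).card < a k j) ≤ K / ((n : ℝ) + 1) := by
    refine pr_le_of_card_le (hc.ext.card_pos k) ?_
    by_cases hz : ∑ j, a k j = 0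
    · rw [filter_false_of_mem]
      · simp; positivity
      · rintro A _ ⟨_, j, _, hj⟩
        have : a k j ≤ ∑ j, a k j := single_le_sum (f := fun j => a k j) (fun _ _ => Nat.zero_le _) (mem_univ j)
        omega
    have h1 := card_le_of_sdiff_le ((F k).filter
      (fun A => (∀ j ∈ univ.erase k, (A ∩ inn h j).card ≤ a k j) ∧
      ∃ j ∈ univ.erase k, (A ∩ inn h j).card < a k j)) (inn h k) (∑ j, a k j - 1) (by
      intro A hA
      obtain ⟨_, h1, h2⟩ := mem_filter.1 hA
      have h3 := sum_lt_sum h1 h2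
      rw [← card_sdiff_inn] at h3
      have h4 := add_sum_erase univ (fun j => a k j) (mem_univ k)
      simp only [hd, zero_add] at h4
      omega)
    refine h1.trans ?_
    rw [div_mul_eq_mul_div, le_div_iff₀ hN, mul_assoc, ← pow_succ, Nat.sub_add_cancel (by omega)]
    exact hlo k
  have h1 := pr_le_add (F := F k) (P := fun A => ∃ j, j ≠ k ∧ (A ∩ inn h j).card ≠ a k j)
    (Q := fun A => ∃ j ∈ univ.erase k, a k j < (A ∩ inn h j).card)
    (R := fun A => (∀ j ∈ univ.erase k, (A ∩ inn h j).card ≤ a k j) ∧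
      ∃ j ∈ univ.erase k, (A ∩ inn h j).card < a k j) (by
    rintro A _ ⟨j, hj, hne⟩
    by_cases hx : ∃ j ∈ univ.erase k, a k j < (A ∩ inn h j).card
    · exact Or.inl hx
    · push Not at hx
      have := hx j (by simp [hj])
      exact Or.inr ⟨hx, j, by simp [hj], by omega⟩)
  have h2 : pr (F k) (fun A => ∃ j ∈ univ.erase k, a k j < (A ∩ inn h j).card) ≤
      ℓ * (2 * C₀ * (2 * ℓ) / ((n : ℝ) + 1)) := by
    refine (pr_exists_le (univ.erase k) (fun j A => a k j < (A ∩ inn h j).card)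
      fun A _ hA => hA).trans ?_
    refine (sum_le_card_nsmul _ _ _ fun j hj => hgt j (mem_erase.1 hj).1).trans ?_
    rw [nsmul_eq_mul]
    have : ((univ.erase k : Finset (Fin ℓ)).card : ℝ) ≤ ℓ := by
      have := card_le_card (erase_subset k (univ : Finset (Fin ℓ)))
      rw [card_univ, Fintype.card_fin] at this
      exact_mod_cast this
    exact mul_le_mul_of_nonneg_right this (by positivity)
  refine (h1.trans (add_le_add h2 hlow)).trans ?_
  rw [← mul_div_assoc, ← add_div]
  exact div_le_div_of_nonneg_right (by linarith) hN.le

section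
variable {n ℓ : ℕ} {m : Fin ℓ → Fin ℓ → ℕ} {F : Fin ℓ → Finset (Finset (Fin n))}
  {h t : Fin n → Fin ℓ} {C : ℝ} {a : Fin ℓ → Fin ℓ → ℕ}

lemma cell_self (hht : ∀ y, h y ≠ t y) (k : Fin ℓ) : cell h t k k = ∅ := by
  ext y
  simp only [mem_cell, notMem_empty, iff_false, not_and]
  exact fun h1 h2 => hht y (h2.trans h1.symm)

lemma sdiff_mem_slices (hht : ∀ y, h y ≠ t y) (hd : ∀ k, a k k = 0) {k : Fin ℓ}
    {A : Finset (Fin n)} (h1 : ∀ j, j ≠ k → (A ∩ inn h j).card = a k j)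
    (h2 : ∀ y ∈ A, h y = k ∨ t y = k) : A \ inn h k ∈ slices (cell h t k) (a k) := by
  rw [mem_slices]
  constructor
  · intro y hy
    rw [Finset.mem_sdiff, mem_inn] at hy
    exact mem_biUnion.2 ⟨h y, mem_univ _, mem_cell.2 ⟨(h2 y hy.1).resolve_left hy.2, rfl⟩⟩
  · intro j
    by_cases hj : j = k
    · subst hj
      rw [cell_self hht, inter_empty, hd, card_empty]
    · rw [← h1 j hj]
      congr 1
      ext y
      simp only [mem_inter, Finset.mem_sdiff, mem_inn, mem_cell]
      constructor
      · rintro ⟨⟨h3, _⟩, _, h4⟩; exact ⟨h3, h4⟩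
      · rintro ⟨h3, h4⟩
        have h5 : h y ≠ k := fun h6 => hj (h4.symm.trans h6)
        exact ⟨⟨h3, h5⟩, (h2 y h3).resolve_left h5, h4⟩

lemma Good.triple (hg : Good m F h t C) (hN : 4 * C ≤ (n : ℝ) + 1) {k : Fin ℓ} {y : Fin n}
    (hk : k ≠ h y) (hk' : k ≠ t y) :
    pp (F k) y * pp (F (t y)) y * ((n : ℝ) + 1) ^ 3 ≤ 4 * C := by
  have hN0 : (0 : ℝ) < (n : ℝ) + 1 := by positivity
  have h1 := link_points hg.ext hg.link {k, t y, h y} y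
  have h2 : t y ∉ ({h y} : Finset (Fin ℓ)) := by simpa using (hg.ne y).symm
  have h3 : k ∉ ({t y, h y} : Finset (Fin ℓ)) := by simp [hk, hk']
  rw [prod_insert h3, prod_insert h2, prod_singleton, card_insert_of_notMem h3,
    card_insert_of_notMem h2, card_singleton] at h1
  have e : (1 + 1 + 1 : ℕ).choose 2 = 3 := rfl
  rw [e] at h1
  have h4 : 1 / 4 ≤ pp (F (h y)) y := by
    have h5 := hg.top y
    have h6 : C / ((n : ℝ) + 1) ≤ 1 / 4 := by rw [div_le_iff₀ hN0]; linarith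
    linarith
  obtain ⟨q, hq⟩ : ∃ q : ℝ, q = pp (F k) y * pp (F (t y)) y * ((n : ℝ) + 1) ^ 3 := ⟨_, rfl⟩
  have hq0 : 0 ≤ q := by
    rw [hq]; exact mul_nonneg (mul_nonneg (pp_nonneg _ _) (pp_nonneg _ _)) (by positivity)
  have h7 := mul_le_mul_of_nonneg_left h4 hq0
  have h8 : q * pp (F (h y)) y ≤ C := by rw [hq]; linarith
  rw [← hq]
  linarith

lemma exists_alien_le (k : Fin ℓ) {δ : ℝ} (hδ : 0 ≤ δ)
    (hal : ∀ y, k ≠ h y → k ≠ t y → pp (F k) y ≤ δ / ((n : ℝ) + 1)) :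
    pr (F k) (fun A => ∃ y ∈ A, ¬ (h y = k ∨ t y = k)) ≤ δ := by
  have hN0 : (0 : ℝ) < (n : ℝ) + 1 := by positivity
  refine (pr_exists_le (univ.filter (fun y => ¬ (h y = k ∨ t y = k))) (fun y A => y ∈ A)
    (fun A _ hA => ?_)).trans ?_
  · obtain ⟨y, hy, hy'⟩ := hA
    exact ⟨y, by simpa using hy', hy⟩
  · refine (sum_le_card_nsmul _ _ (δ / ((n : ℝ) + 1)) fun y hy => ?_).trans ?_
    · simp only [mem_filter, mem_univ, true_and, not_or] at hy
      exact hal y (Ne.symm hy.1) (Ne.symm hy.2)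
    · rw [nsmul_eq_mul]
      have h1 : ((univ.filter (fun y => ¬ (h y = k ∨ t y = k))).card : ℝ) ≤ (n : ℝ) + 1 := by
        have := card_filter_le univ (fun y => ¬ (h y = k ∨ t y = k))
        rw [card_univ, Fintype.card_fin] at this
        have : ((univ.filter (fun y => ¬ (h y = k ∨ t y = k))).card : ℝ) ≤ n := by exact_mod_cast this
        linarith
      refine (mul_le_mul_of_nonneg_right h1 (by positivity)).trans (le_of_eq ?_)
      field_simp

lemma Profile.not_slices_le (hp : Profile m F h t a C) (k : Fin ℓ) {δ : ℝ} (hδ : 0 ≤ δ)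
    (hal : ∀ y, k ≠ h y → k ≠ t y → pp (F k) y ≤ δ / ((n : ℝ) + 1)) :
    pr (F k) (fun A => A \ inn h k ∉ slices (cell h t k) (a k)) ≤ C / ((n : ℝ) + 1) + δ := by
  refine (pr_le_add (Q := fun A => ∃ j, j ≠ k ∧ (A ∩ inn h j).card ≠ a k j)
    (R := fun A => ∃ y ∈ A, ¬ (h y = k ∨ t y = k)) fun A _ hA => ?_).trans
    (add_le_add (hp.typ k) (exists_alien_le k hδ hal))
  by_contra hcon
  push Not at hcon
  refine hA (sdiff_mem_slices hp.ne hp.diag hcon.1 fun y hy => ?_)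
  have := hcon.2 y hy
  tauto

end

/-- Asymptotically almost every member of `F k` is of the generic shape. -/
lemma Profile.not_slices_small {ℓ : ℕ} (m : Fin ℓ → Fin ℓ → ℕ) {C η : ℝ} (hη : 0 < η) :
    ∀ᶠ n : ℕ in atTop, ∀ (F : Fin ℓ → Finset (Finset (Fin n))) (h t a), Profile m F h t a C →
      ∀ k, pr (F k) (fun A => A \ inn h k ∉ slices (cell h t k) (a k)) ≤ η := by
  filter_upwards [ev_le (4 * C), ev_le (C / (η / 2)), ev_le (4 * C / (η / 2) ^ 2)] with
    n hn1 hn2 hn3 F h t a hp k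
  have hN0 : (0 : ℝ) < (n : ℝ) + 1 := by positivity
  have h1 : C / ((n : ℝ) + 1) ≤ η / 2 := by
    rw [div_le_iff₀ (by positivity)] at hn2 ⊢
    linarith
  refine (hp.not_slices_le k (δ := η / 2) (by positivity) fun y hk hk' => ?_).trans (by linarith)
  have h2 := hp.triple hn1 hk hk'
  have h3 : pp (F k) y ^ 2 ≤ pp (F k) y * pp (F (t y)) y := by
    rw [pow_two]
    exact mul_le_mul_of_nonneg_left (hp.snd y k hk) (pp_nonneg _ _)
  have h4 : pp (F k) y ^ 2 * ((n : ℝ) + 1) ^ 3 ≤ 4 * C :=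
    (mul_le_mul_of_nonneg_right h3 (by positivity)).trans h2
  have h5 : 4 * C ≤ (η / 2) ^ 2 * ((n : ℝ) + 1) := by
    rw [div_le_iff₀ (by positivity)] at hn3
    linarith
  rw [le_div_iff₀ hN0]
  refine le_of_sq_le_sq ?_ (by positivity)
  have h6 : (pp (F k) y * ((n : ℝ) + 1)) ^ 2 * ((n : ℝ) + 1) ≤ (η / 2) ^ 2 * ((n : ℝ) + 1) := by
    refine le_trans (le_of_eq ?_) (h4.trans h5)
    ring
  exact le_of_mul_le_mul_right h6 hN0

/-- The generic outer traces all of whose unions with subsets of `inn h k` belong to `F k`. -/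
def full {n ℓ : ℕ} (F : Fin ℓ → Finset (Finset (Fin n))) (h t : Fin n → Fin ℓ)
    (a : Fin ℓ → Fin ℓ → ℕ) (k : Fin ℓ) : Finset (Finset (Fin n)) :=
  (slices (cell h t k) (a k)).filter (fun T => inn h k ∪ T ∈ F k)

section
variable {n ℓ : ℕ} {m : Fin ℓ → Fin ℓ → ℕ} {F : Fin ℓ → Finset (Finset (Fin n))}
  {h t : Fin n → Fin ℓ} {C : ℝ} {a : Fin ℓ → Fin ℓ → ℕ}

lemma Closed.exists_core (hc : Closed m F h t C) (hsym : ∀ k1 k2, m k1 k2 = m k2 k1) {k : Fin ℓ}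
    {T : Finset (Fin n)} (hT : inn h k ∪ T ∉ F k) : ∃ D ⊆ inn h k, D.card ≤ MM m ∧
      ∀ E, D ⊆ E → E ∪ T ∉ F k := by
  by_contra hcon
  push Not at hcon
  refine hT (prod_update_insert_le hc.ext k _ hsym fun j hj B hB => ?_)
  obtain ⟨E, hE, hE'⟩ := hcon (B ∩ inn h k) inter_subset_right
    ((hc.trace j k hj B hB).trans (le_MM m j k))
  refine le_trans (card_le_card fun x hx => ?_) (hc.ext.1 k j hj.symm _ hE' B hB)
  simp only [mem_inter, mem_union] at hx ⊢
  refine ⟨hx.1.imp (fun h1 => hE (mem_inter.2 ⟨hx.2, h1⟩)) id, hx.2⟩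

lemma card_powerset_not_ge {I D : Finset (Fin n)} (hD : D ⊆ I) {M : ℕ} (hM : D.card ≤ M) :
    ((I.powerset.filter (fun E => ¬ D ⊆ E)).card : ℝ) ≤ (1 - 1 / 2 ^ M) * 2 ^ I.card := by
  have h1 := card_filter_add_card_filter_not (s := I.powerset) (fun E => D ⊆ E)
  rw [card_powerset] at h1
  have h2 : (I \ D).powerset.card ≤ (I.powerset.filter (fun E => D ⊆ E)).card := by
    refine card_le_card_of_injOn (fun E => E ∪ D) (fun E hE => ?_) ?_
    · simp only [coe_powerset, Set.mem_preimage, Set.mem_powerset_iff, coe_subset] at hE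
      simp only [coe_filter, mem_powerset, Set.mem_ofPred_eq]
      exact ⟨union_subset (hE.trans sdiff_subset) hD, subset_union_right⟩
    · intro E hE E' hE' hEE
      simp only [coe_powerset, Set.mem_preimage, Set.mem_powerset_iff, coe_subset] at hE hE'
      have h3 : ∀ X, X ⊆ I \ D → (X ∪ D) \ D = X := fun X hX => by
        rw [union_sdiff_right, sdiff_eq_self_of_disjoint (disjoint_of_subset_left hX sdiff_disjoint)]
      rw [← h3 E hE, ← h3 E' hE']
      exact congrArg (· \ D) hEE
  rw [card_powerset] at h2
  have h3 : (I \ D).card + D.card = I.card := card_sdiff_add_card_eq_card hD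
  have h4 : (2 : ℝ) ^ I.card ≤ 2 ^ M * 2 ^ (I \ D).card := by
    rw [← pow_add]
    exact pow_le_pow_right₀ (by norm_num) (by omega)
  have h5 : ((I.powerset.filter (fun E => D ⊆ E)).card : ℝ) +
    (I.powerset.filter (fun E => ¬ D ⊆ E)).card = 2 ^ I.card := by exact_mod_cast h1
  have h6 : (2 : ℝ) ^ (I \ D).card ≤ (I.powerset.filter (fun E => D ⊆ E)).card := by
    exact_mod_cast h2
  have h7 : (1 / 2 ^ M : ℝ) * 2 ^ I.card ≤ 2 ^ (I \ D).card := by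
    rw [one_div, inv_mul_le_iff₀ (by positivity)]
    exact h4
  linarith

lemma Closed.card_fiber_le (hc : Closed m F h t C) (hsym : ∀ k1 k2, m k1 k2 = m k2 k1) {k : Fin ℓ}
    (T : Finset (Fin n)) (hT : inn h k ∪ T ∉ F k) :
    (((F k).filter (fun A => A \ inn h k = T)).card : ℝ) ≤
      (1 - 1 / 2 ^ MM m) * 2 ^ (inn h k).card := by
  obtain ⟨D, hD, hDM, hDT⟩ := hc.exists_core hsym hT
  refine le_trans (Nat.cast_le.2 ?_) (card_powerset_not_ge hD hDM)
  refine card_le_card_of_injOn (fun A => A ∩ inn h k) (fun A hA => ?_) ?_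
  · rw [mem_coe, mem_filter] at hA
    rw [mem_coe, mem_filter, mem_powerset]
    refine ⟨inter_subset_right, fun hDA => hDT (A ∩ inn h k) hDA ?_⟩
    rw [← hA.2, union_comm, sdiff_union_inter]
    exact hA.1
  · intro A hA B hB hAB
    rw [← sdiff_union_inter A (inn h k), ← sdiff_union_inter B (inn h k), (mem_filter.1 hA).2,
      (mem_filter.1 hB).2]
    exact congrArg (T ∪ ·) hAB

lemma card_fiber_le_two_pow (G : Finset (Finset (Fin n))) (I T : Finset (Fin n)) :
    (G.filter (fun A => A \ I = T)).card ≤ 2 ^ I.card := by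
  rw [← card_powerset]
  refine card_le_card_of_injOn (fun A => A ∩ I) (fun A _ => ?_) ?_
  · rw [mem_coe, mem_powerset]; exact inter_subset_right
  · intro A hA B hB hAB
    rw [← sdiff_union_inter A I, ← sdiff_union_inter B I, (mem_filter.1 hA).2,
      (mem_filter.1 hB).2]
    exact congrArg (T ∪ ·) hAB

lemma Closed.card_typ_le (hc : Closed m F h t C) (hsym : ∀ k1 k2, m k1 k2 = m k2 k1) (k : Fin ℓ)
    (a : Fin ℓ → Fin ℓ → ℕ) :
    (((F k).filter (fun A => A \ inn h k ∈ slices (cell h t k) (a k))).card : ℝ) ≤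
      2 ^ (inn h k).card * ((slices (cell h t k) (a k)).card - 1 / 2 ^ MM m *
        ((slices (cell h t k) (a k)).filter (fun T => inn h k ∪ T ∉ F k)).card) := by
  have h1 := card_eq_sum_card_fiberwise (f := fun A => A \ inn h k)
    (s := (F k).filter (fun A => A \ inn h k ∈ slices (cell h t k) (a k)))
    (t := slices (cell h t k) (a k)) (fun A hA => (mem_filter.1 hA).2)
  rw [h1, Nat.cast_sum]
  have h2 : ∀ T ∈ slices (cell h t k) (a k),
      ((((F k).filter (fun A => A \ inn h k ∈ slices (cell h t k) (a k))).filter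
        (fun A => A \ inn h k = T)).card : ℝ) ≤
      2 ^ (inn h k).card * (1 - if inn h k ∪ T ∉ F k then 1 / 2 ^ MM m else 0) := by
    intro T hT
    have h3 : (((F k).filter (fun A => A \ inn h k ∈ slices (cell h t k) (a k))).filter
        (fun A => A \ inn h k = T)).card ≤ ((F k).filter (fun A => A \ inn h k = T)).card :=
      card_le_card (filter_subset_filter _ (filter_subset _ _))
    have h4 := (Nat.cast_le (α := ℝ)).2 h3
    refine h4.trans ?_
    split_ifs with h5
    · rw [sub_zero, mul_one]
      exact_mod_cast card_fiber_le_two_pow (F k) (inn h k) T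
    · rw [mul_comm]
      exact hc.card_fiber_le hsym T h5
  refine (sum_le_sum h2).trans (le_of_eq ?_)
  rw [← mul_sum, sum_sub_distrib, ← sum_filter, sum_const, sum_const]
  simp only [nsmul_eq_mul, mul_one]
  ring

lemma prod_card_slices (h t : Fin n → Fin ℓ) (a : Fin ℓ → Fin ℓ → ℕ) :
    ∏ k, ∏ j, (cell h t k j).card.choose (a k j) = ∏ k, (slices (cell h t k) (a k)).card :=
  prod_congr rfl fun k _ => (card_slices _ _ (disjoint_cell k)).symm

/-- Consequences of almost all members being generic. -/
lemma Profile.weights (hp : Profile m F h t a C) (hsym : ∀ k1 k2, m k1 k2 = m k2 k1) {η : ℝ}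
    (hη1 : η ≤ 1)
    (hη : ∀ k, pr (F k) (fun A => A \ inn h k ∉ slices (cell h t k) (a k)) ≤ η) :
    (∀ k, (1 - η) * (F k).card ≤ 2 ^ (inn h k).card * ((slices (cell h t k) (a k)).card - 1 / 2 ^ MM m *
        ((slices (cell h t k) (a k)).filter (fun T => inn h k ∪ T ∉ F k)).card : ℝ)) ∧
    (1 - η) ^ ℓ * ∏ k, ((F k).card : ℝ) ≤
      2 ^ n * ∏ k, ((slices (cell h t k) (a k)).card : ℝ) := by
  have h1 : ∀ k, (1 - η) * (F k).card ≤ 2 ^ (inn h k).card * ((slices (cell h t k) (a k)).card - 1 / 2 ^ MM m *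
        ((slices (cell h t k) (a k)).filter (fun T => inn h k ∪ T ∉ F k)).card : ℝ) := by
    intro k
    refine le_trans ?_ (hp.card_typ_le hsym k a)
    rw [← pr_mul_card (P := fun A => A \ inn h k ∈ slices (cell h t k) (a k))]
    refine mul_le_mul_of_nonneg_right ?_ (Nat.cast_nonneg _)
    have := pr_add_not (P := fun A => A \ inn h k ∈ slices (cell h t k) (a k)) (hp.ext.card_pos k)
    have := hη k
    linarith
  refine ⟨h1, ?_⟩
  have h2 : ∏ k, ((1 - η) * ((F k).card : ℝ)) ≤
      ∏ k, ((2 : ℝ) ^ (inn h k).card * (slices (cell h t k) (a k)).card) := by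
    refine prod_le_prod (fun k _ => mul_nonneg (by linarith) (Nat.cast_nonneg _)) fun k _ => ?_
    refine (h1 k).trans (mul_le_mul_of_nonneg_left ?_ (by positivity))
    have : (0 : ℝ) ≤ 1 / 2 ^ MM m *
      ((slices (cell h t k) (a k)).filter (fun T => inn h k ∪ T ∉ F k)).card :=
      mul_nonneg (by positivity) (Nat.cast_nonneg _)
    linarith
  rw [prod_mul_distrib, prod_mul_distrib, prod_const, card_univ, Fintype.card_fin] at h2
  have h3 : ∏ k, (2 : ℝ) ^ (inn h k).card = 2 ^ n := by exact_mod_cast prod_two_pow_inn h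
  rwa [h3] at h2

lemma Profile.nonfull_le (hp : Profile m F h t a C) (hsym : ∀ k1 k2, m k1 k2 = m k2 k1) {η : ℝ}
    (hη1 : η ≤ 1)
    (hη : ∀ k, pr (F k) (fun A => A \ inn h k ∉ slices (cell h t k) (a k)) ≤ η) (k : Fin ℓ) :
    (((slices (cell h t k) (a k)).filter (fun T => inn h k ∪ T ∉ F k)).card : ℝ) ≤
      2 ^ MM m * (ℓ * η) * (slices (cell h t k) (a k)).card := by
  obtain ⟨h1, -⟩ := hp.weights hsym hη1 hη
  have hge := hp.ext.ge_struct hp.ne (a := a) fun k j hkj => (hp.sum k j hkj).le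
  rw [prod_card_slices] at hge
  have hge' : (2 : ℝ) ^ n * ∏ k, ((slices (cell h t k) (a k)).card : ℝ) ≤
    ∏ k, ((F k).card : ℝ) := by exact_mod_cast hge
  obtain ⟨s, hs⟩ : ∃ s : Fin ℓ → ℝ, s = fun k => ((slices (cell h t k) (a k)).card : ℝ) := ⟨_, rfl⟩
  obtain ⟨u, hu⟩ : ∃ u : Fin ℓ → ℝ, u = fun k => (1 / 2 ^ MM m *
        ((slices (cell h t k) (a k)).filter (fun T => inn h k ∪ T ∉ F k)).card : ℝ) := ⟨_, rfl⟩
  have hsk : ∀ k, ((slices (cell h t k) (a k)).card : ℝ) = s k := fun k => by rw [hs]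
  have huk : ∀ k, (1 / 2 ^ MM m *
        ((slices (cell h t k) (a k)).filter (fun T => inn h k ∪ T ∉ F k)).card : ℝ) = u k :=
    fun k => by rw [hu]
  have hs0 : ∀ k, 0 ≤ s k := fun k => by rw [← hsk]; exact Nat.cast_nonneg _
  have hu0 : ∀ k, 0 ≤ u k := fun k => by
    rw [← huk]; exact mul_nonneg (by positivity) (Nat.cast_nonneg _)
  simp only [hsk, huk] at h1 hge' ⊢
  have hF0 : ∀ k, (0 : ℝ) < (F k).card := fun k => by exact_mod_cast hp.ext.card_pos k
  have h2 : (∏ i ∈ univ.erase k, ((1 - η) * ((F i).card : ℝ))) ≤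
      ∏ i ∈ univ.erase k, ((2 : ℝ) ^ (inn h i).card * s i) := by
    refine prod_le_prod (fun k _ => mul_nonneg (by linarith) (Nat.cast_nonneg _)) fun k _ => ?_
    refine (h1 k).trans (mul_le_mul_of_nonneg_left ?_ (by positivity))
    linarith [hu0 k]
  have hnn : 0 ≤ (1 - η) * ((F k).card : ℝ) := mul_nonneg (by linarith) (Nat.cast_nonneg _)
  have h3 : (∏ i, ((1 - η) * ((F i).card : ℝ))) ≤ (2 ^ (inn h k).card * (s k - u k)) *
      ∏ i ∈ univ.erase k, ((2 : ℝ) ^ (inn h i).card * s i) := by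
    rw [← mul_prod_erase univ _ (mem_univ k)]
    exact mul_le_mul (h1 k) h2 (prod_nonneg fun i _ => mul_nonneg (by linarith) (Nat.cast_nonneg _))
      (hnn.trans (h1 k))
  have h4 : s k * ((2 ^ (inn h k).card * (s k - u k)) *
      ∏ i ∈ univ.erase k, ((2 : ℝ) ^ (inn h i).card * s i)) =
      (s k - u k) * (2 ^ n * ∏ i, s i) := by
    have h5 : (2 : ℝ) ^ n * ∏ i, s i = ∏ i, ((2 : ℝ) ^ (inn h i).card * s i) := by
      rw [prod_mul_distrib]
      congr 1
      exact_mod_cast (prod_two_pow_inn h).symm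
    rw [h5, ← mul_prod_erase univ _ (mem_univ k)]
    ring
  have h5 : 0 ≤ s k - u k := by
    have := hnn.trans (h1 k)
    exact nonneg_of_mul_nonneg_right this (by positivity)
  have h6 : s k * ((1 - η) ^ ℓ * ∏ i, ((F i).card : ℝ)) ≤
      (s k - u k) * ∏ i, ((F i).card : ℝ) := by
    have e : (1 - η) ^ ℓ * ∏ i, ((F i).card : ℝ) = ∏ i, ((1 - η) * ((F i).card : ℝ)) := by
      rw [prod_mul_distrib, prod_const, card_univ, Fintype.card_fin]
    rw [e]
    refine (mul_le_mul_of_nonneg_left h3 (hs0 k)).trans ?_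
    rw [h4]
    exact mul_le_mul_of_nonneg_left hge' h5
  have h7 : s k * (1 - η) ^ ℓ ≤ s k - u k := by
    refine le_of_mul_le_mul_right ?_ (prod_pos fun i _ => hF0 i : (0 : ℝ) < ∏ i, ((F i).card : ℝ))
    rw [mul_assoc]
    exact h6
  have h8 : 1 + (ℓ : ℝ) * (-η) ≤ (1 + -η) ^ ℓ := one_add_mul_le_pow (by linarith) ℓ
  have h9 := mul_le_mul_of_nonneg_left h8 (hs0 k)
  have h10 : u k ≤ ℓ * η * s k := by
    have e : (1 + -η) = 1 - η := by ring
    rw [e] at h9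
    linarith
  rw [← huk, one_div, inv_mul_le_iff₀ (by positivity)] at h10
  linarith

end

lemma two_choose_le_choose_add (α β a b : ℕ) :
    α.choose (a + 1) * β.choose b + α.choose a * β.choose (b + 1) ≤ (α + β).choose (a + 1 + b) := by
  rw [Nat.add_choose_eq]
  have h1 : ((a + 1, b) : ℕ × ℕ) ≠ (a, b + 1) := by simp
  rw [← sum_pair (f := fun p : ℕ × ℕ => α.choose p.1 * β.choose p.2) h1]
  refine sum_le_sum_of_subset fun p hp => ?_
  rw [mem_insert, mem_singleton] at hp
  rw [Finset.HasAntidiagonal.mem_antidiagonal]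
  rcases hp with rfl | rfl
  · rfl
  · show a + (b + 1) = a + 1 + b
    omega

lemma choose_add_gain {α β a b : ℕ} {K N : ℝ} (hα : (α : ℝ) ≤ N) (hN : 0 < N)
    (hβ : N ≤ K * β) (hb : 2 * b ≤ β) :
    (1 + 1 / (2 * (b + 1) * K)) * (α.choose (a + 1) * β.choose b : ℝ) ≤
      (α + β).choose (a + 1 + b) := by
  have h1 : (α.choose (a + 1) : ℝ) ≤ N * α.choose a := by
    have e := Nat.choose_succ_right_eq α a
    have : α.choose (a + 1) ≤ α * α.choose a := by
      calc _ ≤ α.choose (a + 1) * (a + 1) := Nat.le_mul_of_pos_right _ (by omega)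
        _ = α.choose a * (α - a) := e
        _ ≤ α.choose a * α := Nat.mul_le_mul_left _ (Nat.sub_le _ _)
        _ = _ := mul_comm _ _
    have h2 : (α.choose (a + 1) : ℝ) ≤ α * α.choose a := by exact_mod_cast this
    exact h2.trans (mul_le_mul_of_nonneg_right hα (Nat.cast_nonneg _))
  have h2 : (β.choose b : ℝ) * β ≤ 2 * (b + 1) * β.choose (b + 1) := by
    have e := Nat.choose_succ_right_eq β b
    have : β.choose b * β ≤ 2 * (b + 1) * β.choose (b + 1) := by
      calc _ ≤ β.choose b * (2 * (β - b)) := Nat.mul_le_mul_left _ (by omega)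
        _ = 2 * (β.choose b * (β - b)) := by ring
        _ = 2 * (β.choose (b + 1) * (b + 1)) := by rw [e]
        _ = _ := by ring
    exact_mod_cast this
  have hK : 0 < K := by
    by_contra hcon
    have := mul_nonpos_of_nonpos_of_nonneg (not_lt.1 hcon) (Nat.cast_nonneg (α := ℝ) β)
    linarith
  have h3 : N * (β.choose b : ℝ) ≤ 2 * (b + 1) * K * β.choose (b + 1) := by
    have := mul_le_mul_of_nonneg_right hβ (Nat.cast_nonneg (α := ℝ) (β.choose b))
    have := mul_le_mul_of_nonneg_left h2 hK.le
    linarith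
  have h4 : (α.choose (a + 1) * β.choose b : ℝ) ≤
      2 * (b + 1) * K * (α.choose a * β.choose (b + 1)) := by
    have h5 := mul_le_mul_of_nonneg_right h1 (Nat.cast_nonneg (α := ℝ) (β.choose b))
    have h6 := mul_le_mul_of_nonneg_left h3 (Nat.cast_nonneg (α := ℝ) (α.choose a))
    linarith
  have h5 : 1 / (2 * (b + 1) * K) * (α.choose (a + 1) * β.choose b : ℝ) ≤
      α.choose a * β.choose (b + 1) := by
    rw [one_div, inv_mul_le_iff₀ (by positivity)]
    exact h4
  have h6 : (α.choose (a + 1) * β.choose b + α.choose a * β.choose (b + 1) : ℝ) ≤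
      (α + β).choose (a + 1 + b) := by exact_mod_cast two_choose_le_choose_add α β a b
  linarith

section
variable {n ℓ : ℕ} {m : Fin ℓ → Fin ℓ → ℕ} {F : Fin ℓ → Finset (Finset (Fin n))}
  {h t : Fin n → Fin ℓ} {C : ℝ} {a : Fin ℓ → Fin ℓ → ℕ}

lemma prod_prod_split {M : Type*} [CommMonoid M] {k j : Fin ℓ} (hkj : k ≠ j)
    (f : Fin ℓ → Fin ℓ → M) : ∏ x, ∏ y, f x y = f k j * (f j k *
      ∏ p ∈ (univ.erase (k, j)).erase (j, k), f p.1 p.2) := by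
  rw [mul_prod_erase (univ.erase (k, j)) (fun p : Fin ℓ × Fin ℓ => f p.1 p.2) (a := (j, k))
    (by simp [hkj.symm]), mul_prod_erase univ (fun p : Fin ℓ × Fin ℓ => f p.1 p.2) (mem_univ (k, j)),
    ← univ_product_univ, prod_product]

lemma Extremal.ge_merged (hF : Extremal m F) (hsym : ∀ k1 k2, m k1 k2 = m k2 k1)
    (hht : ∀ y, h y ≠ t y) {k j : Fin ℓ} (hkj : k ≠ j)
    (ha : ∀ k j, k ≠ j → a k j + a j k ≤ m k j) :
    2 ^ n * (((cell h t k j).card + (cell h t j k).card).choose (m k j) *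
      ∏ p ∈ (univ.erase (k, j)).erase (j, k), (cell h t p.1 p.2).card.choose (a p.1 p.2)) ≤
      ∏ k, (F k).card := by
  set h' : Fin n → Fin ℓ := fun y => if t y = j ∧ h y = k then j else h y with hh'
  set t' : Fin n → Fin ℓ := fun y => if t y = j ∧ h y = k then k else t y with ht'
  set a' : Fin ℓ → Fin ℓ → ℕ := fun x y => if x = k ∧ y = j then m k j else
    if x = j ∧ y = k then 0 else a x y with ha'
  have h1 := hF.ge_struct (h := h') (t := t') (a := a') (fun y => by
    simp only [hh', ht']
    split_ifs
    · exact hkj.symm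
    · exact hht y) (fun x y hxy => by
    simp only [ha']
    by_cases h1 : x = k ∧ y = j
    · obtain ⟨rfl, rfl⟩ := h1
      simp [hxy, hxy.symm]
    · by_cases h2 : x = j ∧ y = k
      · obtain ⟨rfl, rfl⟩ := h2
        simp [hxy, hxy.symm, hsym]
      · rw [if_neg h1, if_neg h2, if_neg (by tauto), if_neg (by tauto)]
        exact ha x y hxy)
  rw [prod_prod_split hkj] at h1
  refine le_trans (le_of_eq ?_) h1
  congr 1
  have e1 : cell h' t' k j = cell h t k j ∪ cell h t j k := by
    ext y
    simp only [mem_cell, mem_union, hh', ht']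
    split_ifs with hy
    · simp [hy]
    · simp [hy]
  have e2 : a' k j = m k j := by simp [ha']
  have e3 : a' j k = 0 := by simp [ha', hkj.symm]
  rw [e1, e2, e3, Nat.choose_zero_right, one_mul, card_union_of_disjoint]
  · congr 1
    refine prod_congr rfl fun p hp => ?_
    simp only [mem_erase, mem_univ, and_true, ne_eq, Prod.ext_iff] at hp
    have e4 : a' p.1 p.2 = a p.1 p.2 := by
      simp only [ha']
      rw [if_neg hp.2, if_neg hp.1]
    have e5 : cell h' t' p.1 p.2 = cell h t p.1 p.2 := by
      ext y
      simp only [mem_cell, hh', ht']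
      split_ifs with hy
      · rw [hy.1, hy.2]
        have h3 := hp.1
        have h4 := hp.2
        constructor
        · rintro ⟨e, e'⟩; exact absurd ⟨e.symm, e'.symm⟩ h4
        · rintro ⟨e, e'⟩; exact absurd ⟨e.symm, e'.symm⟩ h3
      · rfl
    rw [e4, e5]
  · rw [disjoint_left]
    intro y hy hy'
    rw [mem_cell] at hy hy'
    exact hkj (hy.1.symm.trans hy'.1)

lemma cell_card_le (k j : Fin ℓ) : ((cell h t k j).card : ℝ) ≤ (n : ℝ) + 1 := by
  have := card_le_univ (cell h t k j)
  rw [Fintype.card_fin] at this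
  have : ((cell h t k j).card : ℝ) ≤ n := by exact_mod_cast this
  linarith

lemma choose_cell_le (k j : Fin ℓ) (b : ℕ) :
    ((cell h t k j).card.choose b : ℝ) ≤ ((n : ℝ) + 1) ^ b := by
  have h1 : ((cell h t k j).card.choose b : ℝ) ≤ ((cell h t k j).card : ℝ) ^ b := by
    exact_mod_cast Nat.choose_le_pow _ _
  exact h1.trans (pow_le_pow_left₀ (Nat.cast_nonneg _) (cell_card_le k j) b)

lemma card_slices_le (k : Fin ℓ) (b : Fin ℓ → ℕ) :
    ((slices (cell h t k) b).card : ℝ) ≤ ((n : ℝ) + 1) ^ (∑ i, b i) := by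
  rw [card_slices _ _ (disjoint_cell k), Nat.cast_prod, ← prod_pow_eq_pow_sum]
  exact prod_le_prod (fun _ _ => Nat.cast_nonneg _) fun i _ => choose_cell_le k i _

lemma card_slices_le_cell (k j : Fin ℓ) (b : Fin ℓ → ℕ) (hj : 0 < b j) :
    ((slices (cell h t k) b).card : ℝ) * ((n : ℝ) + 1) ≤
      (cell h t k j).card * ((n : ℝ) + 1) ^ (∑ i, b i) := by
  have hN : (0 : ℝ) < (n : ℝ) + 1 := by positivity
  rw [card_slices _ _ (disjoint_cell k), Nat.cast_prod, ← mul_prod_erase univ _ (mem_univ j),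
    ← add_sum_erase univ b (mem_univ j), pow_add, ← prod_pow_eq_pow_sum]
  have h1 : ∏ i ∈ univ.erase j, ((cell h t k i).card.choose (b i) : ℝ) ≤
      ∏ i ∈ univ.erase j, ((n : ℝ) + 1) ^ b i :=
    prod_le_prod (fun _ _ => Nat.cast_nonneg _) fun i _ => choose_cell_le k i _
  have h2 : ((cell h t k j).card.choose (b j) : ℝ) * ((n : ℝ) + 1) ≤
      (cell h t k j).card * ((n : ℝ) + 1) ^ b j := by
    have h3 : ((cell h t k j).card.choose (b j) : ℝ) ≤ ((cell h t k j).card : ℝ) ^ b j := by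
      exact_mod_cast Nat.choose_le_pow _ _
    obtain ⟨c, hc⟩ : ∃ c, b j = c + 1 := ⟨b j - 1, by omega⟩
    rw [hc] at h3 ⊢
    rw [pow_succ] at h3 ⊢
    have h4 := pow_le_pow_left₀ (Nat.cast_nonneg (α := ℝ) _) (cell_card_le (h := h) (t := t) k j) c
    have h5 := mul_le_mul_of_nonneg_right h4 (Nat.cast_nonneg (α := ℝ) (cell h t k j).card)
    have h6 := mul_le_mul_of_nonneg_right (h3.trans h5) hN.le
    linarith
  have h3 := mul_le_mul h2 h1 (prod_nonneg fun _ _ => Nat.cast_nonneg _)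
    (mul_nonneg (Nat.cast_nonneg _) (by positivity))
  linarith

end

/-- Orientation of the pairs, with all relevant cells large. -/
structure Oriented {n ℓ : ℕ} (m : Fin ℓ → Fin ℓ → ℕ) (F : Fin ℓ → Finset (Finset (Fin n)))
    (h t : Fin n → Fin ℓ) (a : Fin ℓ → Fin ℓ → ℕ) (C : ℝ) : Prop extends Profile m F h t a C where
  orient : ∀ k j, a k j = 0 ∨ a j k = 0
  cells : ∀ k j, 0 < a k j → (n : ℝ) + 1 ≤ C * (cell h t k j).card
  slo : ∀ k, ((n : ℝ) + 1) ^ (∑ j, a k j) ≤ C * (slices (cell h t k) (a k)).card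
  tlo : ∀ k, ((F k).card : ℝ) ≤ C * (2 ^ (inn h k).card * (slices (cell h t k) (a k)).card)

lemma Oriented.mono {n ℓ : ℕ} {m : Fin ℓ → Fin ℓ → ℕ} {F : Fin ℓ → Finset (Finset (Fin n))}
    {h t : Fin n → Fin ℓ} {a : Fin ℓ → Fin ℓ → ℕ} {C C' : ℝ} (ho : Oriented m F h t a C)
    (hC : C ≤ C') : Oriented m F h t a C' :=
  ⟨ho.toProfile.mono hC, ho.orient,
    fun k j hj => (ho.cells k j hj).trans (mul_le_mul_of_nonneg_right hC (Nat.cast_nonneg _)),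
    fun k => (ho.slo k).trans (mul_le_mul_of_nonneg_right hC (Nat.cast_nonneg _)),
    fun k => (ho.tlo k).trans (mul_le_mul_of_nonneg_right hC
      (mul_nonneg (by positivity) (Nat.cast_nonneg _)))⟩

lemma exists_oriented {ℓ : ℕ} (m : Fin ℓ → Fin ℓ → ℕ)
    (hsym : ∀ k1 k2, m k1 k2 = m k2 k1) {C₀ : ℝ} (hC₀ : 0 < C₀) :
    ∃ C : ℝ, 0 < C ∧ ∀ᶠ n : ℕ in atTop, ∀ (F : Fin ℓ → Finset (Finset (Fin n))) (h t a),
      Profile m F h t a C₀ → Oriented m F h t a C := by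
  obtain ⟨K, hK⟩ : ∃ K : ℝ, K = 2 * C₀ := ⟨_, rfl⟩
  have hK0 : 0 < K := by rw [hK]; positivity
  obtain ⟨g, hg⟩ : ∃ g : ℝ, g = 1 / (2 * ((MM m : ℝ) + 1) * K) := ⟨_, rfl⟩
  have hg0 : 0 < g := by rw [hg]; positivity
  obtain ⟨η, hη⟩ : ∃ η : ℝ, η = min (1 / 2) (g / (2 * (1 + g) * ((ℓ : ℝ) + 1))) := ⟨_, rfl⟩
  have hη0 : 0 < η := by rw [hη]; exact lt_min (by norm_num) (by positivity)
  have hη1 : η ≤ 1 / 2 := by rw [hη]; exact min_le_left _ _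
  have hη2 : η * (2 * (1 + g) * ((ℓ : ℝ) + 1)) ≤ g := by
    rw [← le_div_iff₀ (by positivity), hη]; exact min_le_right _ _
  refine ⟨C₀ + K + 2, by positivity, ?_⟩
  filter_upwards [Profile.not_slices_small m (C := C₀) hη0, ev_le (K * (2 * MM m))] with n hn hn2 F h t a hp
  have hN : (0 : ℝ) < (n : ℝ) + 1 := by positivity
  have hsmall := hn F h t a hp
  obtain ⟨hw1, hw2⟩ := hp.weights hsym (by linarith) hsmall
  have tlo : ∀ k, ((F k).card : ℝ) ≤ 2 * (2 ^ (inn h k).card * (slices (cell h t k) (a k)).card) := by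
    intro k
    have h1 := hw1 k
    have h2 : (0 : ℝ) ≤ 1 / 2 ^ MM m *
      ((slices (cell h t k) (a k)).filter (fun T => inn h k ∪ T ∉ F k)).card :=
      mul_nonneg (by positivity) (Nat.cast_nonneg _)
    have h3 : (1 / 2 : ℝ) * (F k).card ≤ (1 - η) * (F k).card :=
      mul_le_mul_of_nonneg_right (by linarith) (Nat.cast_nonneg _)
    have h4 : (0 : ℝ) ≤ 2 ^ (inn h k).card := by positivity
    have h5 := mul_nonneg h4 h2
    rw [mul_sub] at h1
    linarith
  have slo : ∀ k, ((n : ℝ) + 1) ^ (∑ j, a k j) ≤ K * (slices (cell h t k) (a k)).card := by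
    intro k
    have h1 := (hp.lo k).trans (mul_le_mul_of_nonneg_left (tlo k) hC₀.le)
    refine le_of_mul_le_mul_left (h1.trans (le_of_eq ?_)) (by positivity : (0 : ℝ) < 2 ^ (inn h k).card)
    rw [hK]; ring
  have cells : ∀ k j, 0 < a k j → (n : ℝ) + 1 ≤ K * (cell h t k j).card := by
    intro k j hj
    have h1 := card_slices_le_cell (h := h) (t := t) k j (a k) hj
    have h2 := mul_le_mul_of_nonneg_right (slo k) hN.le
    have h3 := mul_le_mul_of_nonneg_left h1 hK0.le
    refine le_of_mul_le_mul_right ?_ (by positivity : (0 : ℝ) < ((n : ℝ) + 1) ^ (∑ j, a k j))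
    linarith
  refine ⟨hp.mono (by linarith), fun k j => ?_,
    fun k j hj => (cells k j hj).trans (mul_le_mul_of_nonneg_right (by linarith) (Nat.cast_nonneg _)),
    fun k => (slo k).trans (mul_le_mul_of_nonneg_right (by linarith) (Nat.cast_nonneg _)),
    fun k => (tlo k).trans (mul_le_mul_of_nonneg_right (by linarith)
      (mul_nonneg (by positivity) (Nat.cast_nonneg _)))⟩
  by_contra hcon
  push Not at hcon
  have hkj : k ≠ j := by
    rintro rfl
    exact hcon.1 (hp.diag k)
  have hjk0 : 0 < a j k := Nat.pos_of_ne_zero hcon.2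
  have hm := hp.sum k j hkj
  have hmM := le_MM m k j
  obtain ⟨b, hb⟩ : ∃ b, a k j = b + 1 := ⟨a k j - 1, by omega⟩
  have hge := hp.ext.ge_merged hsym hp.ne hkj (a := a) fun k j hkj => (hp.sum k j hkj).le
  have hK2 : (2 * MM m : ℝ) ≤ (cell h t j k).card := by
    refine le_of_mul_le_mul_left ?_ hK0
    exact hn2.trans (cells j k hjk0)
  have hgain := choose_add_gain (a := b) (b := a j k) (cell_card_le (h := h) (t := t) k j) hN
    (cells j k hjk0) (by
      have : 2 * MM m ≤ (cell h t j k).card := by exact_mod_cast hK2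
      omega)
  rw [← hb, hm] at hgain
  have hg1 : g ≤ 1 / (2 * ((a j k : ℝ) + 1) * K) := by
    rw [hg]
    have : (a j k : ℝ) ≤ MM m := by exact_mod_cast (by omega : a j k ≤ MM m)
    gcongr
  obtain ⟨R, hR⟩ : ∃ R : ℕ, R = ∏ p ∈ (univ.erase (k, j)).erase (j, k),
    (cell h t p.1 p.2).card.choose (a p.1 p.2) := ⟨_, rfl⟩
  have hsplit : ∏ k, ((slices (cell h t k) (a k)).card : ℝ) =
      (cell h t k j).card.choose (a k j) * (((cell h t j k).card.choose (a j k) : ℕ) * (R : ℝ)) := by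
    have := prod_card_slices h t a
    rw [prod_prod_split hkj (fun x y => (cell h t x y).card.choose (a x y)), ← hR] at this
    exact_mod_cast this.symm
  rw [← hR] at hge
  have hge' : (2 : ℝ) ^ n * ((((cell h t k j).card + (cell h t j k).card).choose (m k j) : ℕ) * (R : ℝ)) ≤
      ∏ k, ((F k).card : ℝ) := by exact_mod_cast hge
  rw [hsplit] at hw2
  obtain ⟨P, hP⟩ : ∃ P : ℝ, P = ∏ k, ((F k).card : ℝ) := ⟨_, rfl⟩
  have hP0 : 0 < P := by rw [hP]; exact prod_pos fun k _ => by exact_mod_cast hp.ext.card_pos k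
  rw [← hP] at hge' hw2
  obtain ⟨Q, hQ⟩ : ∃ Q : ℝ, Q = ((cell h t k j).card.choose (a k j) : ℝ) * (cell h t j k).card.choose (a j k) :=
    ⟨_, rfl⟩
  have hQ0 : 0 ≤ Q := by rw [hQ]; exact mul_nonneg (Nat.cast_nonneg _) (Nat.cast_nonneg _)
  have h1 : (1 + g) * Q ≤ ((cell h t k j).card + (cell h t j k).card).choose (m k j) := by
    refine le_trans ?_ hgain
    rw [hQ]
    rw [hQ] at hQ0
    exact mul_le_mul_of_nonneg_right (by linarith) hQ0
  have h2 : (1 + g) * (2 ^ n * (Q * R)) ≤ P := by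
    refine le_trans ?_ hge'
    have := mul_le_mul_of_nonneg_left (mul_le_mul_of_nonneg_right h1 (Nat.cast_nonneg (α := ℝ) R))
      (by positivity : (0 : ℝ) ≤ 2 ^ n)
    linarith
  have h3 : (1 - η) ^ ℓ * P ≤ 2 ^ n * (Q * R) := by
    rw [hQ]
    refine hw2.trans (le_of_eq ?_)
    ring
  have h4 : (1 + g) * (1 - η) ^ ℓ ≤ 1 := by
    refine le_of_mul_le_mul_right ?_ hP0
    have := mul_le_mul_of_nonneg_left h3 (by linarith : (0 : ℝ) ≤ 1 + g)
    linarith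
  have h8 : 1 + (ℓ : ℝ) * (-η) ≤ (1 + -η) ^ ℓ := one_add_mul_le_pow (by linarith) ℓ
  have e : (1 + -η) = 1 - η := by ring
  rw [e] at h8
  have h9 := mul_le_mul_of_nonneg_left h8 (by linarith : (0 : ℝ) ≤ 1 + g)
  have h10 : 0 < η * (1 + g) := by positivity
  nlinarith

/-- Lower the `j`-th entry by one. -/
def dec {ℓ : ℕ} (b : Fin ℓ → ℕ) (j : Fin ℓ) : Fin ℓ → ℕ := Function.update b j (b j - 1)

section
variable {n ℓ : ℕ} {h t : Fin n → Fin ℓ}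

lemma sum_dec {b : Fin ℓ → ℕ} {j : Fin ℓ} (hj : 0 < b j) : (∑ i, dec b j i) + 1 = ∑ i, b i := by
  unfold dec
  rw [sum_update_of_mem (mem_univ j), ← add_sum_erase univ b (mem_univ j), Finset.sdiff_singleton_eq_erase]
  omega

lemma card_slices_dec_le (k j : Fin ℓ) {b : Fin ℓ → ℕ} (hj : 0 < b j) :
    ((slices (cell h t k) (dec b j)).card : ℝ) * ((n : ℝ) + 1) ≤ ((n : ℝ) + 1) ^ (∑ i, b i) := by
  rw [← sum_dec hj, pow_succ]
  exact mul_le_mul_of_nonneg_right (card_slices_le k _) (by positivity)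

lemma erase_mem_slices {k j : Fin ℓ} {b : Fin ℓ → ℕ} {T : Finset (Fin n)} {z : Fin n}
    (hT : T ∈ slices (cell h t k) b) (hz : z ∈ T) (hzj : z ∈ cell h t k j) :
    T.erase z ∈ slices (cell h t k) (dec b j) := by
  rw [mem_slices] at hT ⊢
  refine ⟨(erase_subset _ _).trans hT.1, fun i => ?_⟩
  rw [erase_inter]
  unfold dec
  by_cases hij : i = j
  · subst hij
    rw [card_erase_of_mem (mem_inter.2 ⟨hz, hzj⟩), hT.2, Function.update_self]
  · rw [Function.update_of_ne hij, erase_eq_of_notMem, hT.2]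
    intro hzi
    exact disjoint_left.1 (disjoint_cell k i j hij) (mem_inter.1 hzi).2 hzj

lemma card_slices_mem_le (k : Fin ℓ) (b : Fin ℓ → ℕ) (y : Fin n) :
    (((slices (cell h t k) b).filter (y ∈ ·)).card : ℝ) * ((n : ℝ) + 1) ≤
      ((n : ℝ) + 1) ^ (∑ i, b i) := by
  rcases ((slices (cell h t k) b).filter (y ∈ ·)).eq_empty_or_nonempty with he | ⟨T₀, hT₀⟩
  · rw [he]
    simp only [card_empty, Nat.cast_zero, zero_mul]
    positivity
  rw [mem_filter] at hT₀
  obtain ⟨j, _, hj⟩ := mem_biUnion.1 ((mem_slices.1 hT₀.1).1 hT₀.2)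
  have hbj : 0 < b j := by
    rw [← (mem_slices.1 hT₀.1).2 j]
    exact card_pos.2 ⟨y, mem_inter.2 ⟨hT₀.2, hj⟩⟩
  refine le_trans (mul_le_mul_of_nonneg_right (Nat.cast_le.2 ?_) (by positivity))
    (card_slices_dec_le (h := h) (t := t) k j hbj)
  refine card_le_card_of_injOn (fun T => T.erase y) (fun T hT => ?_) ?_
  · rw [mem_coe, mem_filter] at hT
    exact erase_mem_slices hT.1 hT.2 hj
  · intro A hA B hB hAB
    rw [← insert_erase (mem_filter.1 hA).2, ← insert_erase (mem_filter.1 hB).2]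
    exact congrArg (insert y) hAB

end

section
variable {n ℓ : ℕ} {m : Fin ℓ → Fin ℓ → ℕ} {F : Fin ℓ → Finset (Finset (Fin n))}
  {h t : Fin n → Fin ℓ} {C : ℝ} {a : Fin ℓ → Fin ℓ → ℕ}

/-- Points `z` of the cell `(k, j)` that complete `T` to a full slice avoiding `y`. -/
def comp (F : Fin ℓ → Finset (Finset (Fin n))) (h t : Fin n → Fin ℓ) (a : Fin ℓ → Fin ℓ → ℕ)
    (k j : Fin ℓ) (y : Fin n) (T : Finset (Fin n)) : Finset (Fin n) :=
  (cell h t k j).filter (fun z => z ∉ T ∧ y ∉ insert z T ∧ insert z T ∈ full F h t a k)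

lemma Oriented.card_rich (ho : Oriented m F h t a C) (hC : 0 < C)
    (hN : 4 * C ≤ (n : ℝ) + 1) {k j : Fin ℓ} (hj : 0 < a k j) (y : Fin n)
    (hfull : (((slices (cell h t k) (a k)).filter (fun T => inn h k ∪ T ∉ F k)).card : ℝ) ≤
      1 / 4 * (slices (cell h t k) (a k)).card) :
    ((n : ℝ) + 1) ^ (∑ i, a k i) ≤ 4 * C * (((n : ℝ) + 1) *
      ((slices (cell h t k) (dec (a k) j)).filter
        (fun T => 1 / (4 * C) * ((n : ℝ) + 1) ≤ (comp F h t a k j y T).card)).card) := by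
  have hN0 : (0 : ℝ) < (n : ℝ) + 1 := by positivity
  obtain ⟨X, hX⟩ : ∃ X : ℝ, X = ((n : ℝ) + 1) ^ (∑ i, a k i) := ⟨_, rfl⟩
  have hX0 : 0 < X := by rw [hX]; positivity
  obtain ⟨G, hG⟩ : ∃ G, G = (full F h t a k).filter (y ∉ ·) := ⟨_, rfl⟩
  have h1 : (slices (cell h t k) (a k)).card ≤ G.card +
      ((slices (cell h t k) (a k)).filter (fun T => inn h k ∪ T ∉ F k)).card +
      ((slices (cell h t k) (a k)).filter (y ∈ ·)).card := by
    refine (card_le_card (t := G ∪ (slices (cell h t k) (a k)).filter (fun T => inn h k ∪ T ∉ F k) ∪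
      (slices (cell h t k) (a k)).filter (y ∈ ·)) fun T hT => ?_).trans
      ((card_union_le _ _).trans (Nat.add_le_add_right (card_union_le _ _) _))
    simp only [hG, full, mem_union, mem_filter]
    tauto
  have h2 := card_slices_mem_le (h := h) (t := t) k (a k) y
  have h3 := ho.slo k
  rw [← hX] at h2 h3 ⊢
  have h1' : ((slices (cell h t k) (a k)).card : ℝ) ≤ G.card +
      ((slices (cell h t k) (a k)).filter (fun T => inn h k ∪ T ∉ F k)).card +
      ((slices (cell h t k) (a k)).filter (y ∈ ·)).card := by exact_mod_cast h1
  have h4 : 4 * C * (((slices (cell h t k) (a k)).filter (y ∈ ·)).card : ℝ) ≤ X := by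
    refine le_trans ?_ h2
    rw [mul_comm]
    exact mul_le_mul_of_nonneg_left hN (Nat.cast_nonneg _)
  have h5 : X ≤ 2 * C * G.card := by
    have h5 := mul_le_mul_of_nonneg_left h1' hC.le
    have h6 := mul_le_mul_of_nonneg_left hfull hC.le
    linarith
  obtain ⟨R, hR⟩ : ∃ R, R = (slices (cell h t k) (dec (a k) j)).filter
    (fun T => 1 / (4 * C) * ((n : ℝ) + 1) ≤ (comp F h t a k j y T).card) := ⟨_, rfl⟩
  rw [← hR]
  have h7 : G ⊆ (slices (cell h t k) (dec (a k) j)).biUnion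
      (fun T => (comp F h t a k j y T).image (fun z => insert z T)) := by
    intro T hT
    rw [hG, mem_filter, full, mem_filter] at hT
    have h8 := (mem_slices.1 hT.1.1).2 j
    obtain ⟨z, hz⟩ := card_pos.1 (h8 ▸ hj)
    rw [mem_inter] at hz
    refine mem_biUnion.2 ⟨T.erase z, erase_mem_slices hT.1.1 hz.1 hz.2, mem_image.2
      ⟨z, ?_, insert_erase hz.1⟩⟩
    rw [comp, mem_filter, insert_erase hz.1, full, mem_filter]
    exact ⟨hz.2, notMem_erase _ _, hT.2, hT.1⟩
  have h8 : (G.card : ℝ) ≤ ∑ T ∈ slices (cell h t k) (dec (a k) j), ((comp F h t a k j y T).card : ℝ) := by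
    have := (card_le_card h7).trans card_biUnion_le
    have := this.trans (sum_le_sum fun T _ => card_image_le)
    exact_mod_cast this
  have h9 : ∀ T ∈ slices (cell h t k) (dec (a k) j), ((comp F h t a k j y T).card : ℝ) ≤
      1 / (4 * C) * ((n : ℝ) + 1) +
      if 1 / (4 * C) * ((n : ℝ) + 1) ≤ (comp F h t a k j y T).card then (n : ℝ) + 1 else 0 := by
    intro T _
    split_ifs with hif
    · have : ((comp F h t a k j y T).card : ℝ) ≤ (cell h t k j).card := by
        exact_mod_cast card_filter_le _ _
      have := cell_card_le (h := h) (t := t) k j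
      have : 0 < 1 / (4 * C) * ((n : ℝ) + 1) := by positivity
      linarith
    · linarith
  have h10 := h8.trans (sum_le_sum h9)
  rw [sum_add_distrib, ← sum_filter, ← hR, sum_const, sum_const, nsmul_eq_mul, nsmul_eq_mul] at h10
  have h11 := card_slices_dec_le (h := h) (t := t) k j hj
  rw [← hX] at h11
  have h12 : ((slices (cell h t k) (dec (a k) j)).card : ℝ) * (1 / (4 * C) * ((n : ℝ) + 1)) ≤
      1 / (4 * C) * X := by
    have := mul_le_mul_of_nonneg_left h11 (by positivity : 0 ≤ 1 / (4 * C))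
    linarith
  have h13 := mul_le_mul_of_nonneg_left (h10.trans (add_le_add_left h12 _)) (by positivity : 0 ≤ 4 * C)
  have h14 : 4 * C * (1 / (4 * C) * X) = X := by field_simp
  linarith

lemma comp_subset {k j : Fin ℓ} {y : Fin n} {T : Finset (Fin n)} :
    comp F h t a k j y T ⊆ inn h j := fun z hz => by
  rw [comp, mem_filter, mem_cell] at hz
  exact mem_inn.2 hz.1.2

/-- Removing the members of `F k` that are sparse on some `Z i` costs little. -/
lemma Closed.sparse_union_le (hc : Closed m F h t C) (hsym : ∀ k1 k2, m k1 k2 = m k2 k1) {k : Fin ℓ}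
    {ι : Type*} (s : Finset ι) (Z : ι → Finset (Fin n)) (hZ : ∀ i ∈ s, Z i ⊆ inn h k) {ε : ℝ}
    (hε : ∀ i ∈ s, ((n : ℝ) + 1) ^ MM m * (4 / 5) ^ (Z i).card ≤ ε) :
    pr (F k) (fun A => ∃ i ∈ s, 8 * (A ∩ Z i).card ≤ (Z i).card) ≤ s.card * ε := by
  refine (pr_exists_le s (fun i A => 8 * (A ∩ Z i).card ≤ (Z i).card) fun A _ hA => hA).trans ?_
  refine (sum_le_sum fun i hi => (hc.chernoff hsym (hZ i hi)).trans (hε i hi)).trans (le_of_eq ?_)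
  rw [sum_const, nsmul_eq_mul]

lemma pp_ge_of_prod_le {p : Fin ℓ → ℝ} (h0 : ∀ i, 0 ≤ p i) (i₀ i₁ : Fin ℓ)
    (h1 : ∀ i, p i ≤ 1 / 2) (h2 : ∀ i, i ≠ i₀ → p i ≤ p i₁) {x : ℝ} (hx0 : 0 ≤ x) (hx1 : x ≤ 1)
    (hp : (∏ i, (1 - p i)) * (2 + x) ≤ 1) : x ≤ 3 * ℓ * p i₁ := by
  have h3 := one_sub_sum_le_prod (univ.erase i₀) p (fun i _ => h0 i) (fun i _ => by linarith [h1 i])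
  rw [← mul_prod_erase univ _ (mem_univ i₀)] at hp
  have h4 : ∑ i ∈ univ.erase i₀, p i ≤ ℓ * p i₁ := by
    refine (sum_le_card_nsmul _ _ (p i₁) fun i hi => h2 i (mem_erase.1 hi).1).trans ?_
    rw [nsmul_eq_mul]
    refine mul_le_mul_of_nonneg_right ?_ (h0 _)
    have := card_le_univ (univ.erase i₀)
    rw [Fintype.card_fin] at this
    exact_mod_cast this
  have h5 : (0 : ℝ) ≤ ∏ i ∈ univ.erase i₀, (1 - p i) := prod_nonneg fun i _ => by linarith [h1 i]
  have h6 : 1 / 2 * (∏ i ∈ univ.erase i₀, (1 - p i)) ≤ (1 - p i₀) * ∏ i ∈ univ.erase i₀, (1 - p i) :=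
    mul_le_mul_of_nonneg_right (by linarith [h1 i₀]) h5
  have h7 : 1 / 2 * (1 - ℓ * p i₁) * (2 + x) ≤ 1 := by
    refine le_trans (mul_le_mul_of_nonneg_right ?_ (by linarith)) hp
    linarith
  have h8 : 0 ≤ ℓ * p i₁ := mul_nonneg (Nat.cast_nonneg _) (h0 _)
  nlinarith

end

section
variable {n ℓ : ℕ} {m : Fin ℓ → Fin ℓ → ℕ} {F : Fin ℓ → Finset (Finset (Fin n))}
  {h t : Fin n → Fin ℓ} {C : ℝ} {a : Fin ℓ → Fin ℓ → ℕ}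

lemma Profile.sum_a_le (hp : Profile m F h t a C) (k : Fin ℓ) : ∑ i, a k i ≤ MM m := by
  refine (sum_le_sum fun i _ => ?_).trans (sum_le_MM m k)
  by_cases hi : k = i
  · subst hi; rw [hp.diag]; exact Nat.zero_le _
  · have := hp.sum k i hi
    omega

lemma Profile.exists_arc (hp : Profile m F h t a C) (hnz : ∃ k1 k2 : Fin ℓ, k1 ≠ k2 ∧ 0 < m k1 k2) :
    ∃ k j, k ≠ j ∧ 0 < a k j := by
  obtain ⟨k, j, hkj, hm⟩ := hnz
  have := hp.sum k j hkj
  rcases Nat.eq_zero_or_pos (a k j) with h0 | h0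
  · exact ⟨j, k, hkj.symm, by omega⟩
  · exact ⟨k, j, hkj, h0⟩

lemma Oriented.insertion_point (ho : Oriented m F h t a C) (hsym : ∀ k1 k2, m k1 k2 = m k2 k1)
    (hC : 1 ≤ C) (hN : 4 * C ≤ (n : ℝ) + 1) {k j : Fin ℓ} (hkj : k ≠ j) (hj : 0 < a k j) (y : Fin n)
    (hfull : (((slices (cell h t k) (a k)).filter (fun T => inn h k ∪ T ∉ F k)).card : ℝ) ≤
      1 / 4 * (slices (cell h t k) (a k)).card)
    (hexp : ∀ z : ℕ, 1 / (4 * C) * ((n : ℝ) + 1) ≤ z →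
      ((n : ℝ) + 1) ^ (2 * MM m + 1) * (4 / 5) ^ z ≤ 1 / (32 * C ^ 2)) :
    (∏ i, (1 - pp (F i) y)) * (2 + 1 / (8 * C ^ 2 * ((n : ℝ) + 1))) ≤ 1 := by
  have hC0 : 0 < C := by linarith
  have hN0 : (0 : ℝ) < (n : ℝ) + 1 := by positivity
  obtain ⟨R, hR⟩ : ∃ R, R = (slices (cell h t k) (dec (a k) j)).filter
    (fun T => 1 / (4 * C) * ((n : ℝ) + 1) ≤ (comp F h t a k j y T).card) := ⟨_, rfl⟩
  have hrich := ho.card_rich hC0 hN hj y hfull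
  rw [← hR] at hrich
  obtain ⟨x, hx⟩ : ∃ x : ℝ, x = 1 / (8 * C ^ 2 * ((n : ℝ) + 1)) := ⟨_, rfl⟩
  rw [← hx]
  have hx0 : 0 < x := by rw [hx]; positivity
  have hx1 : x ≤ 1 := by
    rw [hx, div_le_one (by positivity)]
    have : 1 ≤ C ^ 2 := one_le_pow₀ hC
    nlinarith
  have hxN : x * (8 * C ^ 2 * ((n : ℝ) + 1)) = 1 := by rw [hx]; field_simp
  have hRcard : (R.card : ℝ) ≤ ((n : ℝ) + 1) ^ MM m := by
    have h1 : (R.card : ℝ) ≤ (slices (cell h t k) (dec (a k) j)).card := by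
      rw [hR]; exact_mod_cast card_filter_le _ _
    refine h1.trans ((card_slices_le k _).trans (pow_le_pow_right₀ (by linarith [Nat.cast_nonneg (α := ℝ) n]) ?_))
    have := sum_dec hj
    have := ho.sum_a_le k
    omega
  have hR0 : ∀ T ∈ R, T ∈ slices (cell h t k) (dec (a k) j) ∧
      1 / (4 * C) * ((n : ℝ) + 1) ≤ (comp F h t a k j y T).card := fun T hT => by
    rwa [hR, mem_filter] at hT
  have hcomp : ∀ T ∈ R, ∃ z, z ∈ comp F h t a k j y T := fun T hT => by
    have h1 := (hR0 T hT).2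
    have : (0 : ℝ) < (comp F h t a k j y T).card := lt_of_lt_of_le (by positivity) h1
    exact card_pos.1 (by exact_mod_cast this)
  obtain ⟨𝒞, h𝒞⟩ : ∃ 𝒞, 𝒞 = (((inn h k).erase y).powerset ×ˢ R).image (fun p => p.1 ∪ p.2) := ⟨_, rfl⟩
  have hin : ∀ E ⊆ inn h k, ∀ T z, z ∈ comp F h t a k j y T → insert z (E ∪ T) ∈ F k := by
    intro E hE T z hz
    rw [comp, mem_filter, full, mem_filter] at hz
    refine ho.ext.down hsym hz.2.2.2.2 ?_
    rw [← union_insert]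
    exact union_subset_union hE le_rfl
  have h𝒞card : x * ((F k).card : ℝ) ≤ 𝒞.card := by
    have e1 : 𝒞.card = 2 ^ ((inn h k).erase y).card * R.card := by
      rw [h𝒞, card_union_image _ _ (inn h k), card_powerset]
      · exact fun A hA => (mem_powerset.1 hA).trans (erase_subset _ _)
      · exact fun B hB => slices_disjoint_inn ho.ne (hR0 B hB).1
    have e2 : (2 : ℝ) ^ (inn h k).card ≤ 2 * 2 ^ ((inn h k).erase y).card := by
      rw [← pow_succ']
      refine pow_le_pow_right₀ (by norm_num) ?_
      have := pred_card_le_card_erase (s := inn h k) (a := y)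
      omega
    have e3 := ho.up k
    have e4 : ((F k).card : ℝ) ≤ C * ((2 * 2 ^ ((inn h k).erase y).card) *
        (4 * C * (((n : ℝ) + 1) * R.card))) := by
      refine e3.trans ?_
      gcongr
    rw [e1]
    push_cast
    have e5 := mul_le_mul_of_nonneg_left e4 hx0.le
    refine e5.trans (le_of_eq ?_)
    calc _ = x * (8 * C ^ 2 * ((n : ℝ) + 1)) * (2 ^ ((inn h k).erase y).card * R.card) := by ring
      _ = _ := by rw [hxN, one_mul]
  obtain ⟨ε, hε⟩ : ∃ ε : ℝ, ε = x / 4 := ⟨_, rfl⟩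
  have hsparse : pr (F j) (fun A => ∃ T ∈ R, 8 * (A ∩ comp F h t a k j y T).card ≤
      (comp F h t a k j y T).card) ≤ ε := by
    refine (ho.sparse_union_le hsym R (comp F h t a k j y) (fun T _ => comp_subset)
      (ε := ε / ((n : ℝ) + 1) ^ MM m) fun T hT => ?_).trans ?_
    · rw [le_div_iff₀ (by positivity)]
      have h1 := hexp _ (hR0 T hT).2
      have h2 : ε = 1 / (32 * C ^ 2) / ((n : ℝ) + 1) := by rw [hε, hx]; field_simp; norm_num
      rw [h2, le_div_iff₀ hN0]
      refine le_trans (le_of_eq ?_) h1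
      rw [pow_succ, two_mul, pow_add]
      ring
    · have : 0 ≤ ε / ((n : ℝ) + 1) ^ MM m := by rw [hε]; positivity
      refine (mul_le_mul_of_nonneg_right hRcard this).trans (le_of_eq ?_)
      field_simp
  obtain ⟨ℬ, hℬ⟩ : ∃ ℬ, ℬ = ((F j).filter (y ∉ ·)).filter
    (fun B => ¬ ∃ T ∈ R, 8 * (B ∩ comp F h t a k j y T).card ≤ (comp F h t a k j y T).card) := ⟨_, rfl⟩
  have hFy : ((F j).card : ℝ) ≤ 2 * ((F j).filter (y ∉ ·)).card := by
    rw [card_avoid (ho.ext.card_pos j)]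
    have h1 := ho.ext.pp_le_half hsym j y
    nlinarith [Nat.cast_nonneg (α := ℝ) (F j).card]
  have hℬcard : (1 - 2 * ε) * ((F j).filter (y ∉ ·)).card ≤ ℬ.card := by
    have h1 := card_filter_add_card_filter_not (s := (F j).filter (y ∉ ·))
      (fun B => ∃ T ∈ R, 8 * (B ∩ comp F h t a k j y T).card ≤ (comp F h t a k j y T).card)
    rw [← hℬ] at h1
    have h2 : ((((F j).filter (y ∉ ·)).filter (fun B => ∃ T ∈ R, 8 * (B ∩ comp F h t a k j y T).card ≤
        (comp F h t a k j y T).card)).card : ℝ) ≤ ε * (F j).card := by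
      refine le_trans ?_ (mul_le_mul_of_nonneg_right hsparse (Nat.cast_nonneg _))
      rw [pr_mul_card]
      exact_mod_cast card_le_card (filter_subset_filter _ (filter_subset _ _))
    have h1' : ((((F j).filter (y ∉ ·)).filter (fun B => ∃ T ∈ R, 8 * (B ∩ comp F h t a k j y T).card ≤
        (comp F h t a k j y T).card)).card : ℝ) + ℬ.card = ((F j).filter (y ∉ ·)).card := by
      exact_mod_cast h1
    have hε0 : 0 ≤ ε := by rw [hε]; positivity
    have := mul_le_mul_of_nonneg_left hFy hε0
    linarith
  have h1 := ho.ext.insertion hsym y hkj (𝒞 := 𝒞) (ℬ := ℬ) (c := x) (b := 1 - 2 * ε) ?_ ?_ ?_ hx0.le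
    (by rw [hε]; linarith) ?_ hℬcard
  · refine le_trans (mul_le_mul_of_nonneg_left ?_ ?_) h1
    · rw [hε]; nlinarith
    · exact prod_nonneg fun i _ => by linarith [ho.ext.pp_le_half hsym i y]
  · intro A hA
    rw [h𝒞, mem_image] at hA
    obtain ⟨⟨E, T⟩, hp, rfl⟩ := hA
    rw [mem_product, mem_powerset] at hp
    obtain ⟨z, hz⟩ := hcomp T hp.2
    refine ⟨ho.ext.down hsym (hin E (hp.1.trans (erase_subset _ _)) T z hz) (subset_insert _ _), ?_⟩
    rw [comp, mem_filter] at hz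
    simp only [mem_union, not_or]
    exact ⟨fun hy => (mem_erase.1 (hp.1 hy)).1 rfl, fun hy => hz.2.2.1 (mem_insert_of_mem hy)⟩
  · intro B hB
    rw [hℬ, mem_filter, mem_filter] at hB
    exact hB.1
  · intro A hA B hB
    rw [h𝒞, mem_image] at hA
    obtain ⟨⟨E, T⟩, hp, rfl⟩ := hA
    rw [mem_product, mem_powerset] at hp
    simp only at hp ⊢
    rw [hℬ, mem_filter, mem_filter] at hB
    have h2 : ∃ z ∈ B, z ∈ comp F h t a k j y T := by
      by_contra hcon
      push Not at hcon
      refine hB.2 ⟨T, hp.2, ?_⟩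
      rw [(disjoint_iff_inter_eq_empty.1 (disjoint_left.2 hcon))]
      simp
    obtain ⟨z, hzB, hz⟩ := h2
    have h3 := ho.ext.1 k j hkj _ (hin E (hp.1.trans (erase_subset _ _)) T z hz) B hB.1.1
    rw [insert_inter_of_mem hzB, card_insert_of_notMem] at h3
    · exact h3
    · rw [mem_inter, mem_union]
      rw [comp, mem_filter, mem_cell] at hz
      rintro ⟨hzE | hzT, -⟩
      · have := mem_inn.1 (mem_of_mem_erase (hp.1 hzE))
        exact hkj (this.symm.trans hz.1.2)
      · exact hz.2.1 hzT
  · refine le_trans (mul_le_mul_of_nonneg_left ?_ hx0.le) h𝒞card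
    exact_mod_cast card_filter_le _ _

end

lemma exists_pp_ge {ℓ : ℕ} (m : Fin ℓ → Fin ℓ → ℕ) (hsym : ∀ k1 k2, m k1 k2 = m k2 k1)
    (hnz : ∃ k1 k2 : Fin ℓ, k1 ≠ k2 ∧ 0 < m k1 k2) {C₀ : ℝ} (hC₀ : 0 < C₀) :
    ∃ C : ℝ, 0 < C ∧ ∀ᶠ n : ℕ in atTop, ∀ (F : Fin ℓ → Finset (Finset (Fin n))) (h t a),
      Oriented m F h t a C₀ → ∀ y, 1 ≤ C * (pp (F (t y)) y * ((n : ℝ) + 1)) := by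
  obtain ⟨K, hK⟩ : ∃ K : ℝ, K = C₀ + 1 := ⟨_, rfl⟩
  have hK1 : 1 ≤ K := by linarith
  have hK0 : 0 < K := by linarith
  have hℓ : 0 < (ℓ : ℝ) := by
    obtain ⟨k, -⟩ := hnz
    exact_mod_cast k.pos
  obtain ⟨η, hη⟩ : ∃ η : ℝ, η = 1 / (4 * (2 ^ MM m * (ℓ + 1))) := ⟨_, rfl⟩
  have hη0 : 0 < η := by rw [hη]; positivity
  have hη1 : η ≤ 1 := by
    rw [hη, div_le_one (by positivity)]
    have h1 : (1 : ℝ) ≤ 2 ^ MM m := one_le_pow₀ (by norm_num)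
    nlinarith
  have hη2 : 2 ^ MM m * (ℓ * η) ≤ 1 / 4 := by
    have : 2 ^ MM m * ((ℓ + 1) * η) = 1 / 4 := by rw [hη]; field_simp
    rw [← this]
    have : (2 : ℝ) ^ MM m * (ℓ * η) ≤ 2 ^ MM m * ((ℓ + 1) * η) := by gcongr; linarith
    exact this
  refine ⟨24 * ℓ * K ^ 2, by positivity, ?_⟩
  filter_upwards [ev_le (4 * K), Profile.not_slices_small m (C := K) hη0,
    exp_small (2 * MM m + 1) (c := 1 / (4 * K)) (ε := 1 / (32 * K ^ 2)) (by positivity) (by positivity)]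
    with n hn1 hn2 hn3 F h t a ho y
  have ho := ho.mono (C' := K) (by linarith)
  have hN0 : (0 : ℝ) < (n : ℝ) + 1 := by positivity
  obtain ⟨k, j, hkj, hj⟩ := ho.exists_arc hnz
  have hfull := (ho.nonfull_le hsym hη1 (hn2 F h t a ho.toProfile) k).trans
    (mul_le_mul_of_nonneg_right hη2 (Nat.cast_nonneg _))
  have h1 := ho.insertion_point hsym hK1 hn1 hkj hj y hfull hn3
  have hx1 : 1 / (8 * K ^ 2 * ((n : ℝ) + 1)) ≤ 1 := by
    rw [div_le_one (by positivity)]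
    have : 1 ≤ K ^ 2 := one_le_pow₀ hK1
    have : (1 : ℝ) ≤ (n : ℝ) + 1 := by linarith [Nat.cast_nonneg (α := ℝ) n]
    nlinarith
  have h2 := pp_ge_of_prod_le (fun i => pp_nonneg (F i) y) (h y) (t y)
    (fun i => ho.ext.pp_le_half hsym i y) (fun i hi => ho.snd y i hi) (by positivity) hx1 h1
  rw [div_le_iff₀ (by positivity)] at h2
  linarith

section
variable {n ℓ : ℕ} {m : Fin ℓ → Fin ℓ → ℕ} {F : Fin ℓ → Finset (Finset (Fin n))}
  {h t : Fin n → Fin ℓ} {C : ℝ} {a : Fin ℓ → Fin ℓ → ℕ}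

lemma pow_le_choose {N K : ℝ} {s b M : ℕ} (hN : 0 ≤ N) (hK : 1 ≤ K) (hs : N ≤ K * s) (hb : b ≤ M)
    (hsM : 2 * M ≤ s) : N ^ b ≤ (2 * K) ^ M * (M.factorial : ℝ) * s.choose b := by
  have h1 := choose_ge (b := b) (s := s) (by omega)
  have h2 : N ^ b ≤ (2 * K) ^ b * ((s : ℝ) / 2) ^ b := by
    rw [← mul_pow]
    exact pow_le_pow_left₀ hN (by linarith) _
  have hb0 : (0 : ℝ) < b.factorial := by exact_mod_cast b.factorial_pos
  rw [div_le_iff₀ hb0] at h1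
  have h3 : (2 * K) ^ b ≤ (2 * K) ^ M := pow_le_pow_right₀ (by linarith) hb
  have h4 : (b.factorial : ℝ) ≤ M.factorial := by exact_mod_cast Nat.factorial_le hb
  calc N ^ b ≤ (2 * K) ^ b * ((s : ℝ) / 2) ^ b := h2
    _ ≤ (2 * K) ^ M * ((s.choose b : ℝ) * b.factorial) := by gcongr
    _ ≤ (2 * K) ^ M * ((s.choose b : ℝ) * M.factorial) := by gcongr
    _ = _ := by ring

lemma Oriented.card_slices_ge (ho : Oriented m F h t a C) (hC : 1 ≤ C)
    (hN : 32 * C * MM m ≤ (n : ℝ) + 1) (k : Fin ℓ) {U : Finset (Fin n)}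
    (hU : U ⊆ univ.biUnion (cell h t k)) (hUa : ∀ i, (U ∩ cell h t k i).card ≤ a k i)
    {W : Fin ℓ → Finset (Fin n)} (hW : ∀ i, W i ⊆ cell h t k i)
    (hWc : ∀ i, 0 < a k i → (cell h t k i).card ≤ 8 * (W i).card) :
    ((n : ℝ) + 1) ^ (∑ i, a k i) ≤ ((32 * C) ^ MM m * ((MM m).factorial : ℝ)) ^ ℓ *
      (((n : ℝ) + 1) ^ U.card * ((slices (cell h t k) (a k)).filter
        (fun T => U ⊆ T ∧ ∀ i, T ∩ cell h t k i ⊆ W i ∪ U)).card) := by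
  have hN0 : (0 : ℝ) < (n : ℝ) + 1 := by positivity
  have hC0 : 0 < C := by linarith
  obtain ⟨L, hL⟩ : ∃ L : ℝ, L = (32 * C) ^ MM m * ((MM m).factorial : ℝ) := ⟨_, rfl⟩
  rw [← hL]
  have hL1 : 1 ≤ L := by
    rw [hL]
    refine one_le_mul_of_one_le_of_one_le (one_le_pow₀ (by linarith)) ?_
    exact_mod_cast Nat.factorial_pos _
  have haM : ∀ i, a k i ≤ MM m := fun i =>
    (single_le_sum (f := fun i => a k i) (fun _ _ => Nat.zero_le _) (mem_univ i)).trans (ho.sum_a_le k)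
  have hUc : ∑ i, (U ∩ cell h t k i).card = U.card := by
    rw [← card_biUnion (fun i _ j _ hij => ((disjoint_cell k i j hij).mono inter_subset_right
      inter_subset_right)), ← inter_biUnion, inter_eq_left.2 hU]
  have hsum : ∑ i, a k i = (∑ i, (a k i - (U ∩ cell h t k i).card)) + U.card := by
    rw [← hUc, ← sum_add_distrib]
    exact sum_congr rfl fun i _ => (Nat.sub_add_cancel (hUa i)).symm
  have hdisj : ∀ i j, i ≠ j → Disjoint (W i \ U) (W j \ U) := fun i j hij =>
    (disjoint_cell k i j hij).mono (sdiff_subset.trans (hW i)) (sdiff_subset.trans (hW j))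
  have h1 : (slices (fun i => W i \ U) (fun i => a k i - (U ∩ cell h t k i).card)).card ≤
      ((slices (cell h t k) (a k)).filter
        (fun T => U ⊆ T ∧ ∀ i, T ∩ cell h t k i ⊆ W i ∪ U)).card := by
    refine card_le_card_of_injOn (fun T => T ∪ U) (fun T hT => ?_) ?_
    · rw [mem_coe, mem_slices] at hT
      have hTi : ∀ i, T ∩ cell h t k i = T ∩ (W i \ U) := by
        intro i
        ext x
        simp only [mem_inter]
        refine and_congr_right fun hx => ⟨fun hxi => ?_, fun hxi => hW i (Finset.mem_sdiff.1 hxi).1⟩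
        obtain ⟨j, _, hj⟩ := mem_biUnion.1 (hT.1 hx)
        by_cases hij : i = j
        · rwa [hij]
        · exact absurd (hW j (Finset.mem_sdiff.1 hj).1) (disjoint_left.1 (disjoint_cell k i j hij) hxi)
      rw [mem_coe, mem_filter, mem_slices]
      refine ⟨⟨union_subset (fun x hx => ?_) hU, fun i => ?_⟩, subset_union_right, fun i => ?_⟩
      · obtain ⟨j, _, hj⟩ := mem_biUnion.1 (hT.1 hx)
        exact mem_biUnion.2 ⟨j, mem_univ _, hW j (Finset.mem_sdiff.1 hj).1⟩
      · rw [union_inter_distrib_right, card_union_of_disjoint, hTi, hT.2]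
        · have := hUa i
          omega
        · rw [disjoint_left]
          intro x hx hx'
          obtain ⟨j, _, hj⟩ := mem_biUnion.1 (hT.1 (mem_inter.1 hx).1)
          exact (Finset.mem_sdiff.1 hj).2 (mem_inter.1 hx').1
      · rw [union_inter_distrib_right, hTi]
        exact union_subset_union (inter_subset_right.trans sdiff_subset) inter_subset_left
    · intro T hT T' hT' hTT
      have key : ∀ X ∈ slices (fun i => W i \ U) (fun i => a k i - (U ∩ cell h t k i).card),
          (X ∪ U) \ U = X := by
        intro X hX
        rw [union_sdiff_right, Finset.sdiff_eq_self_iff_disjoint, disjoint_left]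
        intro x hx hx'
        obtain ⟨j, _, hj⟩ := mem_biUnion.1 ((mem_slices.1 hX).1 hx)
        exact (Finset.mem_sdiff.1 hj).2 hx'
      rw [← key T hT, ← key T' hT']
      exact congrArg (· \ U) hTT
  have h2 : ((n : ℝ) + 1) ^ (∑ i, (a k i - (U ∩ cell h t k i).card)) ≤ L ^ ℓ *
      (slices (fun i => W i \ U) (fun i => a k i - (U ∩ cell h t k i).card)).card := by
    rw [card_slices _ _ hdisj, Nat.cast_prod, ← prod_pow_eq_pow_sum]
    have e : L ^ ℓ = ∏ _i : Fin ℓ, L := by simp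
    rw [e, ← prod_mul_distrib]
    refine prod_le_prod (fun _ _ => by positivity) fun i _ => ?_
    rcases Nat.eq_zero_or_pos (a k i) with h0 | h0
    · simp only [h0, Nat.zero_sub, pow_zero, Nat.choose_zero_right, Nat.cast_one, mul_one]
      exact hL1
    · have g1 := ho.cells k i h0
      have g2 : ((cell h t k i).card : ℝ) ≤ 8 * (W i).card := by exact_mod_cast hWc i h0
      have g3 : (W i).card ≤ (W i \ U).card + MM m := by
        have q1 := card_sdiff_add_card_inter (W i) U
        have q2 : (W i ∩ U).card ≤ (U ∩ cell h t k i).card := by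
          rw [inter_comm]
          exact card_le_card (inter_subset_inter le_rfl (hW i))
        have := hUa i
        have := haM i
        omega
      have g3' : ((W i).card : ℝ) ≤ (W i \ U).card + MM m := by exact_mod_cast g3
      have g4 : (n : ℝ) + 1 ≤ 16 * C * (W i \ U).card := by
        have := mul_le_mul_of_nonneg_left (g2.trans (mul_le_mul_of_nonneg_left g3' (by norm_num))) hC0.le
        linarith
      have g5 : 2 * MM m ≤ (W i \ U).card := by
        have : 16 * C * (2 * MM m) ≤ 16 * C * (W i \ U).card := by linarith
        have := le_of_mul_le_mul_left this (by positivity)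
        exact_mod_cast this
      have := pow_le_choose hN0.le (by linarith : 1 ≤ 16 * C) g4
        (b := a k i - (U ∩ cell h t k i).card) (M := MM m) (by have := haM i; omega) g5
      refine this.trans (le_of_eq ?_)
      rw [hL]
      ring
  have h1' : ((slices (fun i => W i \ U) (fun i => a k i - (U ∩ cell h t k i).card)).card : ℝ) ≤
      ((slices (cell h t k) (a k)).filter
        (fun T => U ⊆ T ∧ ∀ i, T ∩ cell h t k i ⊆ W i ∪ U)).card := by exact_mod_cast h1
  have h3 := h2.trans (mul_le_mul_of_nonneg_left h1' (by positivity))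
  rw [hsum, pow_add]
  have := mul_le_mul_of_nonneg_right h3 (by positivity : 0 ≤ ((n : ℝ) + 1) ^ U.card)
  linarith

/-- An extremal tuple whose cells are matched to the orientation. -/
structure Placed {n ℓ : ℕ} (m : Fin ℓ → Fin ℓ → ℕ) (F : Fin ℓ → Finset (Finset (Fin n)))
    (h t : Fin n → Fin ℓ) (a : Fin ℓ → Fin ℓ → ℕ) (C : ℝ) : Prop extends Oriented m F h t a C where
  reach : ∀ y, 1 ≤ C * (pp (F (t y)) y * ((n : ℝ) + 1))
  far : ∀ y k, k ≠ h y → k ≠ t y → pp (F k) y * ((n : ℝ) + 1) ^ 2 ≤ C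
  empty : ∀ k j, a k j = 0 → cell h t k j = ∅

lemma Placed.mono {C' : ℝ} (hp : Placed m F h t a C) (hC : C ≤ C') : Placed m F h t a C' := by
  refine ⟨hp.toOriented.mono hC, fun y => (hp.reach y).trans (mul_le_mul_of_nonneg_right hC ?_),
    fun y k hk hk' => (hp.far y k hk hk').trans hC, hp.empty⟩
  have := pp_nonneg (F (t y)) y
  positivity

lemma Oriented.cell_empty (ho : Oriented m F h t a C) (hsym : ∀ k1 k2, m k1 k2 = m k2 k1)
    (hC : 1 ≤ C) (hN : 32 * C * MM m ≤ (n : ℝ) + 1)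
    (hreach : ∀ y, 1 ≤ C * (pp (F (t y)) y * ((n : ℝ) + 1)))
    (hfull : ∀ k, ((32 * C) ^ MM m * ((MM m).factorial : ℝ)) ^ ℓ *
      (((slices (cell h t k) (a k)).filter (fun T => inn h k ∪ T ∉ F k)).card : ℝ) ≤
      1 / 2 * (slices (cell h t k) (a k)).card)
    (hexp : ∀ z : ℕ, 1 / C * ((n : ℝ) + 1) ≤ z →
      ((n : ℝ) + 1) ^ (MM m + 1) * (4 / 5) ^ z ≤ 1 / (2 * C)) (k j : Fin ℓ) (hkj : a k j = 0) :
    cell h t k j = ∅ := by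
  have hN0 : (0 : ℝ) < (n : ℝ) + 1 := by positivity
  have hC0 : 0 < C := by linarith
  rw [eq_empty_iff_forall_notMem]
  intro y hy
  rw [mem_cell] at hy
  obtain ⟨hty, hhy⟩ := hy
  have hne : k ≠ j := fun e => ho.ne y (hhy.trans (e.symm.trans hty.symm))
  have hr := hreach y
  rw [hty] at hr
  have hm := ho.sum k j hne
  rcases Nat.eq_zero_or_pos (a j k) with h0 | h0
  · have : pp (F k) y = 0 := by
      refine pr_eq_zero fun A hA hyA => ?_
      have h1 := ho.trace k j hne A hA
      have : 0 < (A ∩ inn h j).card := card_pos.2 ⟨y, mem_inter.2 ⟨hyA, mem_inn.2 hhy⟩⟩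
      omega
    rw [this] at hr
    norm_num at hr
  · have hcell : cell h t j k ⊆ inn h k := fun z hz => mem_inn.2 (mem_cell.1 hz).2
    have h1 : pp (F k) y ≤ pr (F k) (fun A => 8 * (A ∩ cell h t j k).card ≤ (cell h t j k).card) := by
      refine pr_mono fun A hA hyA => ?_
      by_contra hcon
      push Not at hcon
      have h2 := ho.card_slices_ge hC hN j (U := ∅) (empty_subset _) (by simp)
        (W := fun i => if i = k then A ∩ cell h t j k else cell h t j i) (by
          intro i
          split_ifs with hi
          · rw [hi]; exact inter_subset_right
          · exact le_rfl) (by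
          intro i _
          split_ifs with hi
          · rw [hi]; exact hcon.le
          · omega)
      have h3 : ((slices (cell h t j) (a j)).filter (fun T => ∅ ⊆ T ∧ ∀ i, T ∩ cell h t j i ⊆
          (if i = k then A ∩ cell h t j k else cell h t j i) ∪ ∅)).card ≤
          ((slices (cell h t j) (a j)).filter (fun T => inn h j ∪ T ∉ F j)).card := by
        refine card_le_card fun T hT => ?_
        rw [mem_filter] at hT ⊢
        refine ⟨hT.1, fun hTF => ?_⟩
        have h4 := ho.ext.1 k j hne A hA _ hTF
        have h5 : T ∩ cell h t j k ⊆ A := by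
          have := hT.2.2 k
          rw [if_pos rfl, union_empty] at this
          exact this.trans inter_subset_left
        have h6 : insert y (T ∩ cell h t j k) ⊆ A ∩ (inn h j ∪ T) := by
          intro x hx
          rw [mem_insert] at hx
          rcases hx with rfl | hx
          · exact mem_inter.2 ⟨hyA, mem_union_left _ (mem_inn.2 hhy)⟩
          · exact mem_inter.2 ⟨h5 hx, mem_union_right _ (mem_inter.1 hx).1⟩
        have h7 := card_le_card h6
        rw [card_insert_of_notMem, (mem_slices.1 hT.1).2] at h7
        · omega
        · intro hx
          have := (mem_cell.1 (mem_inter.1 hx).2).1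
          exact hne (hty.symm.trans this)
      have h3' : ((((slices (cell h t j) (a j)).filter (fun T => ∅ ⊆ T ∧ ∀ i, T ∩ cell h t j i ⊆
          (if i = k then A ∩ cell h t j k else cell h t j i) ∪ ∅)).card : ℕ) : ℝ) ≤
          ((slices (cell h t j) (a j)).filter (fun T => inn h j ∪ T ∉ F j)).card := by exact_mod_cast h3
      have h4 := hfull j
      have h5 : ((slices (cell h t j) (a j)).card : ℝ) ≤ ((n : ℝ) + 1) ^ (∑ i, a j i) :=
        card_slices_le j _
      rw [card_empty, pow_zero, one_mul] at h2
      have h6 := h2.trans ((mul_le_mul_of_nonneg_left h3' (by positivity)).trans h4)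
      have : 0 < ((n : ℝ) + 1) ^ (∑ i, a j i) := by positivity
      linarith
    have h2 := ho.chernoff hsym hcell
    have h3 := hexp (cell h t j k).card (by
      rw [div_mul_eq_mul_div, one_mul, div_le_iff₀ hC0]
      have := ho.cells j k h0
      linarith)
    have h4 := mul_le_mul_of_nonneg_right (h1.trans h2) hN0.le
    have h5 : pp (F k) y * ((n : ℝ) + 1) ≤ 1 / (2 * C) := by
      refine h4.trans (le_trans (le_of_eq ?_) h3)
      rw [pow_succ]; ring
    have h6 := mul_le_mul_of_nonneg_left h5 hC0.le
    have h7 : C * (1 / (2 * C)) = 1 / 2 := by field_simp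
    linarith

end

lemma exists_placed {ℓ : ℕ} (m : Fin ℓ → Fin ℓ → ℕ) (hsym : ∀ k1 k2, m k1 k2 = m k2 k1)
    (hnz : ∃ k1 k2 : Fin ℓ, k1 ≠ k2 ∧ 0 < m k1 k2) {C₀ : ℝ} (hC₀ : 0 < C₀) :
    ∃ C : ℝ, 0 < C ∧ ∀ᶠ n : ℕ in atTop, ∀ (F : Fin ℓ → Finset (Finset (Fin n))) (h t a),
      Oriented m F h t a C₀ → Placed m F h t a C := by
  obtain ⟨C₁, hC₁, hev⟩ := exists_pp_ge m hsym hnz hC₀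
  obtain ⟨K, hK⟩ : ∃ K : ℝ, K = C₀ + C₁ + 1 := ⟨_, rfl⟩
  have hK1 : 1 ≤ K := by linarith
  have hK0 : 0 < K := by linarith
  have hℓ : 0 < (ℓ : ℝ) := by
    obtain ⟨k, -⟩ := hnz
    exact_mod_cast k.pos
  obtain ⟨L, hL⟩ : ∃ L : ℝ, L = ((32 * K) ^ MM m * ((MM m).factorial : ℝ)) ^ ℓ := ⟨_, rfl⟩
  have hL1 : 1 ≤ L := by
    rw [hL]
    refine one_le_pow₀ (one_le_mul_of_one_le_of_one_le (one_le_pow₀ (by linarith)) ?_)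
    exact_mod_cast Nat.factorial_pos _
  obtain ⟨η, hη⟩ : ∃ η : ℝ, η = 1 / (2 * (2 ^ MM m * L * (ℓ + 1))) := ⟨_, rfl⟩
  have hη0 : 0 < η := by rw [hη]; positivity
  have hη1 : η ≤ 1 := by
    rw [hη, div_le_one (by positivity)]
    have h1 : (1 : ℝ) ≤ 2 ^ MM m * L := one_le_mul_of_one_le_of_one_le (one_le_pow₀ (by norm_num)) hL1
    nlinarith
  have hη2 : L * (2 ^ MM m * (ℓ * η)) ≤ 1 / 2 := by
    have : L * (2 ^ MM m * ((ℓ + 1) * η)) = 1 / 2 := by rw [hη]; field_simp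
    rw [← this]
    gcongr
    linarith
  refine ⟨K + 4 * K ^ 2, by positivity, ?_⟩
  filter_upwards [hev, ev_le (4 * K), ev_le (32 * K * MM m), Profile.not_slices_small m (C := K) hη0,
    exp_small (MM m + 1) (c := 1 / K) (ε := 1 / (2 * K)) (by positivity) (by positivity)]
    with n hn0 hn1 hn2 hn3 hn4 F h t a ho'
  have hN0 : (0 : ℝ) < (n : ℝ) + 1 := by positivity
  have ho := ho'.mono (C' := K) (by linarith)
  have hreach : ∀ y, 1 ≤ K * (pp (F (t y)) y * ((n : ℝ) + 1)) := fun y =>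
    (hn0 F h t a ho' y).trans (mul_le_mul_of_nonneg_right (by linarith)
      (mul_nonneg (pp_nonneg _ _) hN0.le))
  have hfull : ∀ k, L * (((slices (cell h t k) (a k)).filter (fun T => inn h k ∪ T ∉ F k)).card : ℝ) ≤
      1 / 2 * (slices (cell h t k) (a k)).card := fun k => by
    have h1 := mul_le_mul_of_nonneg_left
      (ho.nonfull_le hsym hη1 (hn3 F h t a ho.toProfile) k) (by linarith : 0 ≤ L)
    refine h1.trans ?_
    rw [← mul_assoc]
    exact mul_le_mul_of_nonneg_right hη2 (Nat.cast_nonneg _)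
  have hK2 : 0 ≤ 4 * K ^ 2 := by positivity
  refine ⟨ho.mono (by linarith), fun y => (hreach y).trans (mul_le_mul_of_nonneg_right (by linarith)
      (mul_nonneg (pp_nonneg _ _) hN0.le)), fun y k hk hk' => ?_,
    ho.cell_empty hsym hK1 hn2 hreach (fun k => by rw [← hL]; exact hfull k) hn4⟩
  have h1 := ho.triple hn1 hk hk'
  have h2 := hreach y
  have h3 : 0 ≤ pp (F k) y * ((n : ℝ) + 1) ^ 2 := mul_nonneg (pp_nonneg _ _) (by positivity)
  have h4 := mul_le_mul_of_nonneg_left h2 h3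
  have h5 := mul_le_mul_of_nonneg_left h1 hK0.le
  have h6 : pp (F k) y * ((n : ℝ) + 1) ^ 2 * (K * (pp (F (t y)) y * ((n : ℝ) + 1))) =
      K * (pp (F k) y * pp (F (t y)) y * ((n : ℝ) + 1) ^ 3) := by ring
  linarith

section
variable {n ℓ : ℕ} {m : Fin ℓ → Fin ℓ → ℕ} {F : Fin ℓ → Finset (Finset (Fin n))}
  {h t : Fin n → Fin ℓ} {C : ℝ} {a : Fin ℓ → Fin ℓ → ℕ}

/-- Sets `U` of size `u` that certify, together with a bounded part `D` of `inn h k`, that many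
members of `St h t a k` are missing from `F k`. -/
def wits (F : Fin ℓ → Finset (Finset (Fin n))) (h t : Fin n → Fin ℓ) (a : Fin ℓ → Fin ℓ → ℕ)
    (k : Fin ℓ) (M u : ℕ) : Finset (Finset (Fin n)) :=
  univ.filter (fun U => U.card = u ∧ U ⊆ univ.biUnion (cell h t k) ∧
    (∀ i, (U ∩ cell h t k i).card ≤ a k i) ∧ ∃ D ⊆ inn h k, D.card ≤ M ∧
    ∃ W : Fin ℓ → Finset (Fin n), (∀ i, W i ⊆ cell h t k i) ∧
      (∀ i, 0 < a k i → (cell h t k i).card ≤ 8 * (W i).card) ∧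
      ∀ T ∈ slices (cell h t k) (a k), U ⊆ T → (∀ i, T ∩ cell h t k i ⊆ W i ∪ U) →
        ∀ E, D ⊆ E → E ∪ T ∉ F k)

lemma St_sdiff_card_le {k : Fin ℓ} {X : Finset (Fin n)} (hX : X ∈ St h t a k) :
    X \ inn h k ⊆ univ.biUnion (cell h t k) ∧ (X \ inn h k).card ≤ ∑ i, a k i := by
  rw [mem_St] at hX
  have h1 : X \ inn h k ⊆ univ.biUnion (fun i => X ∩ cell h t k i) := by
    intro x hx
    rw [Finset.mem_sdiff, mem_inn] at hx
    exact mem_biUnion.2 ⟨h x, mem_univ _, mem_inter.2 ⟨hx.1,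
      mem_cell.2 ⟨(hX.1 x hx.1).resolve_left hx.2, rfl⟩⟩⟩
  exact ⟨h1.trans (biUnion_mono fun i _ => inter_subset_right),
    (card_le_card h1).trans (card_biUnion_le.trans (sum_le_sum fun i _ => hX.2 i))⟩

lemma card_St_le (k : Fin ℓ) :
    ((St h t a k).card : ℝ) ≤ 2 ^ (inn h k).card * ((n : ℝ) + 1) ^ (∑ i, a k i) := by
  have := card_le_of_sdiff_le (St h t a k) (inn h k) (∑ i, a k i)
    fun X hX => (St_sdiff_card_le hX).2
  exact_mod_cast this

lemma card_powerset_superset {I D : Finset (Fin n)} (hD : D ⊆ I) :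
    2 ^ I.card = 2 ^ D.card * (I.powerset.filter (D ⊆ ·)).card := by
  have h1 : (I.powerset.filter (D ⊆ ·)) = (I \ D).powerset.image (· ∪ D) := by
    ext X
    simp only [mem_filter, mem_powerset, mem_image]
    constructor
    · rintro ⟨h1, h2⟩
      exact ⟨X \ D, sdiff_subset_sdiff h1 le_rfl, sdiff_union_of_subset h2⟩
    · rintro ⟨Y, hY, rfl⟩
      exact ⟨union_subset (hY.trans sdiff_subset) hD, subset_union_right⟩
  rw [h1, card_image_of_injOn, card_powerset, ← pow_add, card_sdiff_of_subset hD]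
  · congr 1
    have := card_le_card hD
    omega
  · intro X hX Y hY hXY
    rw [mem_coe, mem_powerset] at hX hY
    have key : ∀ Z ⊆ I \ D, (Z ∪ D) \ D = Z := by
      intro Z hZ
      rw [union_sdiff_right, Finset.sdiff_eq_self_iff_disjoint]
      exact disjoint_sdiff_self_left.mono_left hZ
    rw [← key X hX, ← key Y hY]
    exact congrArg (· \ D) hXY

lemma Oriented.card_wits_le (ho : Oriented m F h t a C) (hC : 1 ≤ C)
    (hN : 32 * C * MM m ≤ (n : ℝ) + 1) (k : Fin ℓ) (M u : ℕ) :
    ((wits F h t a k M u).card : ℝ) * (F k).card ≤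
      C * 2 ^ M * 2 ^ MM m * ((32 * C) ^ MM m * ((MM m).factorial : ℝ)) ^ ℓ *
        (((n : ℝ) + 1) ^ u * (St h t a k \ F k).card) := by
  have hC0 : 0 < C := by linarith
  obtain ⟨L, hL⟩ : ∃ L : ℝ, L = ((32 * C) ^ MM m * ((MM m).factorial : ℝ)) ^ ℓ := ⟨_, rfl⟩
  have hL0 : 0 < L := by
    rw [hL]
    have : (0 : ℝ) < (MM m).factorial := by exact_mod_cast Nat.factorial_pos _
    positivity
  rw [← hL]
  have h1 : ∀ U ∈ wits F h t a k M u, (2 : ℝ) ^ (inn h k).card * ((n : ℝ) + 1) ^ (∑ i, a k i) ≤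
      2 ^ M * L * ((n : ℝ) + 1) ^ u * ((St h t a k \ F k).filter (fun X => U ⊆ X \ inn h k)).card := by
    intro U hU
    rw [wits, mem_filter] at hU
    obtain ⟨-, hUu, hUc, hUa, D, hD, hDM, W, hW, hWc, hbad⟩ := hU
    have g1 := ho.card_slices_ge hC hN k hUc hUa hW hWc
    rw [← hL, hUu] at g1
    obtain ⟨G, hG⟩ : ∃ G, G = (slices (cell h t k) (a k)).filter
        (fun T => U ⊆ T ∧ ∀ i, T ∩ cell h t k i ⊆ W i ∪ U) := ⟨_, rfl⟩
    rw [← hG] at g1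
    have g2 := card_powerset_superset hD
    have g3 := card_union_image ((inn h k).powerset.filter (D ⊆ ·)) G (inn h k)
      (fun A hA => mem_powerset.1 (mem_filter.1 hA).1) (fun B hB => by
        rw [hG, mem_filter] at hB
        exact slices_disjoint_inn ho.ne hB.1)
    have g4 : (((inn h k).powerset.filter (D ⊆ ·) ×ˢ G).image (fun p => p.1 ∪ p.2)).card ≤
        ((St h t a k \ F k).filter (fun X => U ⊆ X \ inn h k)).card := by
      refine card_le_card fun X hX => ?_
      obtain ⟨⟨E, T⟩, hp, rfl⟩ := mem_image.1 hX
      rw [mem_product, mem_filter, mem_powerset, hG, mem_filter] at hp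
      obtain ⟨⟨hE, hDE⟩, hT, hUT, hTW⟩ := hp
      rw [mem_filter, Finset.mem_sdiff]
      refine ⟨⟨union_mem_St ho.ne hE hT, hbad T hT hUT hTW E hDE⟩, fun x hx => ?_⟩
      exact Finset.mem_sdiff.2 ⟨mem_union_right _ (hUT hx),
        disjoint_left.1 (slices_disjoint_inn ho.ne hT) (hUT hx)⟩
    rw [g3] at g4
    have g2' : (2 : ℝ) ^ (inn h k).card ≤ 2 ^ M * ((inn h k).powerset.filter (D ⊆ ·)).card := by
      have : (2 : ℝ) ^ (inn h k).card = 2 ^ D.card * ((inn h k).powerset.filter (D ⊆ ·)).card := by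
        exact_mod_cast g2
      rw [this]
      exact mul_le_mul_of_nonneg_right (pow_le_pow_right₀ (by norm_num) hDM) (Nat.cast_nonneg _)
    have g4' : (((inn h k).powerset.filter (D ⊆ ·)).card : ℝ) * G.card ≤
        ((St h t a k \ F k).filter (fun X => U ⊆ X \ inn h k)).card := by exact_mod_cast g4
    calc _ ≤ 2 ^ M * (((inn h k).powerset.filter (D ⊆ ·)).card : ℝ) *
          (L * (((n : ℝ) + 1) ^ u * G.card)) :=
          mul_le_mul g2' g1 (by positivity) (mul_nonneg (by positivity) (Nat.cast_nonneg _))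
      _ = 2 ^ M * L * ((n : ℝ) + 1) ^ u * ((((inn h k).powerset.filter (D ⊆ ·)).card : ℝ) * G.card) := by
          ring
      _ ≤ _ := mul_le_mul_of_nonneg_left g4' (by positivity)
  have h2 : ∑ U ∈ wits F h t a k M u, ((St h t a k \ F k).filter (fun X => U ⊆ X \ inn h k)).card ≤
      2 ^ MM m * (St h t a k \ F k).card := by
    have e : ∀ U, ((St h t a k \ F k).filter (fun X => U ⊆ X \ inn h k)).card =
        ∑ X ∈ St h t a k \ F k, if U ⊆ X \ inn h k then 1 else 0 := fun U => by
      rw [card_filter]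
    simp only [e]
    rw [sum_comm, mul_comm, ← smul_eq_mul]
    refine sum_le_card_nsmul _ _ _ fun X hX => ?_
    rw [← card_filter]
    have hX' := (St_sdiff_card_le (Finset.mem_sdiff.1 hX).1).2
    refine (card_le_card (t := (X \ inn h k).powerset) fun U hU =>
      mem_powerset.2 (mem_filter.1 hU).2).trans ?_
    rw [card_powerset]
    exact Nat.pow_le_pow_right (by norm_num) (hX'.trans (ho.sum_a_le k))
  have h2' : ∑ U ∈ wits F h t a k M u,
      (((St h t a k \ F k).filter (fun X => U ⊆ X \ inn h k)).card : ℝ) ≤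
      2 ^ MM m * (St h t a k \ F k).card := by exact_mod_cast h2
  have h3 := sum_le_sum h1
  rw [sum_const, nsmul_eq_mul, ← mul_sum] at h3
  have h4 := mul_le_mul_of_nonneg_left (ho.up k) (Nat.cast_nonneg (α := ℝ) (wits F h t a k M u).card)
  have h5 := mul_le_mul_of_nonneg_left (h3.trans (mul_le_mul_of_nonneg_left h2' (by positivity))) hC0.le
  linarith

/-- Adjoining `St h t a k` to `F k` and discarding the conflicting sets elsewhere. -/
lemma Extremal.adjoin (hF : Extremal m F) (hsym : ∀ k1 k2, m k1 k2 = m k2 k1) (k : Fin ℓ)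
    (S : Finset (Finset (Fin n))) :
    (((F k).card : ℝ) + (S \ F k).card) * (1 - ∑ j ∈ univ.erase k,
      pr (F j) (fun A => ∃ X ∈ S, m k j < (A ∩ X).card)) ≤ (F k).card := by
  obtain ⟨G, hG⟩ : ∃ G : Fin ℓ → Finset (Finset (Fin n)), G = fun j => if j = k then F k ∪ S else
    (F j).filter (fun A => ¬ ∃ X ∈ S, m k j < (A ∩ X).card) := ⟨_, rfl⟩
  have hGk : G k = F k ∪ S := by rw [hG]; simp
  have hGj : ∀ j, j ≠ k → G j = (F j).filter (fun A => ¬ ∃ X ∈ S, m k j < (A ∩ X).card) :=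
    fun j hj => by rw [hG]; simp [hj]
  have key : ∀ j, j ≠ k → ∀ A ∈ G k, ∀ B ∈ G j, (A ∩ B).card ≤ m k j := by
    intro j hj A hA B hB
    rw [hGk, mem_union] at hA
    rw [hGj j hj, mem_filter] at hB
    rcases hA with hA | hA
    · exact hF.1 k j hj.symm A hA B hB.1
    · by_contra hcon
      push Not at hcon
      rw [inter_comm] at hcon
      exact hB.2 ⟨A, hA, hcon⟩
  have hov : Overlap m G := by
    intro i j hij A hA B hB
    by_cases hi : i = k
    · subst hi; exact key j hij.symm A hA B hB
    by_cases hj : j = k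
    · subst hj
      rw [inter_comm, hsym]
      exact key i hi B hB A hA
    · rw [hGj i hi, mem_filter] at hA
      rw [hGj j hj, mem_filter] at hB
      exact hF.1 i j hij A hA.1 B hB.1
  have h1 := hF.2 G hov
  rw [← mul_prod_erase univ _ (mem_univ k), ← mul_prod_erase univ (fun k => (F k).card) (mem_univ k)] at h1
  have h2 : (G k).card = (F k).card + (S \ F k).card := by
    rw [hGk, ← union_sdiff_self_eq_union, card_union_of_disjoint disjoint_sdiff]
  have h3 : ∀ j ∈ univ.erase k, ((G j).card : ℝ) =
      (1 - pr (F j) (fun A => ∃ X ∈ S, m k j < (A ∩ X).card)) * (F j).card := by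
    intro j hj
    have := pr_add_not (P := fun A => ∃ X ∈ S, m k j < (A ∩ X).card) (hF.card_pos j)
    rw [hGj j (mem_erase.1 hj).1, ← pr_mul_card (P := fun A => ¬ ∃ X ∈ S, m k j < (A ∩ X).card)]
    congr 1
    linarith
  rw [h2] at h1
  have h1' : (((F k).card : ℝ) + (S \ F k).card) * ∏ j ∈ univ.erase k, ((G j).card : ℝ) ≤
      (F k).card * ∏ j ∈ univ.erase k, ((F j).card : ℝ) := by exact_mod_cast h1
  rw [prod_congr rfl h3, prod_mul_distrib, ← mul_assoc] at h1'
  have h4 := le_of_mul_le_mul_right h1'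
    (prod_pos fun j _ => by exact_mod_cast hF.card_pos j)
  refine le_trans (mul_le_mul_of_nonneg_left ?_ (add_nonneg (Nat.cast_nonneg _) (Nat.cast_nonneg _))) h4
  exact one_sub_sum_le_prod _ _ (fun _ _ => pr_nonneg) (fun _ _ => pr_le_one)

/-- A missing member of the structure produces many missing members. -/
lemma Oriented.exists_wits (ho : Oriented m F h t a C) (hsym : ∀ k1 k2, m k1 k2 = m k2 k1)
    {k : Fin ℓ} {X : Finset (Fin n)} (hX : X ∈ St h t a k) (hXF : X ∉ F k) :
    ∃ u ≤ MM m, 0 < (wits F h t a k (MM m + 1) u).card := by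
  have h1 := St_sdiff_card_le hX
  have h2 : inn h k ∪ (X \ inn h k) ∉ F k := fun hmem =>
    hXF (ho.ext.down hsym hmem (by rw [union_sdiff_self_eq_union]; exact subset_union_right))
  obtain ⟨D, hD, hDM, hbad⟩ := ho.exists_core hsym h2
  refine ⟨(X \ inn h k).card, h1.2.trans (ho.sum_a_le k), card_pos.2 ⟨X \ inn h k, ?_⟩⟩
  rw [wits, mem_filter]
  refine ⟨mem_univ _, rfl, h1.1, fun i => ?_, D, hD, by omega, cell h t k, fun i => le_rfl,
    fun i _ => by omega, fun T _ hUT _ E hDE hmem => ?_⟩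
  · exact (card_le_card (inter_subset_inter sdiff_subset le_rfl)).trans ((mem_St.1 hX).2 i)
  · exact hbad E hDE (ho.ext.down hsym hmem (union_subset_union le_rfl hUT))

end

section
variable {n ℓ : ℕ} {m : Fin ℓ → Fin ℓ → ℕ} {F : Fin ℓ → Finset (Finset (Fin n))}
  {h t : Fin n → Fin ℓ} {C : ℝ} {a : Fin ℓ → Fin ℓ → ℕ}

lemma Placed.pr_subset_le (hp : Placed m F h t a C) (hC : 1 ≤ C) {k j : Fin ℓ} (hkj : k ≠ j)
    (hempty : cell h t k j = ∅) {U : Finset (Fin n)} (hU : U ⊆ univ.biUnion (cell h t k))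
    (hUa : ∀ i, (U ∩ cell h t k i).card ≤ a k i) (hne : U.Nonempty) :
    pr (F j) (U ⊆ ·) * ((n : ℝ) + 1) ^ (U.card + 1) ≤ C ^ (ℓ + 2) := by
  have hN0 : (0 : ℝ) < (n : ℝ) + 1 := by positivity
  have hN1 : (1 : ℝ) ≤ (n : ℝ) + 1 := by linarith [Nat.cast_nonneg (α := ℝ) n]
  have hC0 : 0 < C := by linarith
  obtain ⟨y₀, hy₀⟩ := hne
  have hUt : ∀ y ∈ U, t y = k ∧ h y ≠ k ∧ h y ≠ j := by
    intro y hy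
    obtain ⟨i, _, hi⟩ := mem_biUnion.1 (hU hy)
    rw [mem_cell] at hi
    refine ⟨hi.1, fun e => hp.ne y (e.trans hi.1.symm), fun e => ?_⟩
    have : y ∈ cell h t k j := mem_cell.2 ⟨hi.1, e⟩
    rw [hempty] at this
    exact notMem_empty _ this
  obtain ⟨D, hD⟩ : ∃ D : Fin ℓ → Finset (Fin n), D = fun i => if i = k then {y₀} else
    if i = j then U else U ∩ cell h t k i := ⟨_, rfl⟩
  have hDk : D k = {y₀} := by rw [hD]; simp
  have hDj : D j = U := by rw [hD]; simp [hkj.symm]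
  have hDi : ∀ i, i ≠ k → i ≠ j → D i = U ∩ cell h t k i := fun i h1 h2 => by rw [hD]; simp [h1, h2]
  have h1 := hp.link D
  have hmem : ∀ y ∈ U, y ∈ D j ∧ y ∈ D (h y) := by
    intro y hy
    obtain ⟨g1, g2, g3⟩ := hUt y hy
    rw [hDj, hDi _ g2 g3]
    exact ⟨hy, mem_inter.2 ⟨hy, mem_cell.2 ⟨g1, rfl⟩⟩⟩
  have hexp : U.card + 2 ≤ ∑ y, (univ.filter (fun i => y ∈ D i)).card.choose 2 := by
    have g1 : ∑ y ∈ U, (if y = y₀ then 3 else 1) ≤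
        ∑ y, (univ.filter (fun i => y ∈ D i)).card.choose 2 := by
      refine le_trans (sum_le_sum fun y hy => ?_) (sum_le_univ_sum_of_nonneg fun _ => Nat.zero_le _)
      obtain ⟨e1, e2, e3⟩ := hUt y hy
      obtain ⟨e4, e5⟩ := hmem y hy
      split_ifs with hyy
      · have : ({k, j, h y} : Finset (Fin ℓ)) ⊆ univ.filter (fun i => y ∈ D i) := by
          intro i hi
          simp only [mem_insert, mem_singleton] at hi
          rw [mem_filter]
          refine ⟨mem_univ _, ?_⟩
          rcases hi with rfl | rfl | rfl
          · rw [hDk, hyy]; exact mem_singleton_self _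
          · exact e4
          · exact e5
        have := card_le_card this
        rw [card_insert_of_notMem (by simp [hkj, e2.symm]), card_insert_of_notMem
          (by simpa using e3.symm), card_singleton] at this
        exact (by decide : 3 ≤ Nat.choose 3 2).trans (Nat.choose_le_choose 2 this)
      · have : ({j, h y} : Finset (Fin ℓ)) ⊆ univ.filter (fun i => y ∈ D i) := by
          intro i hi
          simp only [mem_insert, mem_singleton] at hi
          rw [mem_filter]
          refine ⟨mem_univ _, ?_⟩
          rcases hi with rfl | rfl
          · exact e4
          · exact e5
        have := card_le_card this
        rw [card_insert_of_notMem (by simpa using e3.symm), card_singleton] at this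
        exact (by decide : 1 ≤ Nat.choose 2 2).trans (Nat.choose_le_choose 2 this)
    refine le_trans (le_of_eq ?_) g1
    rw [← add_sum_erase U _ hy₀, if_pos rfl, sum_congr rfl (g := fun _ => 1)
      (fun y hy => if_neg (mem_erase.1 hy).1), sum_const, smul_eq_mul, mul_one, card_erase_of_mem hy₀]
    have := card_pos.2 ⟨y₀, hy₀⟩
    omega
  obtain ⟨c, hc⟩ : ∃ c : Fin ℓ → ℝ, c = fun i => if i = k then C * ((n : ℝ) + 1) else C := ⟨_, rfl⟩
  have hc0 : ∀ i, 0 < c i := fun i => by rw [hc]; simp only; split_ifs <;> positivity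
  have h2 : ∀ i ∈ univ.erase j, 1 ≤ c i * pr (F i) (D i ⊆ ·) := by
    intro i hi
    have hij := (mem_erase.1 hi).1
    by_cases hik : i = k
    · subst hik
      have h3 := hp.reach y₀
      rw [(hUt y₀ hy₀).1] at h3
      have h4 : pr (F i) (D i ⊆ ·) = pp (F i) y₀ := by
        rw [hDk]; simp only [singleton_subset_iff]; rfl
      rw [h4, hc]
      simp only [if_true]
      linarith
    · rw [hc, hDi i hik hij]
      simp only [if_neg hik]
      refine hp.sub i _ (fun y hy => mem_inn.2 (mem_cell.1 (mem_inter.1 hy).2).2) ?_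
      have h3 := hUa i
      have h4 : a k i ≤ ∑ i, a k i :=
        single_le_sum (f := fun i => a k i) (fun _ _ => Nat.zero_le _) (mem_univ i)
      have := hp.sum_a_le k
      omega
  have h3 : (1 : ℝ) ≤ ∏ i ∈ univ.erase j, (c i * pr (F i) (D i ⊆ ·)) := by
    have := prod_le_prod (s := univ.erase j) (f := fun _ => (1 : ℝ)) (fun _ _ => by norm_num) h2
    rwa [prod_const_one] at this
  rw [prod_mul_distrib] at h3
  have h4 : ∏ i ∈ univ.erase j, c i ≤ C ^ ℓ * ((n : ℝ) + 1) := by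
    have hk : k ∈ univ.erase j := mem_erase.2 ⟨hkj, mem_univ _⟩
    rw [← mul_prod_erase _ _ hk]
    have e1 : c k = C * ((n : ℝ) + 1) := by rw [hc]; simp
    have e2 : ∏ i ∈ (univ.erase j).erase k, c i = C ^ ((univ.erase j).erase k).card := by
      rw [← prod_const]
      refine prod_congr rfl fun i hi => ?_
      rw [hc]; simp [(mem_erase.1 hi).1]
    rw [e1, e2, mul_right_comm, ← pow_succ']
    refine mul_le_mul_of_nonneg_right (pow_le_pow_right₀ hC ?_) hN0.le
    have := card_erase_add_one hk
    rw [this]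
    exact (card_le_univ _).trans (by simp)
  rw [← mul_prod_erase univ _ (mem_univ j), hDj] at h1
  obtain ⟨Q, hQ⟩ : ∃ Q : ℝ, Q = ∏ i ∈ univ.erase j, pr (F i) (D i ⊆ ·) := ⟨_, rfl⟩
  rw [← hQ] at h1 h3
  have hQ0 : 0 ≤ Q := by rw [hQ]; exact prod_nonneg fun _ _ => pr_nonneg
  have h5 : 1 ≤ C ^ ℓ * ((n : ℝ) + 1) * Q := h3.trans (mul_le_mul_of_nonneg_right h4 hQ0)
  have hp0 : 0 ≤ pr (F j) (U ⊆ ·) := pr_nonneg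
  have h6 : pr (F j) (U ⊆ ·) * Q * ((n : ℝ) + 1) ^ (U.card + 2) ≤ C :=
    (mul_le_mul_of_nonneg_left (pow_le_pow_right₀ hN1 hexp) (mul_nonneg hp0 hQ0)).trans h1
  have h7 := mul_le_mul_of_nonneg_left h5 (mul_nonneg hp0 (by positivity : 0 ≤ ((n : ℝ) + 1) ^ (U.card + 1)))
  have h8 := mul_le_mul_of_nonneg_left h6 (by positivity : 0 ≤ C ^ ℓ)
  calc pr (F j) (U ⊆ ·) * ((n : ℝ) + 1) ^ (U.card + 1) ≤
        C ^ ℓ * (pr (F j) (U ⊆ ·) * Q * ((n : ℝ) + 1) ^ (U.card + 2)) := by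
          refine le_trans (le_of_eq (by ring)) (h7.trans (le_of_eq ?_))
          rw [pow_succ _ (U.card + 1)]; ring
    _ ≤ C ^ ℓ * C := h8
    _ ≤ C ^ (ℓ + 2) := by rw [← pow_succ]; exact pow_le_pow_right₀ hC (by omega)

lemma Placed.exists_wits_of_conflict (hp : Placed m F h t a C)
    (hsym : ∀ k1 k2, m k1 k2 = m k2 k1) {k j : Fin ℓ} (hkj : k ≠ j)
    {A X : Finset (Fin n)} (hA : A ∈ F j) (hX : X ∈ St h t a k) (hlt : m k j < (A ∩ X).card) :
    ∃ u < MM m + 2, ∃ U ∈ wits F h t a k (MM m + 1) u, U.Nonempty ∧ U ⊆ A := by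
  have hmM := le_MM m k j
  have h1 : (A ∩ inn h k).card ≤ m k j := by
    rw [hsym]
    exact hp.trace j k hkj.symm A hA
  have h2 : ((A ∩ X) ∩ inn h k).card ≤ m k j :=
    (card_le_card (inter_subset_inter inter_subset_left le_rfl)).trans h1
  have h3 := card_sdiff_add_card_inter (A ∩ X) (inn h k)
  obtain ⟨D, hD⟩ : ∃ D, D = (A ∩ X) ∩ inn h k := ⟨_, rfl⟩
  rw [← hD] at h2 h3
  obtain ⟨U, hUs, hUc⟩ := exists_subset_card_eq (s := (A ∩ X) \ inn h k)
    (n := m k j + 1 - D.card) (by omega)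
  have hUA : U ⊆ A := hUs.trans (sdiff_subset.trans inter_subset_left)
  have hUX : U ⊆ X := hUs.trans (sdiff_subset.trans inter_subset_right)
  have hUcell : U ⊆ univ.biUnion (cell h t k) :=
    hUs.trans ((sdiff_subset_sdiff inter_subset_right le_rfl).trans (St_sdiff_card_le hX).1)
  have hUa : ∀ i, (U ∩ cell h t k i).card ≤ a k i := fun i =>
    (card_le_card (inter_subset_inter hUX le_rfl)).trans ((mem_St.1 hX).2 i)
  have hDU : Disjoint U D := by
    rw [hD, disjoint_left]
    exact fun x hx hx' => (Finset.mem_sdiff.1 (hUs hx)).2 (mem_inter.1 hx').2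
  have hDA : D ⊆ A := by rw [hD]; exact inter_subset_left.trans inter_subset_left
  have hDI : D ⊆ inn h k := by rw [hD]; exact inter_subset_right
  have hbad : ∀ T ∈ slices (cell h t k) (a k), U ⊆ T →
      (∀ i, T ∩ cell h t k i ⊆ cell h t k i ∪ U) → ∀ E, D ⊆ E → E ∪ T ∉ F k := by
    intro T _ hUT _ E hDE hmem
    have h4 := hp.ext.1 k j hkj _ hmem A hA
    have h5 : U ∪ D ⊆ (E ∪ T) ∩ A :=
      union_subset (subset_inter (hUT.trans subset_union_right) hUA)
        (subset_inter (hDE.trans subset_union_left) hDA)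
    have h6 := card_le_card h5
    rw [card_union_of_disjoint hDU] at h6
    omega
  refine ⟨U.card, by omega, U, ?_, card_pos.1 (by omega), hUA⟩
  rw [wits, mem_filter]
  exact ⟨mem_univ _, rfl, hUcell, hUa, D, hDI, by omega, cell h t k, fun _ => le_rfl,
    fun i _ => by omega, hbad⟩

/-- Conflicts with `St h t a k` in a family `F j` pointing to `k` are controlled by witnesses. -/
lemma Placed.conflict_le_of_in (hp : Placed m F h t a C) (hsym : ∀ k1 k2, m k1 k2 = m k2 k1)
    (hC : 1 ≤ C) {k j : Fin ℓ}
    (hkj : k ≠ j) (hjk : a j k ≠ 0) :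
    pr (F j) (fun A => ∃ X ∈ St h t a k, m k j < (A ∩ X).card) ≤
      ∑ u ∈ range (MM m + 2), (wits F h t a k (MM m + 1) u).card *
        (C ^ (ℓ + 2) / ((n : ℝ) + 1) ^ (u + 1)) := by
  have hN0 : (0 : ℝ) < (n : ℝ) + 1 := by positivity
  have hakj : a k j = 0 := (hp.orient k j).resolve_right hjk
  have hempty := hp.empty k j hakj
  obtain ⟨W, hW⟩ : ∃ W : ℕ → Finset (Finset (Fin n)), W = fun u =>
    (wits F h t a k (MM m + 1) u).filter (fun U => U.Nonempty) := ⟨_, rfl⟩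
  have hW' : ∀ u U, U ∈ W u ↔ U ∈ wits F h t a k (MM m + 1) u ∧ U.Nonempty := fun u U => by
    rw [hW, mem_filter]
  have hWc : ∀ u, (W u).card ≤ (wits F h t a k (MM m + 1) u).card := fun u =>
    card_le_card fun U hU => ((hW' u U).1 hU).1
  have h0 : ∀ A ∈ F j, (∃ X ∈ St h t a k, m k j < (A ∩ X).card) →
      ∃ u ∈ range (MM m + 2), ∃ U ∈ W u, U ⊆ A := by
    rintro A hA ⟨X, hX, hlt⟩
    obtain ⟨u, hu, U, hU, hne, hUA⟩ := hp.exists_wits_of_conflict hsym hkj hA hX hlt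
    exact ⟨u, mem_range.2 hu, U, (hW' u U).2 ⟨hU, hne⟩, hUA⟩
  refine (pr_exists_le (range (MM m + 2)) (fun u A => ∃ U ∈ W u, U ⊆ A) h0).trans
    (sum_le_sum fun u _ => ?_)
  refine (pr_exists_le (W u) (fun U A => U ⊆ A) fun A _ hA => hA).trans ?_
  have h1 : ∀ U ∈ W u, pr (F j) (U ⊆ ·) ≤ C ^ (ℓ + 2) / ((n : ℝ) + 1) ^ (u + 1) := by
    intro U hU
    obtain ⟨hU, hne⟩ := (hW' u U).1 hU
    rw [wits, mem_filter] at hU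
    obtain ⟨-, hUu, hUc, hUa, -⟩ := hU
    rw [le_div_iff₀ (by positivity), ← hUu]
    exact hp.pr_subset_le hC hkj hempty hUc hUa hne
  refine (sum_le_card_nsmul _ _ _ h1).trans ?_
  rw [nsmul_eq_mul]
  refine mul_le_mul_of_nonneg_right ?_ (by positivity)
  exact_mod_cast hWc u

lemma Placed.point_wits (hp : Placed m F h t a C) {k j : Fin ℓ}
    (hkj : k ≠ j) (hjk : a j k = 0) {A : Finset (Fin n)} (hA : A ∈ F j)
    (hdense : 0 < a k j → (cell h t k j).card ≤ 8 * (A ∩ cell h t k j).card)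
    {y : Fin n} (hyA : y ∈ A) (hy : y ∉ cell h t k j) {M : ℕ} :
    (h y = k → ∅ ∈ wits F h t a k (M + 1) 0) ∧ (t y = k → {y} ∈ wits F h t a k (M + 1) 1) := by
  have hm := hp.sum k j hkj
  have hW1 : ∀ i, (if i = j then A ∩ cell h t k j else cell h t k i) ⊆ cell h t k i := by
    intro i
    split_ifs with hi
    · rw [hi]; exact inter_subset_right
    · exact le_rfl
  have hW2 : ∀ i, 0 < a k i → (cell h t k i).card ≤
      8 * (if i = j then A ∩ cell h t k j else cell h t k i).card := by
    intro i hi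
    split_ifs with hij
    · subst hij; exact hdense hi
    · omega
  have key : ∀ U ⊆ A, ∀ T ∈ slices (cell h t k) (a k), (∀ i, T ∩ cell h t k i ⊆
      (if i = j then A ∩ cell h t k j else cell h t k i) ∪ U) → ∀ E, y ∈ E ∪ T → E ∪ T ∉ F k := by
    intro U hU T hT hTW E hyE hmem
    have h4 := hp.ext.1 k j hkj _ hmem A hA
    have h5 : insert y (T ∩ cell h t k j) ⊆ (E ∪ T) ∩ A := by
      intro x hx
      rcases mem_insert.1 hx with rfl | hx
      · exact mem_inter.2 ⟨hyE, hyA⟩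
      · have h6 := hTW j hx
        rw [if_pos rfl, mem_union] at h6
        refine mem_inter.2 ⟨mem_union_right _ (mem_inter.1 hx).1, ?_⟩
        rcases h6 with h6 | h6
        · exact (mem_inter.1 h6).1
        · exact hU h6
    have h6 := card_le_card h5
    rw [card_insert_of_notMem (fun hx => hy (mem_inter.1 hx).2), (mem_slices.1 hT).2] at h6
    omega
  constructor
  · intro hhy
    rw [wits, mem_filter]
    refine ⟨mem_univ _, card_empty, empty_subset _, by simp, {y}, by simpa using hhy, by simp, _,
      hW1, hW2, fun T hT _ hTW E hDE => key ∅ (empty_subset _) T hT hTW E ?_⟩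
    exact mem_union_left _ (hDE (mem_singleton_self y))
  · intro hty
    have hyc : y ∈ cell h t k (h y) := mem_cell.2 ⟨hty, rfl⟩
    rw [wits, mem_filter]
    refine ⟨mem_univ _, card_singleton y, by
      rw [singleton_subset_iff]; exact mem_biUnion.2 ⟨h y, mem_univ _, hyc⟩, fun i => ?_, ∅,
      empty_subset _, by simp, _, hW1, hW2, fun T hT hUT hTW E _ =>
        key {y} (by simpa using hyA) T hT hTW E (mem_union_right _ (hUT (mem_singleton_self y)))⟩
    by_cases hyi : y ∈ cell h t k i
    · have h1 : a k i ≠ 0 := fun h0 => by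
        rw [hp.empty k i h0] at hyi
        exact notMem_empty _ hyi
      exact (card_le_card inter_subset_left).trans (by rw [card_singleton]; omega)
    · rw [singleton_inter_of_notMem hyi]; simp

lemma Placed.conflict_le_of_out (hp : Placed m F h t a C) (hsym : ∀ k1 k2, m k1 k2 = m k2 k1)
    (hC : 1 ≤ C) {k j : Fin ℓ} (hkj : k ≠ j) (hjk : a j k = 0) {e : ℝ} (he0 : 0 ≤ e)
    (he : 0 < a k j → ((n : ℝ) + 1) ^ MM m * (4 / 5) ^ (cell h t k j).card ≤ e) :
    pr (F j) (fun A => ∃ X ∈ St h t a k, m k j < (A ∩ X).card) ≤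
      e + ∑ u ∈ range (MM m + 2), (wits F h t a k (MM m + 1) u).card *
        (C ^ (ℓ + 2) / ((n : ℝ) + 1) ^ (u + 1)) := by
  have hN0 : (0 : ℝ) < (n : ℝ) + 1 := by positivity
  have hC0 : 0 < C := by linarith
  have hm := hp.sum k j hkj
  obtain ⟨Y, hY⟩ : ∃ Y : Fin n → Prop, Y = fun y => y ∉ cell h t k j ∧ ∃ A ∈ F j, y ∈ A ∧
    (0 < a k j → (cell h t k j).card ≤ 8 * (A ∩ cell h t k j).card) := ⟨_, rfl⟩
  obtain ⟨Y₀, hY₀⟩ : ∃ Y₀, Y₀ = univ.filter (fun y => h y = k ∧ Y y) := ⟨_, rfl⟩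
  obtain ⟨Y₁, hY₁⟩ : ∃ Y₁, Y₁ = univ.filter (fun y => t y = k ∧ Y y) := ⟨_, rfl⟩
  have hC' : C ≤ C ^ (ℓ + 2) := le_self_pow₀ hC (by omega)
  have hpt : ∀ y ∈ Y₀ ∪ Y₁, pp (F j) y ≤ C / ((n : ℝ) + 1) ^ 2 := by
    intro y hy
    rw [le_div_iff₀ (by positivity)]
    have hyY : y ∉ cell h t k j ∧ (h y = k ∨ t y = k) := by
      rw [mem_union, hY₀, hY₁, mem_filter, mem_filter, hY] at hy
      tauto
    rw [mem_cell] at hyY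
    have hne := hp.ne y
    refine hp.far y j ?_ ?_
    · rintro rfl
      rcases hyY.2 with h1 | h1
      · exact hkj h1.symm
      · exact hyY.1 ⟨h1, rfl⟩
    · intro hj
      rcases hyY.2 with h1 | h1
      · have : y ∈ cell h t j k := mem_cell.2 ⟨hj.symm, h1⟩
        rw [hp.empty j k hjk] at this
        exact notMem_empty _ this
      · exact hkj (h1.symm.trans hj.symm)
  have h1 : pr (F j) (fun A => ∃ X ∈ St h t a k, m k j < (A ∩ X).card) ≤
      pr (F j) (fun A => 0 < a k j ∧ 8 * (A ∩ cell h t k j).card ≤ (cell h t k j).card) +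
      pr (F j) (fun A => ∃ y ∈ Y₀ ∪ Y₁, y ∈ A) := by
    refine pr_le_add fun A hA hX => ?_
    obtain ⟨X, hX, hlt⟩ := hX
    by_cases hd : 0 < a k j ∧ 8 * (A ∩ cell h t k j).card ≤ (cell h t k j).card
    · exact Or.inl hd
    right
    have h2 : ∃ y ∈ A ∩ X, y ∉ cell h t k j := by
      by_contra hcon
      push Not at hcon
      have h3 : A ∩ X ⊆ X ∩ cell h t k j := fun y hy =>
        mem_inter.2 ⟨(mem_inter.1 hy).2, hcon y hy⟩
      have := card_le_card h3
      have := (mem_St.1 hX).2 j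
      omega
    obtain ⟨y, hy, hyc⟩ := h2
    rw [mem_inter] at hy
    have hYy : Y y := by
      rw [hY]
      refine ⟨hyc, A, hA, hy.1, fun h0 => ?_⟩
      by_contra hcon
      exact hd ⟨h0, by omega⟩
    refine ⟨y, ?_, hy.1⟩
    rw [mem_union, hY₀, hY₁, mem_filter, mem_filter]
    rcases (mem_St.1 hX).1 y hy.2 with g | g
    · exact Or.inl ⟨mem_univ _, g, hYy⟩
    · exact Or.inr ⟨mem_univ _, g, hYy⟩
  have h2 : pr (F j) (fun A => 0 < a k j ∧ 8 * (A ∩ cell h t k j).card ≤ (cell h t k j).card) ≤ e := by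
    rcases Nat.eq_zero_or_pos (a k j) with h0 | h0
    · rw [pr_eq_zero (fun A _ hA => by omega)]
      exact he0
    · refine (pr_mono fun A _ hA => hA.2).trans ((hp.chernoff hsym ?_).trans (he h0))
      exact fun z hz => mem_inn.2 (mem_cell.1 hz).2
  have h3 : pr (F j) (fun A => ∃ y ∈ Y₀ ∪ Y₁, y ∈ A) ≤
      ((Y₀.card : ℝ) + Y₁.card) * (C / ((n : ℝ) + 1) ^ 2) := by
    refine (pr_exists_le (Y₀ ∪ Y₁) (fun y A => y ∈ A) fun A _ hA => hA).trans ?_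
    refine (sum_le_card_nsmul _ _ _ hpt).trans ?_
    rw [nsmul_eq_mul]
    refine mul_le_mul_of_nonneg_right ?_ (by positivity)
    exact_mod_cast card_union_le _ _
  have hwit : ∀ y, Y y → (h y = k → ∅ ∈ wits F h t a k (MM m + 1) 0) ∧
      (t y = k → {y} ∈ wits F h t a k (MM m + 1) 1) := by
    intro y hy
    rw [hY] at hy
    obtain ⟨hyc, A, hA, hyA, hd⟩ := hy
    exact hp.point_wits hkj hjk hA hd hyA hyc
  have h4 : (Y₁.card : ℝ) ≤ (wits F h t a k (MM m + 1) 1).card := by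
    refine Nat.cast_le.2 (card_le_card_of_injOn (fun y => {y}) (fun y hy => ?_) ?_)
    · rw [hY₁, mem_coe, mem_filter] at hy
      exact (hwit y hy.2.2).2 hy.2.1
    · exact fun x _ y _ hxy => singleton_injective hxy
  have h5 : (Y₀.card : ℝ) ≤ (wits F h t a k (MM m + 1) 0).card * ((n : ℝ) + 1) := by
    rcases Y₀.eq_empty_or_nonempty with h0 | ⟨y, hy⟩
    · rw [h0, card_empty, Nat.cast_zero]
      exact mul_nonneg (Nat.cast_nonneg _) hN0.le
    · rw [hY₀, mem_filter] at hy
      have g1 : (1 : ℝ) ≤ (wits F h t a k (MM m + 1) 0).card := by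
        exact_mod_cast card_pos.2 ⟨_, (hwit y hy.2.2).1 hy.2.1⟩
      have g2 : (Y₀.card : ℝ) ≤ n := by
        have := card_le_univ Y₀
        rw [Fintype.card_fin] at this
        exact_mod_cast this
      nlinarith
  have h6 : ∑ u ∈ range 2, (wits F h t a k (MM m + 1) u).card *
        (C ^ (ℓ + 2) / ((n : ℝ) + 1) ^ (u + 1)) ≤
      ∑ u ∈ range (MM m + 2), (wits F h t a k (MM m + 1) u).card *
        (C ^ (ℓ + 2) / ((n : ℝ) + 1) ^ (u + 1)) :=
    sum_le_sum_of_subset_of_nonneg (range_subset_range.2 (by omega))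
      fun _ _ _ => mul_nonneg (Nat.cast_nonneg _) (by positivity)
  rw [sum_range_succ, sum_range_succ, range_zero, sum_empty, zero_add] at h6
  have h7 : ((Y₀.card : ℝ) + Y₁.card) * (C / ((n : ℝ) + 1) ^ 2) ≤
      (wits F h t a k (MM m + 1) 0).card * (C ^ (ℓ + 2) / ((n : ℝ) + 1) ^ (0 + 1)) +
      (wits F h t a k (MM m + 1) 1).card * (C ^ (ℓ + 2) / ((n : ℝ) + 1) ^ (1 + 1)) := by
    have g0 : C / ((n : ℝ) + 1) ^ 2 ≤ C ^ (ℓ + 2) / ((n : ℝ) + 1) ^ 2 := by gcongr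
    have g1 : ((Y₀.card : ℝ) + Y₁.card) ≤ (wits F h t a k (MM m + 1) 0).card * ((n : ℝ) + 1) +
      (wits F h t a k (MM m + 1) 1).card := add_le_add h5 h4
    refine (mul_le_mul g1 g0 (by positivity) (add_nonneg (mul_nonneg (Nat.cast_nonneg _) hN0.le)
      (Nat.cast_nonneg _))).trans (le_of_eq ?_)
    field_simp
    ring
  linarith

end

section
variable {n ℓ : ℕ} {m : Fin ℓ → Fin ℓ → ℕ} {F : Fin ℓ → Finset (Finset (Fin n))}
  {h t : Fin n → Fin ℓ} {C : ℝ} {a : Fin ℓ → Fin ℓ → ℕ}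

lemma sum_wits_le (hF : Extremal m F) {k : Fin ℓ} {K Q : ℝ} (hQ : 0 ≤ Q)
    (hw : ∀ u, ((wits F h t a k (MM m + 1) u).card : ℝ) * (F k).card ≤
      K * (((n : ℝ) + 1) ^ u * (St h t a k \ F k).card)) :
    ∑ u ∈ range (MM m + 2), (wits F h t a k (MM m + 1) u).card * (Q / ((n : ℝ) + 1) ^ (u + 1)) ≤
      (MM m + 2) * (K * Q) / ((n : ℝ) + 1) * ((St h t a k \ F k).card / (F k).card) := by
  have hN0 : (0 : ℝ) < (n : ℝ) + 1 := by positivity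
  have hf : (0 : ℝ) < (F k).card := by exact_mod_cast hF.card_pos k
  have h1 : ∀ u ∈ range (MM m + 2), (wits F h t a k (MM m + 1) u).card * (Q / ((n : ℝ) + 1) ^ (u + 1))
      ≤ K * Q / ((n : ℝ) + 1) * ((St h t a k \ F k).card / (F k).card) := by
    intro u _
    have h2 := (le_div_iff₀ hf).2 (hw u)
    refine (mul_le_mul_of_nonneg_right h2 (by positivity)).trans (le_of_eq ?_)
    rw [pow_succ]
    field_simp
  refine (sum_le_card_nsmul _ _ _ h1).trans (le_of_eq ?_)
  rw [nsmul_eq_mul, card_range]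
  push_cast
  ring

lemma Placed.conflict_le (hp : Placed m F h t a C) (hsym : ∀ k1 k2, m k1 k2 = m k2 k1)
    (hC : 1 ≤ C) {k j : Fin ℓ} (hkj : k ≠ j) {e : ℝ} (he0 : 0 ≤ e)
    (he : 0 < a k j → ((n : ℝ) + 1) ^ MM m * (4 / 5) ^ (cell h t k j).card ≤ e) :
    pr (F j) (fun A => ∃ X ∈ St h t a k, m k j < (A ∩ X).card) ≤
      e + ∑ u ∈ range (MM m + 2), (wits F h t a k (MM m + 1) u).card *
        (C ^ (ℓ + 2) / ((n : ℝ) + 1) ^ (u + 1)) := by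
  rcases eq_or_ne (a j k) 0 with hjk | hjk
  · exact hp.conflict_le_of_out hsym hC hkj hjk he0 he
  · exact (hp.conflict_le_of_in hsym hC hkj hjk).trans (le_add_of_nonneg_left he0)

lemma exists_St_subset {ℓ : ℕ} (m : Fin ℓ → Fin ℓ → ℕ) (hsym : ∀ k1 k2, m k1 k2 = m k2 k1)
    {C : ℝ} (hC : 1 ≤ C) :
    ∀ᶠ n : ℕ in atTop, ∀ (F : Fin ℓ → Finset (Finset (Fin n))) (h t a),
      Placed m F h t a C → ∀ k, St h t a k ⊆ F k := by
  have hC0 : 0 < C := by linarith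
  obtain ⟨K, hK⟩ : ∃ K : ℝ, K = C * 2 ^ (MM m + 1) * 2 ^ MM m *
    ((32 * C) ^ MM m * ((MM m).factorial : ℝ)) ^ ℓ := ⟨_, rfl⟩
  have hK0 : 0 < K := by
    have : (0 : ℝ) < (MM m).factorial := by exact_mod_cast Nat.factorial_pos _
    rw [hK]; positivity
  obtain ⟨δ, hδ⟩ : ∃ δ : ℝ, δ = 1 / (4 * ((ℓ : ℝ) + 1) * (1 + C)) := ⟨_, rfl⟩
  have hδ0 : 0 < δ := by rw [hδ]; positivity
  obtain ⟨D, hD⟩ : ∃ D : ℝ, D = (MM m + 2) * (K * C ^ (ℓ + 2)) := ⟨_, rfl⟩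
  filter_upwards [ev_le (32 * C * MM m), ev_le (D / δ),
    exp_small (2 * MM m) (c := 1 / C) (ε := δ / K) (by positivity) (by positivity)]
    with n hN hND hexp F h t a hp k
  by_contra hcon
  rw [Finset.not_subset] at hcon
  obtain ⟨X, hX, hXF⟩ := hcon
  have hN0 : (0 : ℝ) < (n : ℝ) + 1 := by positivity
  have hN1 : (1 : ℝ) ≤ (n : ℝ) + 1 := by linarith [Nat.cast_nonneg (α := ℝ) n]
  have hf : (0 : ℝ) < (F k).card := by exact_mod_cast hp.ext.card_pos k
  have hw : ∀ u, ((wits F h t a k (MM m + 1) u).card : ℝ) * (F k).card ≤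
      K * (((n : ℝ) + 1) ^ u * (St h t a k \ F k).card) := fun u => by
    rw [hK]
    exact hp.toOriented.card_wits_le hC hN k (MM m + 1) u
  have hsum := sum_wits_le hp.ext (by positivity : 0 ≤ C ^ (ℓ + 2)) hw
  rw [← hD] at hsum
  obtain ⟨u, hu, hpos⟩ := hp.toOriented.exists_wits hsym hX hXF
  obtain ⟨r, hr⟩ : ∃ r : ℝ, r = (St h t a k \ F k).card / (F k).card := ⟨_, rfl⟩
  rw [← hr] at hsum
  have hrf : ((St h t a k \ F k).card : ℝ) = r * (F k).card := by rw [hr, div_mul_cancel₀ _ hf.ne']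
  have hr1 : 1 ≤ K * ((n : ℝ) + 1) ^ MM m * r := by
    have h1 : (1 : ℝ) ≤ (wits F h t a k (MM m + 1) u).card := by exact_mod_cast hpos
    have h2 := (mul_le_mul_of_nonneg_right h1 hf.le).trans (hw u)
    rw [hrf] at h2
    have h3 : 1 ≤ K * ((n : ℝ) + 1) ^ u * r := by
      refine le_of_mul_le_mul_right ?_ hf
      linarith
    have hr0 : 0 ≤ r := hr ▸ div_nonneg (Nat.cast_nonneg _) (Nat.cast_nonneg _)
    have h4 := pow_le_pow_right₀ hN1 hu
    exact h3.trans (mul_le_mul_of_nonneg_right (mul_le_mul_of_nonneg_left h4 hK0.le) hr0)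
  have hr0 : 0 < r := by
    by_contra hr0
    have : K * ((n : ℝ) + 1) ^ MM m * r ≤ 0 :=
      mul_nonpos_of_nonneg_of_nonpos (by positivity) (not_lt.1 hr0)
    linarith
  have hrC : r ≤ C := by
    have h1 : ((St h t a k \ F k).card : ℝ) ≤ (St h t a k).card := by
      exact_mod_cast card_le_card sdiff_subset
    have h2 := h1.trans ((card_St_le k).trans (hp.lo k))
    rw [hrf] at h2
    exact le_of_mul_le_mul_right h2 hf
  have hconf : ∀ j ∈ univ.erase k, pr (F j) (fun A => ∃ X ∈ St h t a k, m k j < (A ∩ X).card) ≤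
      2 * δ * r := by
    intro j hj
    have h1 := hp.conflict_le hsym hC (ne_of_mem_erase hj).symm (e := δ * r) (by positivity) ?_
    · refine (h1.trans (add_le_add_right hsum _)).trans ?_
      have h2 : D / ((n : ℝ) + 1) ≤ δ := by
        rw [div_le_iff₀ hN0]
        rw [div_le_iff₀ hδ0] at hND
        linarith
      have := mul_le_mul_of_nonneg_right h2 hr0.le
      linarith
    · intro hkj
      have hc : 1 / C * ((n : ℝ) + 1) ≤ (cell h t k j).card := by
        rw [one_div, inv_mul_le_iff₀ hC0]
        exact hp.cells k j hkj
      have h2 := hexp _ hc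
      rw [le_div_iff₀ hK0] at h2
      have h3 : 0 ≤ ((n : ℝ) + 1) ^ MM m * (4 / 5) ^ (cell h t k j).card := by positivity
      have h4 := mul_le_mul_of_nonneg_left hr1 h3
      have h5 := mul_le_mul_of_nonneg_right h2 hr0.le
      calc _ = _ := (mul_one _).symm
        _ ≤ _ := h4
        _ = ((n : ℝ) + 1) ^ (2 * MM m) * (4 / 5) ^ (cell h t k j).card * K * r := by
          rw [two_mul, pow_add]; ring
        _ ≤ _ := h5
  have hsum2 := sum_le_card_nsmul _ _ _ hconf
  rw [nsmul_eq_mul] at hsum2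
  have hcard : ((univ.erase k).card : ℝ) ≤ ℓ + 1 := by
    have := card_le_univ (univ.erase k)
    rw [Fintype.card_fin] at this
    have : ((univ.erase k).card : ℝ) ≤ ℓ := by exact_mod_cast this
    linarith
  have hfin : ∑ j ∈ univ.erase k, pr (F j) (fun A => ∃ X ∈ St h t a k, m k j < (A ∩ X).card) ≤
      r / (2 * (1 + C)) := by
    refine hsum2.trans ((mul_le_mul_of_nonneg_right hcard (by positivity)).trans (le_of_eq ?_))
    rw [hδ]
    field_simp
    ring
  have hadj := hp.ext.adjoin hsym k (St h t a k)
  rw [hrf] at hadj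
  have h6 : (1 + r) * (1 - ∑ j ∈ univ.erase k,
      pr (F j) (fun A => ∃ X ∈ St h t a k, m k j < (A ∩ X).card)) ≤ 1 := by
    refine le_of_mul_le_mul_right ?_ hf
    linarith
  have h7 := mul_le_mul_of_nonneg_left hfin (by positivity : 0 ≤ 1 + r)
  have h8 : (1 + r) * (r / (2 * (1 + C))) ≤ r / 2 := by
    have : (1 + r) * (r / (2 * (1 + C))) ≤ (1 + C) * (r / (2 * (1 + C))) := by gcongr
    refine this.trans (le_of_eq ?_)
    field_simp
  linarith

end

section
variable {n ℓ : ℕ} {m : Fin ℓ → Fin ℓ → ℕ} {F : Fin ℓ → Finset (Finset (Fin n))}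
  {h t : Fin n → Fin ℓ} {C : ℝ} {a : Fin ℓ → Fin ℓ → ℕ}

lemma Placed.eq_of_pos (hp : Placed m F h t a C) {k j : Fin ℓ} (ha : 0 < a k j) :
    k ≠ j ∧ a k j = m k j := by
  have hkj : k ≠ j := by
    rintro rfl
    rw [hp.diag k] at ha
    exact lt_irrefl 0 ha
  have h1 := hp.sum k j hkj
  rcases hp.orient k j with h2 | h2 <;> exact ⟨hkj, by omega⟩

lemma Placed.not_St_le (hp : Placed m F h t a C) (hC : 0 ≤ C) (k : Fin ℓ) :
    pr (F k) (· ∉ St h t a k) ≤ C / ((n : ℝ) + 1) := by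
  have hN0 : (0 : ℝ) < (n : ℝ) + 1 := by positivity
  refine (pr_mono fun A hA hnot => ?_).trans (exists_alien_le (F := F) (h := h) (t := t) k
    (div_nonneg hC hN0.le) fun y hy hy' => ?_)
  · by_contra hcon
    push Not at hcon
    refine hnot (mem_St.2 ⟨hcon, fun j => ?_⟩)
    rcases Nat.eq_zero_or_pos (a k j) with h0 | h0
    · rw [hp.empty k j h0]; simp
    · obtain ⟨hkj, ham⟩ := hp.eq_of_pos h0
      rw [ham]
      exact (card_le_card (inter_subset_inter le_rfl fun z hz => mem_inn.2 (mem_cell.1 hz).2)).trans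
        (hp.trace k j hkj A hA)
  · rw [div_div, le_div_iff₀ (by positivity), ← pow_two]
    exact hp.far y k hy hy'

lemma Extremal.card_le_two_mul_avoid (hF : Extremal m F) (hsym : ∀ k1 k2, m k1 k2 = m k2 k1)
    (k : Fin ℓ) (y : Fin n) : ((F k).card : ℝ) ≤ 2 * ((F k).filter (y ∉ ·)).card := by
  rw [card_avoid (hF.card_pos k)]
  have h1 := hF.pp_le_half hsym k y
  have h2 : (0 : ℝ) ≤ (F k).card := Nat.cast_nonneg _
  nlinarith

/-- Members of `St h t a k` avoiding `y` with the cell over `(k, j)` not saturated. -/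
lemma card_unsaturated_ge (k j : Fin ℓ) (y : Fin n) :
    a k j * ((St h t a k).filter (y ∉ ·)).card ≤ ((cell h t k j).card + a k j) *
      ((St h t a k).filter (fun X => y ∉ X ∧ (X ∩ cell h t k j).card + 1 ≤ a k j)).card := by
  obtain ⟨Z, hZ⟩ : ∃ Z, Z = cell h t k j := ⟨_, rfl⟩
  obtain ⟨S₁, hS₁⟩ : ∃ S₁, S₁ = (St h t a k).filter
    (fun X => y ∉ X ∧ (X ∩ cell h t k j).card + 1 ≤ a k j) := ⟨_, rfl⟩
  obtain ⟨S₂, hS₂⟩ : ∃ S₂, S₂ = (St h t a k).filter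
    (fun X => y ∉ X ∧ (X ∩ cell h t k j).card = a k j) := ⟨_, rfl⟩
  have h1 : ((St h t a k).filter (y ∉ ·)).card ≤ S₁.card + S₂.card := by
    refine (card_le_card fun X hX => ?_).trans (card_union_le _ _)
    rw [mem_filter] at hX
    have := (mem_St.1 hX.1).2 j
    rw [mem_union, hS₁, hS₂, mem_filter, mem_filter]
    rcases this.lt_or_eq with g | g
    · exact Or.inl ⟨hX.1, hX.2, g⟩
    · exact Or.inr ⟨hX.1, hX.2, g⟩
  have h2 : a k j * S₂.card ≤ Z.card * S₁.card := by
    have e1 : (S₂.sigma fun X => X ∩ Z).card = S₂.card * a k j := by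
      rw [card_sigma, sum_const_nat]
      intro X hX
      rw [hS₂, mem_filter] at hX
      rw [hZ]
      exact hX.2.2
    rw [mul_comm, ← e1, ← card_product]
    refine card_le_card_of_injOn (fun p => (p.2, p.1.erase p.2)) ?_ ?_
    · rintro ⟨X, z⟩ hp
      rw [mem_coe, mem_sigma] at hp
      obtain ⟨hX, hz⟩ := hp
      simp only [mem_inter] at hz
      rw [hS₂, mem_filter] at hX
      obtain ⟨hX, hyX, hc⟩ := hX
      rw [mem_coe, mem_product]
      refine ⟨hz.2, ?_⟩
      rw [hS₁, mem_filter, mem_St]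
      rw [mem_St] at hX
      refine ⟨⟨fun x hx => hX.1 x (mem_of_mem_erase hx), fun i =>
        (card_le_card (inter_subset_inter (erase_subset _ _) le_rfl)).trans (hX.2 i)⟩,
        fun hy => hyX (mem_of_mem_erase hy), ?_⟩
      have e2 : (X.erase z) ∩ cell h t k j = (X ∩ cell h t k j).erase z := by
        rw [erase_inter]
      have hz' : z ∈ X ∩ cell h t k j := mem_inter.2 ⟨hz.1, hZ ▸ hz.2⟩
      change ((X.erase z) ∩ cell h t k j).card + 1 ≤ a k j
      rw [e2, card_erase_of_mem hz']
      have h3 := card_pos.2 ⟨z, hz'⟩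
      have h4 : (X ∩ cell h t k j).card = a k j := hc
      omega
    · rintro ⟨X, z⟩ hp ⟨X', z'⟩ hp' heq
      rw [mem_coe, mem_sigma, mem_inter] at hp hp'
      simp only [Prod.mk.injEq] at heq
      obtain ⟨rfl, heq⟩ := heq
      have hzX : z ∈ X := hp.2.1
      have hzX' : z ∈ X' := hp'.2.1
      have : X = X' := by rw [← insert_erase hzX, ← insert_erase hzX', heq]
      rw [this]
  rw [← hS₁, ← hZ]
  calc _ ≤ a k j * (S₁.card + S₂.card) := Nat.mul_le_mul_left _ h1
    _ ≤ _ := by rw [mul_add, add_mul]; omega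

/-- A set meeting the cell over `(k, j)` in at least `a k j` points meets `St h t a k` inside it. -/
lemma Placed.inter_subset_cell (hp : Placed m F h t a C) {k j : Fin ℓ} (ha : 0 < a k j)
    (hS : St h t a k ⊆ F k) {B X : Finset (Fin n)} (hB : B ∈ F j)
    (hBc : a k j ≤ (B ∩ cell h t k j).card) (hX : X ∈ St h t a k) : X ∩ B ⊆ X ∩ cell h t k j := by
  intro z hz
  rw [mem_inter] at hz
  by_contra hcon
  have hzc : z ∉ cell h t k j := fun hz' => hcon (mem_inter.2 ⟨hz.1, hz'⟩)
  obtain ⟨hkj, ham⟩ := hp.eq_of_pos ha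
  obtain ⟨U, hU, hUc⟩ := exists_subset_card_eq hBc
  have hzU : z ∉ U := fun hz' => hzc (mem_inter.1 (hU hz')).2
  have hmem : insert z U ∈ St h t a k := by
    rw [mem_St] at hX ⊢
    refine ⟨fun x hx => ?_, fun i => ?_⟩
    · rcases mem_insert.1 hx with rfl | hx
      · exact hX.1 _ hz.1
      · exact Or.inr (mem_cell.1 (mem_inter.1 (hU hx)).2).1
    · by_cases hij : i = j
      · rw [hij, insert_inter_of_notMem hzc]
        exact (card_le_card inter_subset_left).trans hUc.le
      · have hUi : U ∩ cell h t k i = ∅ := by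
          rw [← disjoint_iff_inter_eq_empty]
          exact (disjoint_cell k j i (Ne.symm hij)).mono_left (hU.trans inter_subset_right)
        refine (card_le_card (t := X ∩ cell h t k i) fun x hx => ?_).trans (hX.2 i)
        rw [mem_inter, mem_insert] at hx
        rcases hx.1 with rfl | hxU
        · exact mem_inter.2 ⟨hz.1, hx.2⟩
        · have : x ∈ U ∩ cell h t k i := mem_inter.2 ⟨hxU, hx.2⟩
          rw [hUi] at this
          exact absurd this (notMem_empty _)
  have h1 := hp.ext.1 k j hkj _ (hS hmem) B hB
  have h2 : insert z U ⊆ insert z U ∩ B :=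
    subset_inter le_rfl (insert_subset hz.2 (hU.trans inter_subset_left))
  have h3 := card_le_card h2
  rw [card_insert_of_notMem hzU] at h3
  omega

/-- Inserting a point into the members over the arc `(k, j)` does not increase the product. -/
lemma Placed.insertion_arc (hp : Placed m F h t a C) (hsym : ∀ k1 k2, m k1 k2 = m k2 k1)
    (hC : 0 ≤ C) (hN : 2 * C ≤ (n : ℝ) + 1) {k j : Fin ℓ} (ha : 0 < a k j)
    (h8 : 8 * a k j ≤ (cell h t k j).card) (hS : St h t a k ⊆ F k)
    (hexp : ((n : ℝ) + 1) ^ (MM m + 2) * (4 / 5) ^ (cell h t k j).card ≤ 1) (y : Fin n) :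
    (∏ i, (1 - pp (F i) y)) * ((1 + (1 - 2 * C / ((n : ℝ) + 1)) *
      (a k j / ((cell h t k j).card + a k j))) * (1 + (1 - 2 / ((n : ℝ) + 1) ^ 2))) ≤ 1 := by
  have hN0 : (0 : ℝ) < (n : ℝ) + 1 := by positivity
  obtain ⟨hkj, ham⟩ := hp.eq_of_pos ha
  have ha' : (0 : ℝ) < a k j := by exact_mod_cast ha
  have hn1 : (1 : ℝ) ≤ n := by
    have : 0 < n := y.pos
    exact_mod_cast this
  have h2C : 2 * C / ((n : ℝ) + 1) ≤ 1 := by rw [div_le_iff₀ hN0]; linarith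
  refine hp.ext.insertion hsym y hkj
    (𝒞 := (St h t a k).filter (fun X => y ∉ X ∧ (X ∩ cell h t k j).card + 1 ≤ a k j))
    (ℬ := (F j).filter (fun B => y ∉ B ∧ a k j ≤ (B ∩ cell h t k j).card))
    (fun X hX => ?_) (fun B hB => ?_) (fun X hX B hB => ?_)
    (mul_nonneg (by linarith) (by positivity)) ?_ ?_ ?_
  · rw [mem_filter] at hX
    exact ⟨hS hX.1, hX.2.1⟩
  · rw [mem_filter] at hB
    exact ⟨hB.1, hB.2.1⟩
  · rw [mem_filter] at hX hB
    have h1 := card_le_card (hp.inter_subset_cell ha hS hB.1 hB.2.2 hX.1)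
    omega
  · rw [sub_nonneg, div_le_one (by positivity)]
    nlinarith
  · have h1 := card_unsaturated_ge (h := h) (t := t) (a := a) k j y
    have h1' : (a k j : ℝ) * ((St h t a k).filter (y ∉ ·)).card ≤ ((cell h t k j).card + a k j) *
      ((St h t a k).filter (fun X => y ∉ X ∧ (X ∩ cell h t k j).card + 1 ≤ a k j)).card := by
      exact_mod_cast h1
    have h2 : (1 - 2 * C / ((n : ℝ) + 1)) * ((F k).filter (y ∉ ·)).card ≤
        ((St h t a k).filter (y ∉ ·)).card := by
      have g1 : ((F k).filter (y ∉ ·)).card ≤ ((St h t a k).filter (y ∉ ·)).card +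
          ((F k).filter (· ∉ St h t a k)).card := by
        refine (card_le_card fun X hX => ?_).trans (card_union_le _ _)
        rw [mem_filter] at hX
        rw [mem_union, mem_filter, mem_filter]
        tauto
      have g1' : (((F k).filter (y ∉ ·)).card : ℝ) ≤ ((St h t a k).filter (y ∉ ·)).card +
          ((F k).filter (· ∉ St h t a k)).card := by exact_mod_cast g1
      have g2 : (((F k).filter (· ∉ St h t a k)).card : ℝ) ≤ C / ((n : ℝ) + 1) * (F k).card := by
        rw [← pr_mul_card (P := (· ∉ St h t a k))]
        exact mul_le_mul_of_nonneg_right (hp.not_St_le hC k) (Nat.cast_nonneg _)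
      have g3 := mul_le_mul_of_nonneg_left (hp.ext.card_le_two_mul_avoid hsym k y)
        (div_nonneg hC hN0.le)
      have g4 : 2 * C / ((n : ℝ) + 1) = 2 * (C / ((n : ℝ) + 1)) := by ring
      rw [g4]
      linarith
    have h3 : (a k j : ℝ) / ((cell h t k j).card + a k j) * ((St h t a k).filter (y ∉ ·)).card ≤
        ((St h t a k).filter (fun X => y ∉ X ∧ (X ∩ cell h t k j).card + 1 ≤ a k j)).card := by
      rw [div_mul_eq_mul_div, div_le_iff₀ (by positivity)]
      linarith
    refine le_trans (le_of_eq (by ring)) ((mul_le_mul_of_nonneg_left h2 (by positivity)).trans h3)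
  · have hcell : cell h t k j ⊆ inn h j := fun z hz => mem_inn.2 (mem_cell.1 hz).2
    have g1 : ((F j).filter (y ∉ ·)).card ≤
        ((F j).filter (fun B => y ∉ B ∧ a k j ≤ (B ∩ cell h t k j).card)).card +
          ((F j).filter (fun A => 8 * (A ∩ cell h t k j).card ≤ (cell h t k j).card)).card := by
      refine (card_le_card fun B hB => ?_).trans (card_union_le _ _)
      rw [mem_filter] at hB
      rw [mem_union, mem_filter, mem_filter]
      by_cases hc : a k j ≤ (B ∩ cell h t k j).card
      · exact Or.inl ⟨hB.1, hB.2, hc⟩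
      · exact Or.inr ⟨hB.1, by omega⟩
    have g1' : (((F j).filter (y ∉ ·)).card : ℝ) ≤
        ((F j).filter (fun B => y ∉ B ∧ a k j ≤ (B ∩ cell h t k j).card)).card +
          ((F j).filter (fun A => 8 * (A ∩ cell h t k j).card ≤ (cell h t k j).card)).card := by
      exact_mod_cast g1
    have g2 : (((F j).filter (fun A => 8 * (A ∩ cell h t k j).card ≤ (cell h t k j).card)).card : ℝ) ≤
        1 / ((n : ℝ) + 1) ^ 2 * (F j).card := by
      rw [← pr_mul_card (P := fun A => 8 * (A ∩ cell h t k j).card ≤ (cell h t k j).card)]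
      refine mul_le_mul_of_nonneg_right ((hp.chernoff hsym hcell).trans ?_) (Nat.cast_nonneg _)
      rw [le_div_iff₀ (by positivity)]
      refine le_trans (le_of_eq ?_) hexp
      rw [pow_add]; ring
    have g3 := mul_le_mul_of_nonneg_left (hp.ext.card_le_two_mul_avoid hsym j y)
      (by positivity : (0 : ℝ) ≤ 1 / ((n : ℝ) + 1) ^ 2)
    have g4 : 2 / ((n : ℝ) + 1) ^ 2 = 2 * (1 / ((n : ℝ) + 1) ^ 2) := by ring
    rw [g4]
    linarith

end

section
variable {n ℓ : ℕ} {m : Fin ℓ → Fin ℓ → ℕ} {F : Fin ℓ → Finset (Finset (Fin n))}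
  {h t : Fin n → Fin ℓ} {C : ℝ} {a : Fin ℓ → Fin ℓ → ℕ}

lemma le_add_of_prod_le_one {P p q u v c : ℝ} (hP : (1 - q) * (1 - p) * (1 - u) ≤ P)
    (hq : q ≤ 1 / 2) (hp0 : 0 ≤ p) (hp1 : p ≤ 1) (hu0 : 0 ≤ u) (hu1 : u ≤ 1) (hv0 : 0 ≤ v)
    (hv1 : v ≤ 1) (hc0 : 0 ≤ c) (hc1 : c ≤ 1) (hle : P * ((1 + c) * (1 + (1 - 2 * v))) ≤ 1) :
    c ≤ p + p * c + 2 * (u + v) := by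
  have h1 : 1 / 2 * ((1 - p) * (1 - u)) ≤ P := by
    refine le_trans ?_ hP
    rw [mul_assoc]
    exact mul_le_mul_of_nonneg_right (by linarith) (mul_nonneg (by linarith) (by linarith))
  have h2 := (mul_le_mul_of_nonneg_right h1
    (mul_nonneg (by linarith) (by linarith) : 0 ≤ (1 + c) * (1 + (1 - 2 * v)))).trans hle
  obtain ⟨X, hX⟩ : ∃ X, X = (1 - p) * (1 + c) := ⟨_, rfl⟩
  have hX0 : 0 ≤ X := by rw [hX]; exact mul_nonneg (by linarith) (by linarith)
  have hX2 : X ≤ 2 := by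
    rw [hX]
    nlinarith
  have h3 : X * ((1 - u) * (1 - v)) ≤ 1 := by
    rw [hX]
    refine le_trans (le_of_eq (by ring)) h2
  have h4 : X * (1 - (u + v)) ≤ X * ((1 - u) * (1 - v)) :=
    mul_le_mul_of_nonneg_left (by nlinarith) hX0
  have h5 := mul_le_mul_of_nonneg_right hX2 (by linarith : 0 ≤ u + v)
  have h6 : X = 1 + c - p - p * c := by rw [hX]; ring
  linarith

lemma Placed.prod_one_sub_ge (hp : Placed m F h t a C) (hC : 0 ≤ C) (y : Fin n) :
    (1 - pp (F (h y)) y) * (1 - pp (F (t y)) y) * (1 - ℓ * C / ((n : ℝ) + 1) ^ 2) ≤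
      ∏ i, (1 - pp (F i) y) := by
  have hN0 : (0 : ℝ) < (n : ℝ) + 1 := by positivity
  have hle : ∀ i, pp (F i) y ≤ 1 := fun i => pr_le_one
  have hth : t y ∈ univ.erase (h y) := mem_erase.2 ⟨(hp.ne y).symm, mem_univ _⟩
  rw [← mul_prod_erase univ _ (mem_univ (h y)), ← mul_prod_erase _ _ hth, ← mul_assoc]
  refine mul_le_mul_of_nonneg_left ?_ (mul_nonneg (by linarith [hle (h y)]) (by linarith [hle (t y)]))
  refine le_trans ?_ (one_sub_sum_le_prod _ _ (fun i _ => pp_nonneg _ _) fun i _ => hle i)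
  have h1 : ∑ i ∈ (univ.erase (h y)).erase (t y), pp (F i) y ≤
      ((univ.erase (h y)).erase (t y)).card • (C / ((n : ℝ) + 1) ^ 2) := by
    refine sum_le_card_nsmul _ _ _ fun i hi => ?_
    rw [mem_erase, mem_erase] at hi
    rw [le_div_iff₀ (by positivity)]
    exact hp.far y i hi.2.1 hi.1
  have h2 : (((univ.erase (h y)).erase (t y)).card : ℝ) ≤ ℓ := by
    have := card_le_univ ((univ.erase (h y)).erase (t y))
    rw [Fintype.card_fin] at this
    exact_mod_cast this
  rw [nsmul_eq_mul] at h1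
  have h3 := mul_le_mul_of_nonneg_right h2 (by positivity : 0 ≤ C / ((n : ℝ) + 1) ^ 2)
  have h4 : ℓ * C / ((n : ℝ) + 1) ^ 2 = ℓ * (C / ((n : ℝ) + 1) ^ 2) := by ring
  linarith

lemma weight_ge {s b N C M : ℝ} (hN : 0 < N) (hC : 0 ≤ C) (hb : 0 ≤ b)
    (hbM : b ≤ M) (hs : N ≤ C * s) (hs0 : 0 < s) :
    b / s ≤ (1 - 2 * C / N) * (b / (s + b)) + (M ^ 2 * C ^ 2 + 2 * C ^ 2 * M) / N ^ 2 := by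
  have hi : 1 / s ≤ C / N := by
    rw [div_le_div_iff₀ hs0 hN]
    linarith
  have h1 : b / s ≤ M * (C / N) := by
    rw [div_eq_mul_one_div]
    exact mul_le_mul hbM hi (by positivity) (hb.trans hbM)
  have h0 : 0 ≤ b / s := by positivity
  have h2 : b / (s + b) ≤ b / s := by gcongr; linarith
  have h3 : b / s - b / (s + b) ≤ (b / s) ^ 2 := by
    have e : b / s - b / (s + b) = (b / s) * (b / (s + b)) := by
      field_simp
      ring
    rw [e, pow_two]
    exact mul_le_mul_of_nonneg_left h2 h0
  have h4 : (b / s) ^ 2 ≤ (M * (C / N)) ^ 2 := pow_le_pow_left₀ h0 h1 2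
  have h5 := mul_le_mul_of_nonneg_left (h2.trans h1) (by positivity : 0 ≤ 2 * C / N)
  have e1 : (M ^ 2 * C ^ 2 + 2 * C ^ 2 * M) / N ^ 2 = (M * (C / N)) ^ 2 + 2 * C / N * (M * (C / N)) := by
    field_simp
  rw [e1]
  linarith

lemma Placed.pp_arc_ge (hp : Placed m F h t a C) (hsym : ∀ k1 k2, m k1 k2 = m k2 k1)
    (hC : 0 ≤ C) (hN : 2 * C ≤ (n : ℝ) + 1) (hℓ : ℓ * C ≤ (n : ℝ) + 1) {k j : Fin ℓ} (ha : 0 < a k j)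
    (h8 : 8 * a k j ≤ (cell h t k j).card) (hS : St h t a k ⊆ F k)
    (hexp : ((n : ℝ) + 1) ^ (MM m + 2) * (4 / 5) ^ (cell h t k j).card ≤ 1) (y : Fin n) :
    (a k j : ℝ) / (cell h t k j).card ≤ pp (F (t y)) y + (MM m * C ^ 2 + 2 * (ℓ * C + 1) +
      ((MM m : ℝ) ^ 2 * C ^ 2 + 2 * C ^ 2 * MM m)) / ((n : ℝ) + 1) ^ 2 := by
  have hN0 : (0 : ℝ) < (n : ℝ) + 1 := by positivity
  have hN1 : (1 : ℝ) ≤ (n : ℝ) + 1 := by linarith [Nat.cast_nonneg (α := ℝ) n]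
  have hN2 : (n : ℝ) + 1 ≤ ((n : ℝ) + 1) ^ 2 := by nlinarith
  have ha' : (0 : ℝ) < a k j := by exact_mod_cast ha
  have hs0 : (0 : ℝ) < (cell h t k j).card := by
    have : 0 < (cell h t k j).card := by omega
    exact_mod_cast this
  have haM : (a k j : ℝ) ≤ MM m := by
    rw [(hp.eq_of_pos ha).2]
    exact_mod_cast le_MM m k j
  have h1 := hp.insertion_arc hsym hC hN ha h8 hS hexp y
  have h2 := weight_ge hN0 hC ha'.le haM (hp.cells k j ha) hs0
  obtain ⟨c, hc⟩ : ∃ c, c = (1 - 2 * C / ((n : ℝ) + 1)) *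
    ((a k j : ℝ) / ((cell h t k j).card + a k j)) := ⟨_, rfl⟩
  rw [← hc] at h1 h2
  have hCN : 2 * C / ((n : ℝ) + 1) ≤ 1 := by rw [div_le_iff₀ hN0]; linarith
  have hCN0 : 0 ≤ 2 * C / ((n : ℝ) + 1) := by positivity
  have hq0 : 0 ≤ (a k j : ℝ) / ((cell h t k j).card + a k j) := by positivity
  have hq1 : (a k j : ℝ) / ((cell h t k j).card + a k j) ≤ 1 := by
    rw [div_le_one (by positivity)]; linarith
  have hc0 : 0 ≤ c := by rw [hc]; exact mul_nonneg (by linarith) hq0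
  have hcq : c ≤ (a k j : ℝ) / ((cell h t k j).card + a k j) := by
    rw [hc]
    exact mul_le_of_le_one_left hq0 (by linarith)
  have h3 := le_add_of_prod_le_one (v := 1 / ((n : ℝ) + 1) ^ 2) (hp.prod_one_sub_ge hC y)
    (hp.ext.pp_le_half hsym _ y) (pp_nonneg _ _) pr_le_one (by positivity)
    (by rw [div_le_one (by positivity)]; linarith) (by positivity)
    (by rw [div_le_one (by positivity)]; linarith) hc0 (hcq.trans hq1)
    (by rw [show 2 * (1 / ((n : ℝ) + 1) ^ 2) = 2 / ((n : ℝ) + 1) ^ 2 by ring]; exact h1)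
  have h4 : pp (F (t y)) y * c ≤ C / ((n : ℝ) + 1) * (MM m * (C / ((n : ℝ) + 1))) := by
    refine mul_le_mul (hp.low y _ (hp.ne y).symm) (hcq.trans ?_) hc0 (by positivity)
    rw [div_eq_mul_one_div]
    refine mul_le_mul haM ?_ (by positivity) (Nat.cast_nonneg _)
    rw [div_le_div_iff₀ (by positivity) hN0]
    have := hp.cells k j ha
    nlinarith
  have h5 : C / ((n : ℝ) + 1) * (MM m * (C / ((n : ℝ) + 1))) = MM m * C ^ 2 / ((n : ℝ) + 1) ^ 2 := by
    field_simp
  have h6 : 2 * (ℓ * C / ((n : ℝ) + 1) ^ 2 + 1 / ((n : ℝ) + 1) ^ 2) =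
      2 * (ℓ * C + 1) / ((n : ℝ) + 1) ^ 2 := by ring
  rw [h5] at h4
  rw [h6] at h3
  rw [add_div, add_div]
  linarith

/-- Points of the cell over `(k, j)` have total density at most `m k j`. -/
lemma Placed.sum_pp_cell_le (hp : Placed m F h t a C) {k j : Fin ℓ} (hkj : k ≠ j) :
    ∑ y ∈ cell h t k j, pp (F k) y ≤ m k j := by
  have hf : (0 : ℝ) < (F k).card := by exact_mod_cast hp.ext.card_pos k
  refine le_of_mul_le_mul_right ?_ hf
  rw [sum_mul]
  have h1 : ∀ y ∈ cell h t k j, pp (F k) y * (F k).card = ((F k).filter (y ∈ ·)).card := fun y _ =>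
    pr_mul_card (P := (y ∈ ·))
  rw [sum_congr rfl h1]
  have h2 : ∑ y ∈ cell h t k j, ((F k).filter (y ∈ ·)).card = ∑ A ∈ F k, (A ∩ cell h t k j).card := by
    have e : ∀ A : Finset (Fin n), (A ∩ cell h t k j).card = ∑ y ∈ cell h t k j, if y ∈ A then 1 else 0 := by
      intro A
      rw [← card_filter, inter_comm, filter_mem_eq_inter]
    simp only [e, card_filter]
    exact sum_comm
  have h3 : ∑ A ∈ F k, (A ∩ cell h t k j).card ≤ (F k).card * m k j := by
    rw [← smul_eq_mul]
    refine sum_le_card_nsmul _ _ _ fun A hA => ?_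
    exact (card_le_card (inter_subset_inter le_rfl fun z hz => mem_inn.2 (mem_cell.1 hz).2)).trans
      (hp.trace k j hkj A hA)
  rw [← h2] at h3
  rw [mul_comm]
  exact_mod_cast h3

lemma sum_card_cell (h t : Fin n → Fin ℓ) : ∑ k, ∑ j, (cell h t k j).card = n := by
  have h1 := card_eq_sum_card_fiberwise (f := fun y => (t y, h y)) (s := univ) (t := univ)
    (fun _ _ => mem_univ _)
  rw [card_univ, Fintype.card_fin, ← univ_product_univ, sum_product] at h1
  refine Eq.trans (sum_congr rfl fun k _ => sum_congr rfl fun j _ => ?_) h1.symm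
  congr 1
  ext y
  simp

lemma Profile.sum_a (hp : Profile m F h t a C) : ∑ k, ∑ j, a k j = tot m := by
  have h1 : ∑ k, ∑ j, a k j = ∑ k, ∑ j, ((if k < j then a k j else 0) + if j < k then a k j else 0) := by
    refine sum_congr rfl fun k _ => sum_congr rfl fun j _ => ?_
    rcases lt_trichotomy k j with g | g | g
    · rw [if_pos g, if_neg g.not_gt, add_zero]
    · rw [g, hp.diag j]; simp
    · rw [if_pos g, if_neg g.not_gt, zero_add]
  have h2 : ∑ k, ∑ j, (if j < k then a k j else 0) = ∑ k, ∑ j, if k < j then a j k else 0 := sum_comm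
  rw [h1]
  simp only [sum_add_distrib]
  rw [h2, ← sum_add_distrib]
  simp only [← sum_add_distrib]
  unfold tot pairs
  rw [sum_filter, ← univ_product_univ, sum_product]
  refine sum_congr rfl fun k _ => sum_congr rfl fun j _ => ?_
  by_cases g : k < j
  · rw [if_pos g, if_pos g, if_pos g, hp.sum k j g.ne]
  · rw [if_neg g, if_neg g, if_neg g, add_zero]

end

section
variable {n ℓ : ℕ} {m : Fin ℓ → Fin ℓ → ℕ} {F : Fin ℓ → Finset (Finset (Fin n))}
  {h t : Fin n → Fin ℓ} {C : ℝ} {a : Fin ℓ → Fin ℓ → ℕ}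

lemma Placed.card_cell_mul_le (hp : Placed m F h t a C) {D : ℝ} (hD : 0 ≤ D)
    (hpt : ∀ k j, 0 < a k j → ∀ y, (a k j : ℝ) / (cell h t k j).card ≤
      pp (F (t y)) y + D / ((n : ℝ) + 1) ^ 2) {k j : Fin ℓ} (ha : 0 < a k j) (k' j' : Fin ℓ) :
    ((cell h t k j).card : ℝ) * a k' j' ≤ a k j * (cell h t k' j').card + D := by
  have hN0 : (0 : ℝ) < (n : ℝ) + 1 := by positivity
  rcases Nat.eq_zero_or_pos (a k' j') with h0 | h0
  · rw [h0, Nat.cast_zero, mul_zero]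
    positivity
  obtain ⟨hkj, ham⟩ := hp.eq_of_pos ha
  have hs0 : (0 : ℝ) < (cell h t k' j').card := by
    by_contra hcon
    have h1 := hp.cells k' j' h0
    have h2 : ((cell h t k' j').card : ℝ) = 0 := le_antisymm (not_lt.1 hcon) (Nat.cast_nonneg _)
    rw [h2, mul_zero] at h1
    linarith
  have h1 : ∀ y ∈ cell h t k j, (a k' j' : ℝ) / (cell h t k' j').card ≤
      pp (F k) y + D / ((n : ℝ) + 1) ^ 2 := fun y hy => by
    have := hpt k' j' h0 y
    rwa [(mem_cell.1 hy).1] at this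
  have h2 := sum_le_sum h1
  rw [sum_add_distrib, sum_const, sum_const, nsmul_eq_mul, nsmul_eq_mul] at h2
  have h3 := h2.trans (add_le_add_left (hp.sum_pp_cell_le hkj) _)
  have h4 := mul_le_mul_of_nonneg_right h3 hs0.le
  have h5 : ((cell h t k j).card : ℝ) * (D / ((n : ℝ) + 1) ^ 2) * (cell h t k' j').card ≤ D := by
    calc _ ≤ ((n : ℝ) + 1) * (D / ((n : ℝ) + 1) ^ 2) * ((n : ℝ) + 1) :=
          mul_le_mul (mul_le_mul_of_nonneg_right (cell_card_le k j) (by positivity))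
            (cell_card_le k' j') (Nat.cast_nonneg _) (by positivity)
      _ = D := by field_simp
  have h6 : ((cell h t k j).card : ℝ) * ((a k' j' : ℝ) / (cell h t k' j').card) *
      (cell h t k' j').card = (cell h t k j).card * a k' j' := by
    rw [mul_assoc, div_mul_cancel₀ _ hs0.ne']
  rw [h6, ← ham, add_mul] at h4
  linarith

lemma Placed.abs_card_cell_sub_le (hp : Placed m F h t a C) {D : ℝ} (hD : 0 ≤ D)
    (hpt : ∀ k j, 0 < a k j → ∀ y, (a k j : ℝ) / (cell h t k j).card ≤
      pp (F (t y)) y + D / ((n : ℝ) + 1) ^ 2) {k j : Fin ℓ} (ha : 0 < a k j) :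
    |((cell h t k j).card : ℝ) - m k j * n / (tot m : ℕ)| ≤ ℓ * (ℓ * D) := by
  have htot : 1 ≤ tot m := by
    rw [← hp.sum_a]
    exact ha.trans_le ((single_le_sum (f := fun j => a k j) (fun _ _ => Nat.zero_le _) (mem_univ j)).trans
      (single_le_sum (f := fun k => ∑ j, a k j) (fun _ _ => Nat.zero_le _) (mem_univ k)))
  have htot' : (1 : ℝ) ≤ tot m := by exact_mod_cast htot
  have htot0 : (0 : ℝ) < tot m := by linarith
  have h1 : ∀ k' j', ((cell h t k j).card : ℝ) * a k' j' ≤ a k j * (cell h t k' j').card + D :=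
    hp.card_cell_mul_le hD hpt ha
  have h2 : ∀ k' j', (a k j : ℝ) * (cell h t k' j').card ≤ (cell h t k j).card * a k' j' + D := by
    intro k' j'
    rcases Nat.eq_zero_or_pos (a k' j') with h0 | h0
    · rw [hp.empty k' j' h0, card_empty, Nat.cast_zero, mul_zero]
      exact add_nonneg (mul_nonneg (Nat.cast_nonneg _) (Nat.cast_nonneg _)) hD
    · have := hp.card_cell_mul_le hD hpt h0 k j
      linarith
  have e1 : ∑ k', ∑ j', ((a k' j' : ℕ) : ℝ) = tot m := by exact_mod_cast hp.sum_a
  have e2 : ∑ k' : Fin ℓ, ∑ j', ((cell h t k' j').card : ℝ) = n := by exact_mod_cast sum_card_cell h t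
  have e3 : ∑ _k' : Fin ℓ, ∑ _j' : Fin ℓ, D = ℓ * (ℓ * D) := by simp
  have h3 := sum_le_sum (s := univ) fun k' _ => sum_le_sum (s := univ) fun j' _ => h1 k' j'
  have h4 := sum_le_sum (s := univ) fun k' _ => sum_le_sum (s := univ) fun j' _ => h2 k' j'
  simp only [sum_add_distrib, ← mul_sum, e1, e2] at h3 h4
  rw [sum_const, sum_const, card_univ, Fintype.card_fin, nsmul_eq_mul, nsmul_eq_mul] at h3 h4
  rw [← (hp.eq_of_pos ha).2]
  have h5 : ((cell h t k j).card : ℝ) - a k j * n / (tot m : ℕ) =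
      ((cell h t k j).card * tot m - a k j * n) / tot m := by
    field_simp
  have h6 : |((cell h t k j).card : ℝ) * tot m - a k j * n| ≤ ℓ * (ℓ * D) := by
    rw [abs_le]
    constructor <;> linarith
  rw [h5, abs_div, abs_of_pos htot0]
  exact (div_le_self (abs_nonneg _) htot').trans h6

lemma exists_card_cell {ℓ : ℕ} (m : Fin ℓ → Fin ℓ → ℕ) (hsym : ∀ k1 k2, m k1 k2 = m k2 k1)
    {C : ℝ} (hC : 1 ≤ C) :
    ∃ C' : ℝ, 0 < C' ∧ ∀ᶠ n : ℕ in atTop, ∀ (F : Fin ℓ → Finset (Finset (Fin n))) (h t a),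
      Placed m F h t a C → (∀ k, St h t a k ⊆ F k) ∧ ∀ k j, 0 < a k j →
        |((cell h t k j).card : ℝ) - m k j * n / (tot m : ℕ)| ≤ C' := by
  have hC0 : 0 < C := by linarith
  obtain ⟨D, hD⟩ : ∃ D : ℝ, D = MM m * C ^ 2 + 2 * (ℓ * C + 1) +
      ((MM m : ℝ) ^ 2 * C ^ 2 + 2 * C ^ 2 * MM m) := ⟨_, rfl⟩
  have hD0 : 0 ≤ D := by rw [hD]; positivity
  refine ⟨ℓ * (ℓ * D) + 1, by positivity, ?_⟩
  filter_upwards [exists_St_subset m hsym hC, ev_le (2 * C), ev_le (ℓ * C), ev_le (8 * C * MM m),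
    exp_small (MM m + 2) (c := 1 / C) (ε := 1) (by positivity) one_pos]
    with n hSt h2 hℓ h8 hexp F h t a hp
  refine ⟨hSt F h t a hp, fun k j ha => ?_⟩
  refine (hp.abs_card_cell_sub_le hD0 (fun k' j' ha' y => ?_) ha).trans (le_add_of_nonneg_right zero_le_one)
  have hcell := hp.cells k' j' ha'
  rw [hD]
  refine hp.pp_arc_ge hsym hC0.le h2 hℓ ha' ?_ (hSt F h t a hp k') (hexp _ ?_) y
  · have haM : a k' j' ≤ MM m := by
      rw [(hp.eq_of_pos ha').2]
      exact le_MM m k' j'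
    have haM' : (a k' j' : ℝ) ≤ MM m := by exact_mod_cast haM
    have h3 : (8 : ℝ) * MM m ≤ (cell h t k' j').card := by
      refine le_of_mul_le_mul_left ?_ hC0
      linarith
    have h4 : (8 : ℝ) * a k' j' ≤ (cell h t k' j').card := by linarith
    exact_mod_cast h4
  · rw [one_div, inv_mul_le_iff₀ hC0]
    exact hcell

lemma exists_structure {ℓ : ℕ} (hℓ : 2 ≤ ℓ) (m : Fin ℓ → Fin ℓ → ℕ)
    (hsym : ∀ k1 k2, m k1 k2 = m k2 k1) (hnz : ∃ k1 k2 : Fin ℓ, k1 ≠ k2 ∧ 0 < m k1 k2) :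
    ∃ C C' : ℝ, 0 < C' ∧ ∀ᶠ n : ℕ in atTop, ∀ F : Fin ℓ → Finset (Finset (Fin n)), Extremal m F →
      ∃ h t a, Placed m F h t a C ∧ (∀ k, St h t a k ⊆ F k) ∧ ∀ k j, 0 < a k j →
        |((cell h t k j).card : ℝ) - m k j * n / (tot m : ℕ)| ≤ C' := by
  obtain ⟨C₁, h₁, e₁⟩ := exists_good hℓ m hsym
  obtain ⟨C₂, h₂, e₂⟩ := exists_closed m hsym h₁
  obtain ⟨C₃, h₃, e₃⟩ := exists_profile hℓ m hsym h₂
  obtain ⟨C₄, h₄, e₄⟩ := exists_oriented m hsym h₃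
  obtain ⟨C₅, h₅, e₅⟩ := exists_placed m hsym hnz h₄
  obtain ⟨C', h', e'⟩ := exists_card_cell m hsym (C := C₅ + 1) (by linarith)
  refine ⟨C₅ + 1, C', h', ?_⟩
  filter_upwards [e₁, e₂, e₃, e₄, e₅, e'] with n e₁ e₂ e₃ e₄ e₅ e' F hF
  obtain ⟨h, t, hg⟩ := e₁ F hF
  obtain ⟨a, hp⟩ := e₃ F h t (e₂ F h t hg)
  have hp' := (e₅ F h t a (e₄ F h t a hp)).mono (le_add_of_nonneg_right zero_le_one)
  exact ⟨h, t, a, hp', e' F h t a hp'⟩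

end

end

/-- structure of the extremal example, Theorem 4 of the paper.
For fixed `ℓ ≥ 2` and symmetric not-all-zero `𝐦` with `σ = Σ_S 𝐦_S`, there are `C > 0`
and `N` such that for all `n ≥ N` and every extremal `𝐦`-overlapping tuple `𝓕` on `[n]`
there are an oriented graph `E` on `[ℓ]` whose underlying edges are exactly the pairs
with `𝐦 > 0`, and pairwise disjoint sets `A_e ⊆ [n]` indexed by the arcs, covering `[n]`,
such that `| |A_e| − 𝐦_S·n/σ | ≤ C` for every arc `e` over the pair `S`, and every set
`B ∪ T'` with `B` inside the incoming `A`-sets of `k` and `T'` inside the outgoing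
`A`-sets of `k` meeting each `A_{(k,k')}` in at most `𝐦_{k,k'}` elements lies in `𝓕_k`. -/
theorem extremal_structure (ℓ : ℕ) (hℓ : 2 ≤ ℓ) (m : Fin ℓ → Fin ℓ → ℕ)
    (hsym : ∀ k1 k2, m k1 k2 = m k2 k1)
    (hnz : ∃ k1 k2 : Fin ℓ, k1 ≠ k2 ∧ 0 < m k1 k2) :
    ∃ C : ℝ, 0 < C ∧ ∃ N : ℕ, ∀ n : ℕ, N ≤ n →
      ∀ F : Fin ℓ → Finset (Finset (Fin n)), Extremal m F →
        ∃ E : Fin ℓ → Fin ℓ → Bool,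
          (∀ k1 k2 : Fin ℓ, (E k1 k2 = true ∨ E k2 k1 = true) ↔ (k1 ≠ k2 ∧ 0 < m k1 k2)) ∧
          (∀ k1 k2 : Fin ℓ, ¬ (E k1 k2 = true ∧ E k2 k1 = true)) ∧
          ∃ A : Fin ℓ → Fin ℓ → Finset (Fin n),
            (∀ k1 k2 k1' k2' : Fin ℓ, E k1 k2 = true → E k1' k2' = true →
              (k1, k2) ≠ (k1', k2') → Disjoint (A k1 k2) (A k1' k2')) ∧
            (∀ x : Fin n, ∃ k1 k2 : Fin ℓ, E k1 k2 = true ∧ x ∈ A k1 k2) ∧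
            (∀ k1 k2 : Fin ℓ, E k1 k2 = true →
              |((A k1 k2).card : ℝ) -
                  (m k1 k2 : ℝ) * n / ((∑ q ∈ pairs ℓ, m q.1 q.2 : ℕ) : ℝ)| ≤ C) ∧
            (∀ k : Fin ℓ, ∀ B T' : Finset (Fin n),
              B ⊆ (Finset.univ.filter (fun k' => E k' k = true)).biUnion (fun k' => A k' k) →
              T' ⊆ (Finset.univ.filter (fun k' => E k k' = true)).biUnion (fun k' => A k k') →
              (∀ k' : Fin ℓ, E k k' = true → (T' ∩ A k k').card ≤ m k k') →
              B ∪ T' ∈ F k) := by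
  obtain ⟨C, C', hC', hev⟩ := exists_structure hℓ m hsym hnz
  obtain ⟨N, hN⟩ := Filter.eventually_atTop.1 hev
  refine ⟨C', hC', N, fun n hn F hF => ?_⟩
  obtain ⟨h, t, a, hp, hS, hcard⟩ := hN n hn F hF
  have hE : ∀ k j, decide (0 < a k j) = true ↔ 0 < a k j := fun k j => decide_eq_true_iff
  refine ⟨fun k j => decide (0 < a k j), fun k j => ?_, fun k j => ?_, cell h t,
    fun k j k' j' _ _ hne => ?_, fun x => ⟨t x, h x, ?_, mem_cell.2 ⟨rfl, rfl⟩⟩,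
    fun k j hkj => hcard k j ((hE k j).1 hkj), fun k B T hB hT hTm => ?_⟩
  · rw [hE, hE]
    constructor
    · rintro (h0 | h0)
      · obtain ⟨h1, h2⟩ := hp.eq_of_pos h0
        exact ⟨h1, h2 ▸ h0⟩
      · obtain ⟨h1, h2⟩ := hp.eq_of_pos h0
        exact ⟨h1.symm, hsym k j ▸ h2 ▸ h0⟩
    · rintro ⟨h1, h2⟩
      have := hp.sum k j h1
      omega
  · rw [hE, hE]
    have := hp.orient k j
    omega
  · rw [Finset.disjoint_left]
    intro x hx hx'
    rw [mem_cell] at hx hx'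
    exact hne (by rw [← hx.1, ← hx.2, ← hx'.1, ← hx'.2])
  · rw [hE]
    by_contra hcon
    have h1 : x ∈ cell h t (t x) (h x) := mem_cell.2 ⟨rfl, rfl⟩
    rw [hp.empty _ _ (by omega)] at h1
    exact Finset.notMem_empty _ h1
  · have hBk : ∀ y ∈ B, h y = k := fun y hy => by
      obtain ⟨k', _, hy'⟩ := Finset.mem_biUnion.1 (hB hy)
      exact (mem_cell.1 hy').2
    have hTk : ∀ y ∈ T, t y = k := fun y hy => by
      obtain ⟨k', _, hy'⟩ := Finset.mem_biUnion.1 (hT hy)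
      exact (mem_cell.1 hy').1
    refine hS k (mem_St.2 ⟨fun y hy => ?_, fun j => ?_⟩)
    · exact (Finset.mem_union.1 hy).imp (hBk y) (hTk y)
    · rcases Nat.eq_zero_or_pos (a k j) with h0 | h0
      · rw [hp.empty k j h0]; simp
      · rw [(hp.eq_of_pos h0).2]
        refine (Finset.card_le_card fun y hy => ?_).trans (hTm j ((hE k j).2 h0))
        rw [Finset.mem_inter, Finset.mem_union] at hy
        refine Finset.mem_inter.2 ⟨hy.1.resolve_left fun hyB => ?_, hy.2⟩
        exact hp.ne y ((hBk y hyB).trans (mem_cell.1 hy.2).1.symm)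

end
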